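/- Let h ∈ (0,1], ε ∈ (0,1/(2N)), and w ∈ ℝᴺ with wⁱ ∈ [0,1] for all i and Σ_i wⁱ ≥ 1. Then there is a constant C > 0, depending only on n, N, α, X, Y, c and μ, such that ‖w_{h,ε}‖_{C^{1,α}(𝒩̄_{w,h,ε})} ≤ C · max( h^{-2} ε^{-2}, h^{-3} ε^{-1/2} ), where ‖Φ‖_{C^{1,α}(Ω̄)} := sup_{ψ∈Ω} ‖Φ(ψ)‖ + sup_{ψ∈Ω} ‖DΦ(ψ)‖ + sup_{ψ₁≠ψ₂∈Ω} ‖DΦ(ψ₁) − DΦ(ψ₂)‖/‖ψ₁ − ψ₂‖^α (operator norms for DΦ). -/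

import Mathlib

open MeasureTheory Metric Set Filter
open scoped Classical

noncomputable section

abbrev Pt (n : ℕ) := EuclideanSpace ℝ (Fin n)

/-- The function `g(t) = 2(1 + t² − t√(1+t²))`. -/
def gfun (t : ℝ) : ℝ := 2 * (1 + t ^ 2 - t * Real.sqrt (1 + t ^ 2))

variable {n N : ℕ}

/-- The `i`-th Laguerre cell associated to `ψ`. -/
def LagCell (X : Set (Pt n)) (c : Pt n → Fin N → ℝ) (ψ : Fin N → ℝ) (i : Fin N) :
    Set (Pt n) :=
  {x ∈ X | -c x i - ψ i = ⨆ j, (-c x j - ψ j)}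

/-- `G(ψ) = (μ(Lag_1(ψ)),…,μ(Lag_N(ψ)))`. -/
def Gfun (X : Set (Pt n)) (c : Pt n → Fin N → ℝ) (μ : Measure (Pt n)) (ψ : Fin N → ℝ)
    (i : Fin N) : ℝ := (μ (LagCell X c ψ i)).toReal

/-- `𝒦^ε = {ψ : Gⁱ(ψ) > ε for all i}`. -/
def Kset (X : Set (Pt n)) (c : Pt n → Fin N → ℝ) (μ : Measure (Pt n)) (ε : ℝ) :
    Set (Fin N → ℝ) := {ψ | ∀ i, ε < Gfun X c μ ψ i}

/-- `wⁱ_{h,ε}(ψ) = (Gⁱ(ψ) − ε)·g(ψⁱ/h)`. -/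
def wmap (X : Set (Pt n)) (c : Pt n → Fin N → ℝ) (μ : Measure (Pt n)) (h ε : ℝ)
    (ψ : Fin N → ℝ) : Fin N → ℝ := fun i => (Gfun X c μ ψ i - ε) * gfun (ψ i / h)

/-- `𝒩_{w,h,ε} = {ψ ∈ 𝒦^ε : Σ wⁱ = Σ wⁱ_{h,ε}(ψ)}`. -/
def Nset (X : Set (Pt n)) (c : Pt n → Fin N → ℝ) (μ : Measure (Pt n)) (h ε : ℝ)
    (w : Fin N → ℝ) : Set (Fin N → ℝ) :=
  {ψ ∈ Kset X c μ ε | ∑ i, w i = ∑ i, wmap X c μ h ε ψ i}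

/-- `𝒲^{ε₀} = {ψ : wⁱ_{h,ε}(ψ) ≥ ε₀ for all i}`. -/
def Wset (X : Set (Pt n)) (c : Pt n → Fin N → ℝ) (μ : Measure (Pt n)) (h ε ε₀ : ℝ) :
    Set (Fin N → ℝ) := {ψ | ∀ i, ε₀ ≤ wmap X c μ h ε ψ i}

/-- Euclidean (ℓ²) norm on `ℝᴺ`. -/
def eNorm2 (v : Fin N → ℝ) : ℝ := Real.sqrt (∑ i, v i ^ 2)

/-- ℓ¹ norm on `ℝᴺ`. -/
def l1Norm (v : Fin N → ℝ) : ℝ := ∑ i, |v i|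

/-- `T_#μ = Σ βⁱ δ_{y_i}`, with target points recorded by their indices. -/
def IsPush (μ : Measure (Pt n)) (T : Pt n → Fin N) (β : Fin N → ℝ) : Prop :=
  ∀ i, μ (T ⁻¹' {i}) = ENNReal.ofReal (β i)

/-- `(T,β)` minimizes the optimal transport problem with storage fee `F`. -/
def MinimizesStorage (c : Pt n → Fin N → ℝ) (μ : Measure (Pt n))
    (F : (Fin N → ℝ) → EReal) (T : Pt n → Fin N) (β : Fin N → ℝ) : Prop :=
  Measurable T ∧ IsPush μ T β ∧
    ∀ (T' : Pt n → Fin N) (β' : Fin N → ℝ), Measurable T' → IsPush μ T' β' →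
      ((∫ x, c x (T x) ∂μ : ℝ) : EReal) + F β ≤ ((∫ x, c x (T' x) ∂μ : ℝ) : EReal) + F β'

/-- The storage fee `F_w`: indicator of the box `Π [0, wⁱ]`. -/
def Fw (w β : Fin N → ℝ) : EReal := if ∀ i, β i ∈ Icc 0 (w i) then 0 else ⊤

/-- The standard simplex `Δ_N`. -/
def simplexSet (N : ℕ) : Set (Fin N → ℝ) := {β | ∑ i, β i = 1 ∧ ∀ i, 0 ≤ β i}

/-- The smoothed storage fee `F_{w,h,ε}`. -/
def Fwhe (w : Fin N → ℝ) (h ε : ℝ) (β : Fin N → ℝ) : EReal :=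
  if β ∈ simplexSet N ∧ ∀ i, β i ∈ Icc ε (w i + ε) then
    (((-h) * ∑ i, Real.sqrt ((β i - ε) * (w i - β i + ε)) : ℝ) : EReal)
  else ⊤

/-- (Reg): each `c(·,y_i)` is `C²` on `X`. -/
def RegCond (X : Set (Pt n)) (c : Pt n → Fin N → ℝ) : Prop :=
  ∀ i, ContDiffOn ℝ 2 (fun x => c x i) X

/-- (Twist): the gradients `∇_x c(x,y_i)` are pairwise distinct. -/
def TwistCond (X : Set (Pt n)) (c : Pt n → Fin N → ℝ) : Prop :=
  ∀ x ∈ X, ∀ i k : Fin N, i ≠ k →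
    fderivWithin ℝ (fun y => c y i) X x ≠ fderivWithin ℝ (fun y => c y k) X x

/-- Loeper's condition (QC), together with `c`-convexity of `X` with respect to `Y`. -/
def LoeperCond (X : Set (Pt n)) (c : Pt n → Fin N → ℝ) : Prop :=
  ∃ (Xi : Fin N → Set (Pt n)) (expc iexpc : Fin N → Pt n → Pt n),
    ∀ i, Convex ℝ (Xi i) ∧ ContDiffOn ℝ 2 (expc i) (Xi i) ∧
      ContDiffOn ℝ 2 (iexpc i) X ∧ Set.BijOn (expc i) (Xi i) X ∧
      Set.InvOn (iexpc i) (expc i) (Xi i) X ∧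
      ∀ (t : ℝ) (k : Fin N), Convex ℝ {p ∈ Xi i | -c (expc i p) k + c (expc i p) i ≤ t}

/-- `μ = ρ dx` for a `C^{0,α}` density `ρ`. -/
def HolderDensity (X : Set (Pt n)) (μ : Measure (Pt n)) (α : ℝ) : Prop :=
  ∃ ρ : Pt n → ℝ, μ = volume.withDensity (fun x => ENNReal.ofReal (ρ x)) ∧
    ContinuousOn ρ X ∧ ∃ Cρ : ℝ, ∀ x ∈ X, ∀ y ∈ X, |ρ x - ρ y| ≤ Cρ * ‖x - y‖ ^ α

/-- `(q,1)`-Poincaré–Wirtinger inequality with constant `CPW`. -/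
def PWineq (μ : Measure (Pt n)) (q CPW : ℝ) : Prop :=
  ∀ f : Pt n → ℝ, ContDiff ℝ 1 f →
    (∫ x, |f x - ∫ y, f y ∂μ| ^ q ∂μ) ^ (1 / q) ≤ CPW * ∫ x, ‖fderiv ℝ f x‖ ∂μ

/-- `T` agrees `μ`-a.e. with the Laguerre-cell map `T_ψ`. -/
def AgreesAE (X : Set (Pt n)) (c : Pt n → Fin N → ℝ) (μ : Measure (Pt n))
    (ψ : Fin N → ℝ) (T : Pt n → Fin N) : Prop :=
  ∀ᵐ x ∂μ, x ∈ LagCell X c ψ (T x)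

/-- The Kantorovich transport-cost functional `𝒞`. -/
def Cfun (c : Pt n → Fin N → ℝ) (μ : Measure (Pt n)) (β : Fin N → ℝ) : ℝ :=
  ⨆ ψ : Fin N → ℝ, (-(∫ x, (⨆ i, (-c x i - ψ i)) ∂μ) - ∑ i, ψ i * β i)

/-- One step of the damped Newton algorithm with parameters `h, ε, ε₀, w`. -/
def NewtonIter (X : Set (Pt n)) (c : Pt n → Fin N → ℝ) (μ : Measure (Pt n))
    (h ε ε₀ : ℝ) (w : Fin N → ℝ) (ψ ψ' : Fin N → ℝ) : Prop :=
  ∃ A : (Fin N → ℝ) ≃L[ℝ] (Fin N → ℝ),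
    (A : (Fin N → ℝ) →L[ℝ] (Fin N → ℝ)) = fderiv ℝ (wmap X c μ h ε) ψ ∧
    ∃ (ℓ : ℕ) (r : ℝ),
      ψ' = ψ - ((2 : ℝ)⁻¹ ^ ℓ) • A.symm (wmap X c μ h ε ψ - w) + r • (fun _ => (1 : ℝ)) ∧
      ψ' ∈ Nset X c μ h ε w ∧ (∀ i, ε₀ ≤ wmap X c μ h ε ψ' i) ∧
      eNorm2 (wmap X c μ h ε ψ' - w) ≤
        (1 - (2 : ℝ)⁻¹ ^ (ℓ + 1)) * eNorm2 (wmap X c μ h ε ψ - w) ∧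
      ∀ ℓ' < ℓ, ∀ r' : ℝ,
        (ψ - ((2 : ℝ)⁻¹ ^ ℓ') • A.symm (wmap X c μ h ε ψ - w) + r' • (fun _ => (1 : ℝ)))
          ∈ Nset X c μ h ε w →
        ¬((∀ i, ε₀ ≤ wmap X c μ h ε
              (ψ - ((2 : ℝ)⁻¹ ^ ℓ') • A.symm (wmap X c μ h ε ψ - w)
                + r' • (fun _ => (1 : ℝ))) i) ∧
          eNorm2 (wmap X c μ h ε
              (ψ - ((2 : ℝ)⁻¹ ^ ℓ') • A.symm (wmap X c μ h ε ψ - w)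
                + r' • (fun _ => (1 : ℝ))) - w) ≤
            (1 - (2 : ℝ)⁻¹ ^ (ℓ' + 1)) * eNorm2 (wmap X c μ h ε ψ - w))


section

lemma lemSec {m : ℕ} (R θ : ℝ) (hR : 0 ≤ R) (j : Fin (m+1)) (B : Set (Fin (m+1) → ℝ))
    (hBc : IsClosed B) (hB : B ⊆ closedBall 0 R)
    (hs : ∀ y ∈ B, ∀ y' ∈ B, (∀ l, l ≠ j → y l = y' l) → |y j - y' j| ≤ θ) :
    volume B ≤ ENNReal.ofReal θ * ENNReal.ofReal ((2*R)^m) := by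
  have hmp := volume_preserving_piFinSuccAbove (fun _ : Fin (m+1) => ℝ) j
  have hmp' := hmp.symm
  have hBm := hBc.measurableSet
  rw [← hmp'.measure_preimage hBm.nullMeasurableSet]
  have hm2 : MeasurableSet ((MeasurableEquiv.piFinSuccAbove (fun _ : Fin (m+1) => ℝ) j).symm ⁻¹' B) :=
    (MeasurableEquiv.measurable _) hBm
  rw [Measure.volume_eq_prod, Measure.prod_apply_symm hm2]
  have hins : ∀ (a : ℝ) (y : Fin m → ℝ), (MeasurableEquiv.piFinSuccAbove (fun _ : Fin (m+1) => ℝ) j).symm (a, y)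
      = Fin.insertNth (α := fun _ => ℝ) j a y := fun a y => rfl
  have key : ∀ y : Fin m → ℝ, volume ((fun x : ℝ => (x, y)) ⁻¹'
      ((MeasurableEquiv.piFinSuccAbove (fun _ : Fin (m+1) => ℝ) j).symm ⁻¹' B)) ≤
      (closedBall (0 : Fin m → ℝ) R).indicator (fun _ => ENNReal.ofReal θ) y := by
    intro y
    by_cases hy : y ∈ closedBall (0 : Fin m → ℝ) R
    · rw [indicator_of_mem hy]
      refine (Real.volume_le_diam _).trans ?_
      refine ediam_le ?_
      intro a ha b hb
      have := hs _ ha _ hb (by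
        intro l hl
        obtain ⟨l', rfl⟩ := Fin.exists_succAbove_eq hl
        rw [hins, hins]; simp)
      rw [edist_dist]
      apply ENNReal.ofReal_le_ofReal
      rw [hins, hins] at this
      simpa [Real.dist_eq] using this
    · rw [indicator_of_notMem hy]
      have : ((fun x : ℝ => (x, y)) ⁻¹'
        ((MeasurableEquiv.piFinSuccAbove (fun _ : Fin (m+1) => ℝ) j).symm ⁻¹' B)) = ∅ := by
        ext x
        simp only [mem_preimage, mem_empty_iff_false, iff_false]
        intro hx
        apply hy
        have h1 := hB hx
        rw [mem_closedBall_zero_iff] at h1 ⊢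
        rw [pi_norm_le_iff_of_nonneg hR] at h1 ⊢
        intro l
        have := h1 (j.succAbove l)
        rw [hins] at this
        simpa using this
      rw [this]; simp
  refine (lintegral_mono key).trans ?_
  rw [lintegral_indicator measurableSet_closedBall]
  simp only [lintegral_const, Measure.restrict_apply MeasurableSet.univ, univ_inter]
  gcongr
  rw [Real.volume_pi_closedBall _ hR]
  simp

lemma lemL {m : ℕ} (R M : ℝ) (hR : 0 < R) (hM : 0 < M) : ∃ C : ℝ, 0 ≤ C ∧
    ∀ (A : Set (Fin (m+1) → ℝ)) (κ : (Fin (m+1) → ℝ) → (Fin (m+1) → ℝ)) (η τ : ℝ),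
      0 < η → η ≤ 1 → 0 < τ → A ⊆ closedBall 0 R → (∀ y ∈ A, ‖κ y‖ ≤ M) →
      (∀ y ∈ A, ∃ j, η ≤ |κ y j|) →
      (∀ y ∈ A, ∀ y' ∈ A, ∑ j, κ y j * (y' j - y j) - M * ‖y' - y‖^2 ≤ τ) →
      volume A ≤ ENNReal.ofReal (C * τ / η^2) := by
  refine ⟨(m+1) * 2 * (8 * R * M + 2) * 2 * (2*R)^m, by positivity, ?_⟩
  intro A κ η τ hη hη1 hτ hAR hκM hκη hA
  -- pieces
  set r : ℝ := η / (2 * M) with hr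
  have hr0 : 0 < r := by positivity
  obtain ⟨Q, hQ⟩ : ∃ Q : ℕ, Q = ⌈2 * R / r⌉₊ + 1 := ⟨_, rfl⟩
  let B : Fin (m+1) → Bool → ℕ → Set (Fin (m+1) → ℝ) := fun j s q =>
    {y ∈ A | η ≤ (if s then 1 else -1) * κ y j ∧ -R + q * r ≤ y j ∧ y j ≤ -R + (q+1) * r}
  have hcover : A ⊆ ⋃ j : Fin (m+1), ⋃ s : Bool, ⋃ q ∈ Finset.range Q, closure (B j s q) := by
    intro y hy
    obtain ⟨j, hj⟩ := hκη y hy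
    have hyR : |y j| ≤ R := by
      have := hAR hy
      rw [mem_closedBall_zero_iff] at this
      exact (norm_le_pi_norm y j).trans this
    obtain ⟨h1, h2⟩ := abs_le.1 hyR
    have hq0 : 0 ≤ (y j + R) / r := div_nonneg (by linarith) hr0.le
    have hfl := Nat.floor_le hq0
    have hfl2 := Nat.lt_floor_add_one ((y j + R) / r)
    rw [le_div_iff₀ hr0] at hfl
    rw [div_lt_iff₀ hr0] at hfl2
    have hqQ : ⌊(y j + R) / r⌋₊ < Q := by
      rw [hQ, Nat.lt_succ_iff]
      refine (Nat.floor_le_ceil _).trans (Nat.ceil_le_ceil ?_)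
      gcongr; linarith
    simp only [mem_iUnion]
    refine ⟨j, decide (0 ≤ κ y j), ⌊(y j + R) / r⌋₊, Finset.mem_range.2 hqQ, subset_closure ⟨hy, ?_, by linarith, by linarith⟩⟩
    by_cases h : 0 ≤ κ y j
    · simp [h]; rwa [abs_of_nonneg h] at hj
    · simp [h]; rwa [abs_of_neg (not_le.1 h)] at hj
  have hB : ∀ j s q, volume (closure (B j s q)) ≤ ENNReal.ofReal (2 * τ / η) * ENNReal.ofReal ((2*R)^m) := by
    intro j s q
    refine lemSec R (2 * τ / η) hR.le j _ isClosed_closure ?_ ?_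
    · exact closure_minimal (fun y hy => hAR hy.1) isClosed_closedBall
    -- basic limit claim
    have hlim : ∀ z ∈ closure (B j s q), ∀ z' ∈ closure (B j s q), (∀ l, l ≠ j → z l = z' l) →
        0 ≤ (if s then 1 else -1) * (z' j - z j) →
        η * |z' j - z j| - M * |z' j - z j|^2 ≤ τ ∧ |z' j - z j| ≤ r := by
      intro z hz z' hz' heq hsgn
      obtain ⟨u, hu, hul⟩ := mem_closure_iff_seq_limit.1 hz
      obtain ⟨u', hu', hul'⟩ := mem_closure_iff_seq_limit.1 hz'
      have hz'z : z' - z = Pi.single j (z' j - z j) := by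
        ext l
        by_cases h : l = j
        · subst h; simp
        · simp [h, heq l h]
      have hnorm : ‖z' - z‖ = |z' j - z j| := by
        rw [hz'z, Pi.norm_single]; simp
      constructor
      · -- lower bound sequence
        have hd : Tendsto (fun k => u' k - u k) atTop (nhds (z' - z)) := hul'.sub hul
        have hdj : ∀ l, Tendsto (fun k => u' k l - u k l) atTop (nhds (z' l - z l)) := by
          intro l
          exact (tendsto_pi_nhds.1 hd l)
        have hL : Tendsto (fun k => η * ((if s then 1 else -1) * (u' k j - u k j))
            - ∑ l ∈ Finset.univ.erase j, M * |u' k l - u k l|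
            - 2 * M * |(u' k j - u k j) - (z' j - z j)|
            - M * ‖u' k - u k‖^2) atTop
            (nhds (η * ((if s then 1 else -1) * (z' j - z j))
            - ∑ l ∈ Finset.univ.erase j, M * |z' l - z l|
            - 2 * M * |(z' j - z j) - (z' j - z j)| - M * ‖z' - z‖^2)) := by
          refine Tendsto.sub (Tendsto.sub (Tendsto.sub ?_ ?_) ?_) ?_
          · exact ((hdj j).const_mul _).const_mul _
          · exact tendsto_finsetSum _ fun l _ => ((hdj l).abs).const_mul _
          · exact (((hdj j).sub_const _).abs).const_mul _
          · exact ((hd.norm).pow 2).const_mul _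
        have hs0 : ∑ l ∈ Finset.univ.erase j, M * |z' l - z l| = 0 := by
          apply Finset.sum_eq_zero
          intro l hl
          rw [heq l (Finset.ne_of_mem_erase hl)]; simp
        have habs : ((if s then (1:ℝ) else -1) * (z' j - z j)) = |z' j - z j| := by
          rw [← abs_of_nonneg hsgn, abs_mul]
          cases s <;> simp
        rw [hs0, hnorm, habs] at hL
        simp only [sub_zero, sub_self, abs_zero, mul_zero] at hL
        refine le_of_tendsto hL (Eventually.of_forall fun k => ?_)
        refine le_trans ?_ (hA (u k) (hu k).1 (u' k) (hu' k).1)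
        have hκb : ∀ l, |κ (u k) l| ≤ M := fun l =>
          (norm_le_pi_norm (κ (u k)) l).trans (hκM _ (hu k).1)
        rw [← Finset.add_sum_erase _ _ (Finset.mem_univ j)]
        have h1 : -∑ l ∈ Finset.univ.erase j, M * |u' k l - u k l| ≤
            ∑ l ∈ Finset.univ.erase j, κ (u k) l * (u' k l - u k l) := by
          rw [← Finset.sum_neg_distrib]
          apply Finset.sum_le_sum
          intro l _
          have : |κ (u k) l * (u' k l - u k l)| ≤ M * |u' k l - u k l| := by
            rw [abs_mul]; gcongr; exact hκb l
          linarith [neg_abs_le (κ (u k) l * (u' k l - u k l))]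
        have h2 : η * ((if s then 1 else -1) * (u' k j - u k j))
            - 2 * M * |(u' k j - u k j) - (z' j - z j)| ≤ κ (u k) j * (u' k j - u k j) := by
          set a := u' k j - u k j
          set b := z' j - z j
          have e1 : η ≤ (if s then 1 else -1) * κ (u k) j := (hu k).2.1
          have e2 := hκb j
          have e3 : (if s then (1:ℝ) else -1) * (if s then (1:ℝ) else -1) = 1 := by cases s <;> simp
          set sg : ℝ := if s then 1 else -1
          have e4 : |sg| = 1 := by
            have : sg = 1 ∨ sg = -1 := mul_self_eq_one_iff.1 e3
            rcases this with h | h <;> rw [h] <;> simp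
          have e5 : η ≤ M := e1.trans ((le_abs_self _).trans (by rw [abs_mul, e4, one_mul]; exact e2))
          have e6 : κ (u k) j * a = (sg * κ (u k) j) * (sg * a) := by
            linear_combination (-(κ (u k) j * a)) * e3
          have e7 : sg * a = sg * b + sg * (a - b) := by ring
          have e8 : |sg * (a - b)| = |a - b| := by rw [abs_mul, e4, one_mul]
          have e9 := abs_le.1 e8.le
          have e10 : sg * κ (u k) j ≤ M := (le_abs_self _).trans (by rw [abs_mul, e4, one_mul]; exact e2)
          rw [e6, e7]
          nlinarith [mul_nonneg (sub_nonneg.2 e1) hsgn, e9.1, e9.2, abs_nonneg (a-b),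
            mul_nonneg (sub_nonneg.2 e1) (sub_nonneg.2 e9.2), mul_nonneg (sub_nonneg.2 e1) (neg_le_iff_add_nonneg.1 e9.1),
            mul_nonneg (sub_nonneg.2 e10) (abs_nonneg (a-b)), mul_nonneg hη.le (abs_nonneg (a-b))]
        linarith
      · have hcl : ∀ z ∈ closure (B j s q), -R + q * r ≤ z j ∧ z j ≤ -R + (q+1) * r := by
          intro z hz
          have hc : IsClosed {z : Fin (m+1) → ℝ | -R + q * r ≤ z j ∧ z j ≤ -R + (q+1) * r} :=
            (isClosed_le continuous_const (continuous_apply j)).inter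
              (isClosed_le (continuous_apply j) continuous_const)
          exact closure_minimal (fun y hy => hy.2.2) hc hz
        have a1 := hcl z hz
        have a2 := hcl z' hz'
        rw [abs_le]; constructor <;> nlinarith
    have hfin : ∀ z ∈ closure (B j s q), ∀ z' ∈ closure (B j s q), (∀ l, l ≠ j → z l = z' l) →
        0 ≤ (if s then 1 else -1) * (z' j - z j) → |z' j - z j| ≤ 2 * τ / η := by
      intro z hz z' hz' heq hsgn
      obtain ⟨a1, a2⟩ := hlim z hz z' hz' heq hsgn
      rw [le_div_iff₀ hη]
      have : M * |z' j - z j| ≤ η / 2 := by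
        calc M * |z' j - z j| ≤ M * r := by gcongr
          _ = η / 2 := by rw [hr]; field_simp
      nlinarith [abs_nonneg (z' j - z j)]
    intro z hz z' hz' heq
    rcases le_total 0 ((if s then (1:ℝ) else -1) * (z' j - z j)) with h | h
    · rw [abs_sub_comm]; exact hfin z hz z' hz' heq h
    · exact hfin z' hz' z hz (fun l hl => (heq l hl).symm) (by linarith)
  calc volume A ≤ volume (⋃ j : Fin (m+1), ⋃ s : Bool, ⋃ q ∈ Finset.range Q, closure (B j s q)) :=
        measure_mono hcover
    _ ≤ ∑ j : Fin (m+1), ∑ s : Bool, ∑ q ∈ Finset.range Q,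
        ENNReal.ofReal (2 * τ / η) * ENNReal.ofReal ((2*R)^m) := by
        refine (measure_iUnion_fintype_le _ _).trans (Finset.sum_le_sum fun j _ => ?_)
        refine (measure_iUnion_fintype_le _ _).trans (Finset.sum_le_sum fun s _ => ?_)
        exact (measure_biUnion_finset_le _ _).trans (Finset.sum_le_sum fun q _ => hB j s q)
    _ = ENNReal.ofReal ((m+1) * 2 * Q * (2 * τ / η) * (2*R)^m) := by
        rw [← ENNReal.ofReal_mul (by positivity)]
        simp only [Finset.sum_const, Finset.card_range, Finset.card_univ, Fintype.card_bool, Fintype.card_fin, nsmul_eq_mul]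
        rw [← ENNReal.ofReal_natCast, ← ENNReal.ofReal_natCast, ← ENNReal.ofReal_natCast,
          ← ENNReal.ofReal_mul (by positivity), ← ENNReal.ofReal_mul (by positivity), ← ENNReal.ofReal_mul (by positivity)]
        congr 1; push_cast; ring
    _ ≤ _ := by
        apply ENNReal.ofReal_le_ofReal
        have hQ2 : (Q:ℝ) ≤ (8 * R * M + 2) / η := by
          have := (Nat.ceil_lt_add_one (show 0 ≤ 2 * R / r by positivity)).le
          rw [hQ]; push_cast
          have e : 2 * R / r = 4 * R * M / η := by rw [hr]; field_simp; ring
          rw [e] at this ⊢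
          have h2 : (2:ℝ) ≤ 2 / η := by rw [le_div_iff₀ hη]; linarith
          have : (8 * R * M + 2) / η = 8 * R * M / η + 2 / η := by ring
          have : 4 * R * M / η ≤ 8 * R * M / η := by gcongr; linarith
          linarith
        calc _ ≤ ((m:ℝ)+1) * 2 * ((8 * R * M + 2) / η) * (2 * τ / η) * (2*R)^m := by gcongr
          _ = _ := by field_simp
end

section
/-- Regular data on a convex body. -/
structure RegData {n N : ℕ} (P : Set (Pt n)) (f : Fin N → Pt n → ℝ)
    (Df : Fin N → Pt n → (Pt n →L[ℝ] ℝ)) (M : ℝ) : Prop where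
  comp : IsCompact P
  conv : Convex ℝ P
  inter : (interior P).Nonempty
  Mone : 1 ≤ M
  taylor : ∀ k, ∀ p ∈ P, ∀ q ∈ P, |f k q - f k p - Df k p (q - p)| ≤ M * ‖q - p‖ ^ 2
  lip : ∀ k, ∀ p ∈ P, ∀ q ∈ P, |f k q - f k p| ≤ M * ‖q - p‖
  lipD : ∀ k, ∀ p ∈ P, ∀ q ∈ P, ‖Df k q - Df k p‖ ≤ M * ‖q - p‖
  bddD : ∀ k, ∀ p ∈ P, ‖Df k p‖ ≤ M
  hasD : ∀ k, ∀ p ∈ P, HasFDerivWithinAt (f k) (Df k p) P p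

def cellSet {n N : ℕ} (i : Fin N) (P : Set (Pt n)) (f : Fin N → Pt n → ℝ) (t : Fin N → ℝ) :
    Set (Pt n) := {p ∈ P | ∀ k, k ≠ i → f k p ≤ t k}

def othSet {n N : ℕ} (i k : Fin N) (P : Set (Pt n)) (f : Fin N → Pt n → ℝ) (t : Fin N → ℝ) :
    Set (Pt n) := {p ∈ P | ∀ l, l ≠ i → l ≠ k → f l p ≤ t l}

def TransAt {n N : ℕ} (i k : Fin N) (P : Set (Pt n)) (f : Fin N → Pt n → ℝ)
    (Df : Fin N → Pt n → (Pt n →L[ℝ] ℝ)) (t : Fin N → ℝ) (δ η : ℝ) : Prop :=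
  ∀ t' : Fin N → ℝ, ‖t' - t‖ ≤ δ → ∀ p ∈ cellSet i P f t', f k p = t' k →
    (∀ l, l ≠ i → l ≠ k → f l p = t' l → ∀ lam : ℝ, η ≤ ‖Df l p - lam • Df k p‖) ∧
    (∀ ξ : Pt n →L[ℝ] ℝ, (∀ q ∈ P, ξ (q - p) ≤ 0) → ∀ lam : ℝ, η * ‖ξ‖ ≤ ‖ξ - lam • Df k p‖)

structure LocData {n N : ℕ} (k : Fin N) (P : Set (Pt n))
    (Df : Fin N → Pt n → (Pt n →L[ℝ] ℝ)) (M : ℝ) (p0 w : Pt n) (r1 c0 sg : ℝ) : Prop where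
  p0mem : p0 ∈ P
  r1pos : 0 < r1
  c0pos : 0 < c0
  sgn : sg = 1 ∨ sg = -1
  w1 : ∀ p ∈ P, dist p p0 ≤ r1 → ∀ s ∈ Icc (0:ℝ) 1, p + s • w ∈ P
  w2 : ∀ p ∈ P, dist p p0 ≤ r1 → c0 ≤ sg * Df k p w
  w3 : ∀ p ∈ P, dist p p0 ≤ r1 → ∀ ξ : Pt n →L[ℝ] ℝ, (∀ q ∈ P, ξ (q - p) ≤ 0) → c0 * ‖ξ‖ ≤ - ξ w
  small : 4 * r1 * M * ‖w‖ ≤ c0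

lemma LocData.absw {n N : ℕ} {k : Fin N} {P : Set (Pt n)}
    {Df : Fin N → Pt n → (Pt n →L[ℝ] ℝ)} {M : ℝ} {p0 w : Pt n} {r1 c0 sg : ℝ}
    (h : LocData k P Df M p0 w r1 c0 sg) {p : Pt n} (hp : p ∈ P) (hd : dist p p0 ≤ r1) :
    c0 ≤ |Df k p w| := by
  have := h.w2 p hp hd
  rcases h.sgn with e | e <;> rw [e] at this
  · exact (by linarith : c0 ≤ Df k p w).trans (le_abs_self _)
  · exact (by linarith : c0 ≤ -Df k p w).trans (neg_le_abs _)

lemma LocData.wpos {n N : ℕ} {k : Fin N} {P : Set (Pt n)}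
    {Df : Fin N → Pt n → (Pt n →L[ℝ] ℝ)} {M : ℝ} {p0 w : Pt n} {r1 c0 sg : ℝ}
    (h : LocData k P Df M p0 w r1 c0 sg) : 0 < ‖w‖ := by
  rw [norm_pos_iff]
  rintro rfl
  have := h.absw h.p0mem (by simpa using h.r1pos.le)
  have := h.c0pos
  simp at *; linarith

section Loc
variable {n N m : ℕ} {i k : Fin N} {P : Set (Pt n)} {f : Fin N → Pt n → ℝ}
    {Df : Fin N → Pt n → (Pt n →L[ℝ] ℝ)} {M : ℝ} {p0 w : Pt n} {r1 c0 sg : ℝ}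

lemma decomp (L : Pt n ≃L[ℝ] ℝ × (Fin (m+1) → ℝ)) (hL : L w = (1, 0)) (x : Pt n) :
    x = (L x).1 • w + L.symm (0, (L x).2) := by
  apply L.injective
  rw [map_add, map_smul, hL, L.apply_symm_apply]
  ext <;> simp

lemma locInv (hR : RegData P f Df M) (hl : LocData k P Df M p0 w r1 c0 sg)
    (L : Pt n ≃L[ℝ] ℝ × (Fin (m+1) → ℝ)) (hL : L w = (1, 0)) :
    ∃ CL : ℝ, 1 ≤ CL ∧ ∀ p ∈ P, dist p p0 ≤ r1 → ∀ q ∈ P, dist q p0 ≤ r1 →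
      ‖q - p‖ ≤ CL * max |f k q - f k p| ‖(L q).2 - (L p).2‖ := by
  set N1 := ‖(L.symm : (ℝ × (Fin (m+1) → ℝ)) →L[ℝ] Pt n)‖
  have hM := hR.Mone
  have hc := hl.c0pos
  have hr := hl.r1pos
  have hw := hl.wpos
  have hN1 : 0 ≤ N1 := norm_nonneg _
  refine ⟨‖w‖ * (2/c0) * (1 + M * (1+2*r1) * N1) + N1 + 1, by
    have : 0 ≤ ‖w‖ * (2/c0) * (1 + M * (1+2*r1) * N1) := by positivity
    linarith, ?_⟩
  intro p hp hpd q hq hqd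
  set Δ := q - p with hΔ
  have hLΔ : (L Δ).2 = (L q).2 - (L p).2 := by simp [hΔ]
  rw [← hLΔ]
  set a := (L Δ).1
  set b := (L Δ).2
  set d := |f k q - f k p|
  set y := L.symm (0, b) with hy
  have hdec : Δ = a • w + y := decomp L hL Δ
  have hyn : ‖y‖ ≤ N1 * ‖b‖ := by
    have := (L.symm : (ℝ × (Fin (m+1) → ℝ)) →L[ℝ] Pt n).le_opNorm (0, b)
    simpa [Prod.norm_def] using this
  have hΔn : ‖Δ‖ ≤ |a| * ‖w‖ + ‖y‖ := by
    rw [hdec]; exact (norm_add_le _ _).trans (by rw [norm_smul, Real.norm_eq_abs])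
  have hΔ2 : ‖Δ‖ ≤ 2 * r1 := by
    rw [hΔ, ← dist_eq_norm]
    linarith [dist_triangle_right q p p0]
  have h1 : |Df k p Δ| ≤ d + M * ‖Δ‖^2 := by
    have h := hR.taylor k p hp q hq
    rw [← hΔ] at h
    have h2 : Df k p Δ = (f k q - f k p) - (f k q - f k p - Df k p Δ) := by ring
    rw [h2]; exact (abs_sub _ _).trans (by linarith)
  have h2 : |a| * c0 - M * ‖y‖ ≤ |Df k p Δ| := by
    have e : Df k p Δ = a * Df k p w + Df k p y := by rw [hdec]; simp
    have e1 : |Df k p y| ≤ M * ‖y‖ := ((Df k p).le_opNorm y).trans (by gcongr; exact hR.bddD k p hp)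
    have e2 : |a| * c0 ≤ |a * Df k p w| := by
      rw [abs_mul]; gcongr; exact hl.absw hp hpd
    rw [e]
    have := abs_sub_abs_le_abs_sub (a * Df k p w) (-Df k p y)
    rw [abs_neg, sub_neg_eq_add] at this
    linarith
  have hd0 : 0 ≤ d := abs_nonneg _
  have ha0 : 0 ≤ |a| := abs_nonneg _
  have h3 : |a| * c0 ≤ 2 * (d + M * (1 + 2 * r1) * ‖y‖) := by
    have e1 : M * ‖Δ‖^2 ≤ M * (2 * r1 * (|a| * ‖w‖ + ‖y‖)) := by
      rw [sq]; gcongr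
    have e2 := hl.small
    nlinarith [mul_le_mul_of_nonneg_left e2 ha0, norm_nonneg y]
  set mx := max d ‖b‖
  have hm1 : d ≤ mx := le_max_left _ _
  have hm2 : ‖b‖ ≤ mx := le_max_right _ _
  have hm0 : 0 ≤ mx := hd0.trans hm1
  have hy2 : ‖y‖ ≤ N1 * mx := hyn.trans (by gcongr)
  have h4 : |a| ≤ (2/c0) * ((1 + M * (1 + 2 * r1) * N1) * mx) := by
    rw [div_mul_eq_mul_div, le_div_iff₀ hc]
    refine h3.trans ?_
    have : M * (1 + 2 * r1) * ‖y‖ ≤ M * (1 + 2 * r1) * (N1 * mx) := by gcongr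
    linarith
  calc ‖Δ‖ ≤ |a| * ‖w‖ + ‖y‖ := hΔn
    _ ≤ ((2/c0) * ((1 + M * (1 + 2 * r1) * N1) * mx)) * ‖w‖ + N1 * mx := by gcongr
    _ ≤ _ := by nlinarith

lemma projMeas (hw : w ≠ 0) (R M1 : ℝ) (hRpos : 0 < R) (hM1 : 0 < M1)
    (L : Pt n ≃L[ℝ] ℝ × (Fin (m+1) → ℝ)) (hL : L w = (1, 0)) :
    ∃ C : ℝ, 0 ≤ C ∧ ∀ (S : Set (Pt n)) (T : Pt n → (Pt n →L[ℝ] ℝ)) (η τ : ℝ),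
      0 < η → η ≤ 1 → 0 < τ → (∀ p ∈ S, ‖p‖ ≤ R) → (∀ p ∈ S, T p w = 0) →
      (∀ p ∈ S, ‖T p‖ ≤ M1) → (∀ p ∈ S, η ≤ ‖T p‖) →
      (∀ p ∈ S, ∀ p' ∈ S, T p (p' - p) - M1 * ‖(L p').2 - (L p).2‖^2 ≤ τ) →
      volume ((fun p => (L p).2) '' S) ≤ ENNReal.ofReal (C * τ / η^2) := by
  set N0 := ‖(L : Pt n →L[ℝ] ℝ × (Fin (m+1) → ℝ))‖ + 1
  set N1 := ‖(L.symm : (ℝ × (Fin (m+1) → ℝ)) →L[ℝ] Pt n)‖ + 1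
  have hN0 : 1 ≤ N0 := by have := norm_nonneg (L : Pt n →L[ℝ] ℝ × (Fin (m+1) → ℝ)); simp only [N0]; linarith
  have hN1 : 1 ≤ N1 := by have := norm_nonneg (L.symm : (ℝ × (Fin (m+1) → ℝ)) →L[ℝ] Pt n); simp only [N1]; linarith
  obtain ⟨C, hC, hCl⟩ := lemL (m := m) (N0 * R) (M1 * N1) (by positivity) (by positivity)
  set cc : ℝ := (m+1) * N0
  have hcc : 1 ≤ cc := by
    have : (0:ℝ) ≤ m := by positivity
    simp only [cc]; nlinarith
  refine ⟨C * cc^2, by positivity, ?_⟩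
  intro S T η τ hη hη1 hτ hSR hTw hTM hTη hT
  have hLn : ∀ x, ‖(L x).2‖ ≤ N0 * ‖x‖ := by
    intro x
    have h1 := (L : Pt n →L[ℝ] ℝ × (Fin (m+1) → ℝ)).le_opNorm x
    have h2 : ‖(L x).2‖ ≤ ‖L x‖ := norm_snd_le _
    refine h2.trans (h1.trans ?_)
    gcongr; simp [N0]
  let bj : Fin (m+1) → Pt n := fun j => L.symm (0, Pi.single j 1)
  have hsum : ∀ y : Fin (m+1) → ℝ, L.symm (0, y) = ∑ j, y j • bj j := by
    intro y
    simp only [bj, ← map_smul, ← map_sum]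
    congr 1
    ext j
    · simp [Prod.fst_sum]
    · simp [Prod.snd_sum, Finset.sum_apply, Pi.single_apply]
  have hbj : ∀ j, ‖bj j‖ ≤ N1 := by
    intro j
    have := (L.symm : (ℝ × (Fin (m+1) → ℝ)) →L[ℝ] Pt n).le_opNorm (0, Pi.single j 1)
    have h2 : ‖((0:ℝ), (Pi.single j 1 : Fin (m+1) → ℝ))‖ = 1 := by simp [Prod.norm_def, Pi.norm_single]
    rw [h2, mul_one] at this
    refine this.trans ?_
    simp [N1]
  have hTd : ∀ p ∈ S, ∀ x, T p x = ∑ j, T p (bj j) * (L x).2 j := by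
    intro p hp x
    conv_lhs => rw [decomp L hL x]
    rw [map_add, map_smul, hTw p hp, smul_zero, zero_add, hsum, map_sum]
    exact Finset.sum_congr rfl fun j _ => by rw [map_smul, smul_eq_mul, mul_comm]
  choose! pf hpf1 hpf2 using (fun (y : Fin (m+1) → ℝ) (hy : y ∈ (fun p => (L p).2) '' S) => hy)
  have := hCl ((fun p => (L p).2) '' S) (fun y j => T (pf y) (bj j)) (η / cc) τ (by positivity)
    ((div_le_one (by positivity)).2 (by linarith)) hτ ?_ ?_ ?_ ?_
  · refine this.trans (le_of_eq ?_)
    congr 1; field_simp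
  · rintro _ ⟨p, hp, rfl⟩
    rw [mem_closedBall_zero_iff]
    exact (hLn p).trans (by gcongr; exact hSR p hp)
  · intro y hy
    rw [pi_norm_le_iff_of_nonneg (by positivity)]
    intro j
    exact ((T (pf y)).le_opNorm _).trans (by
      gcongr
      · exact hTM _ (hpf1 y hy)
      · exact hbj j)
  · intro y hy
    by_contra hcon
    push Not at hcon
    have h1 : ‖T (pf y)‖ ≤ (∑ j, |T (pf y) (bj j)|) * N0 := by
      refine ContinuousLinearMap.opNorm_le_bound _ (by positivity) ?_
      intro x
      rw [hTd _ (hpf1 y hy) x, mul_assoc, Finset.sum_mul]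
      refine (norm_sum_le _ _).trans (Finset.sum_le_sum fun j _ => ?_)
      rw [norm_mul, Real.norm_eq_abs]
      gcongr
      exact (norm_le_pi_norm _ j).trans (hLn x)
    have h2 : ∑ j, |T (pf y) (bj j)| < ∑ j : Fin (m+1), η / cc :=
      Finset.sum_lt_sum_of_nonempty ⟨0, Finset.mem_univ _⟩ fun j _ => hcon j
    have h3 := hTη _ (hpf1 y hy)
    simp only [Finset.sum_const, Finset.card_univ, Fintype.card_fin, nsmul_eq_mul] at h2
    have h4 : ((m+1 : ℕ):ℝ) * (η/cc) * N0 = η := by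
      simp only [cc]; push_cast; field_simp
    have h5 : (∑ j, |T (pf y) (bj j)|) * N0 < ((m+1 : ℕ):ℝ) * (η/cc) * N0 := by gcongr
    linarith
  · intro y hy y' hy'
    have h1 := hT _ (hpf1 y hy) _ (hpf1 y' hy')
    have e1 : (L (pf y)).2 = y := hpf2 y hy
    have e2 : (L (pf y')).2 = y' := hpf2 y' hy'
    rw [hTd _ (hpf1 y hy), e1, e2] at h1
    have e3 : (L (pf y' - pf y)).2 = y' - y := by rw [map_sub, Prod.snd_sub, e1, e2]
    rw [e3] at h1
    simp only [Pi.sub_apply] at h1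
    refine le_trans ?_ h1
    gcongr
    nlinarith
end Loc
end

section
section Loc2
variable {n N m : ℕ} {i k : Fin N} {P : Set (Pt n)} {f : Fin N → Pt n → ℝ}
    {Df : Fin N → Pt n → (Pt n →L[ℝ] ℝ)} {M : ℝ} {p0 w : Pt n} {r1 c0 sg : ℝ}

lemma RegData.bdd (hR : RegData P f Df M) : ∃ R : ℝ, 0 < R ∧ ∀ p ∈ P, ‖p‖ ≤ R := by
  obtain ⟨R, hR1, hR2⟩ := hR.comp.isBounded.exists_pos_norm_le
  exact ⟨R, hR1, hR2⟩

lemma badL (hR : RegData P f Df M) (hl : LocData k P Df M p0 w r1 c0 sg)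
    (L : Pt n ≃L[ℝ] ℝ × (Fin (m+1) → ℝ)) (hL : L w = (1, 0)) (K : ℝ) (hK : 1 ≤ K) :
    ∃ C : ℝ, 0 ≤ C ∧ ∀ (t : Fin N → ℝ) (τ δ η : ℝ) (l : Fin N), l ≠ i → l ≠ k → 0 < τ →
      K * τ ≤ δ → 0 < η → η ≤ 1 → TransAt i k P f Df t δ η →
      volume ((fun p => (L p).2) '' {p | p ∈ othSet i k P f t ∧ dist p p0 ≤ r1 ∧ f k p = t k ∧
        t l - K * τ ≤ f l p}) ≤ ENNReal.ofReal (C * τ / η^2) := by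
  obtain ⟨R, hRp, hPR⟩ := hR.bdd
  obtain ⟨CL, hCL, hCLi⟩ := locInv hR hl L hL
  have hM := hR.Mone
  have hc := hl.c0pos
  have hw := hl.wpos
  set Λ := M * ‖w‖ / c0
  have hΛ : 0 ≤ Λ := by positivity
  set M1 := M * (1 + Λ) * CL^2
  have hM1 : 0 < M1 := by positivity
  obtain ⟨C, hC, hCp⟩ := projMeas (norm_pos_iff.1 hw) R M1 hRp hM1 L hL
  refine ⟨C * K, by positivity, ?_⟩
  intro t τ δ η l hli hlk hτ hKτ hη hη1 hT
  have hlam : ∀ p ∈ P, dist p p0 ≤ r1 → |Df l p w / Df k p w| ≤ Λ := by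
    intro p hp hd
    rw [abs_div]
    have h1 := hl.absw hp hd
    have h2 : |Df l p w| ≤ M * ‖w‖ := ((Df l p).le_opNorm w).trans (by gcongr; exact hR.bddD l p hp)
    exact div_le_div₀ (by positivity) h2 hc h1
  have := hCp {p | p ∈ othSet i k P f t ∧ dist p p0 ≤ r1 ∧ f k p = t k ∧
        t l - K * τ ≤ f l p} (fun p => Df l p - (Df l p w / Df k p w) • Df k p) η (K * τ) hη hη1
        (by positivity) ?_ ?_ ?_ ?_ ?_
  · refine this.trans (le_of_eq ?_)
    congr 1; ring
  · rintro p ⟨hp, -⟩; exact hPR p hp.1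
  · rintro p ⟨hp, hd, -⟩
    have h1 := hl.absw hp.1 hd
    have h2 : Df k p w ≠ 0 := by intro h; rw [h] at h1; simp at h1; linarith
    simp [h2]
  · rintro p ⟨hp, hd, -⟩
    refine (norm_sub_le _ _).trans ?_
    rw [norm_smul, Real.norm_eq_abs]
    have e1 := hR.bddD l p hp.1
    have e2 := hR.bddD k p hp.1
    have e3 : |Df l p w / Df k p w| * ‖Df k p‖ ≤ Λ * M := by
      gcongr; exact hlam p hp.1 hd
    have e4 : M * (1 + Λ) * 1 ≤ M1 := by
      simp only [M1]; gcongr; nlinarith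
    linarith
  · rintro p ⟨hp, hd, hfk, hfl⟩
    refine (hT (Function.update t l (f l p)) ?_ p ⟨hp.1, ?_⟩ ?_).1 l hli hlk (by simp) _
    · rw [pi_norm_le_iff_of_nonneg (by nlinarith)]
      intro j
      by_cases hj : j = l
      · subst hj
        simp only [Pi.sub_apply, Function.update_self, Real.norm_eq_abs]
        rw [abs_le]
        have := hp.2 j hli hlk
        constructor <;> nlinarith
      · simp [hj]; nlinarith
    · intro j hji
      by_cases hj : j = l
      · subst hj; simp
      · rw [Function.update_of_ne hj]
        by_cases hjk : j = k
        · subst hjk; exact hfk.le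
        · exact hp.2 j hji hjk
    · rw [Function.update_of_ne hlk.symm]; exact hfk
  · rintro p ⟨hp, hd, hfk, hfl⟩ p' ⟨hp', hd', hfk', hfl'⟩
    have a1 := hR.taylor l p hp.1 p' hp'.1
    have a2 := hR.taylor k p hp.1 p' hp'.1
    have a3 := hlam p hp.1 hd
    have a4 := hCLi p hp.1 hd p' hp'.1 hd'
    have a5 := hp'.2 l hli hlk
    rw [hfk, hfk'] at a2 a4
    simp only [sub_self, abs_zero, zero_sub, abs_neg] at a2 a4
    rw [max_eq_right (norm_nonneg _)] at a4
    simp only [_root_.sub_apply, _root_.smul_apply, smul_eq_mul]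
    set b := ‖(L p').2 - (L p).2‖
    set lam := Df l p w / Df k p w
    have a6 : ‖p' - p‖^2 ≤ CL^2 * b^2 := by
      rw [← mul_pow]; gcongr
    have a7 : -(lam * Df k p (p' - p)) ≤ Λ * (M * ‖p' - p‖^2) := by
      refine (neg_le_abs _).trans ?_
      rw [abs_mul]; gcongr
    have a8 := (abs_le.1 a1).1
    have a9 : M * (1 + Λ) * ‖p' - p‖^2 ≤ M * (1 + Λ) * (CL^2 * b^2) := by gcongr
    simp only [M1]
    nlinarith

lemma normalExists (hR : RegData P f Df M) (hl : LocData k P Df M p0 w r1 c0 sg) (z : Pt n)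
    (hz : z ∈ P) (hd : dist z p0 ≤ r1) (hzi : z ∉ interior P) :
    ∃ ξ : Pt n →L[ℝ] ℝ, (∀ q ∈ P, ξ (q - z) ≤ 0) ∧ ξ w = -1 ∧ ‖ξ‖ ≤ 1/c0 ∧ 1 / ‖w‖ ≤ ‖ξ‖ := by
  obtain ⟨ξ, hξ⟩ := geometric_hahn_banach_open_point hR.conv.interior isOpen_interior hzi
  have h1 : ∀ q ∈ P, ξ (q - z) ≤ 0 := by
    intro q hq
    have hq' : q ∈ closure (interior P) := by
      rw [hR.conv.closure_interior_eq_closure_of_nonempty_interior hR.inter]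
      exact subset_closure hq
    have : closure (interior P) ⊆ {q | ξ q ≤ ξ z} :=
      closure_minimal (fun a ha => (hξ a ha).le) (isClosed_le ξ.continuous continuous_const)
    have := this hq'
    simp at this ⊢; exact this
  have h2 := hl.w3 z hz hd ξ h1
  have h3 : 0 < ‖ξ‖ := by
    rw [norm_pos_iff]; rintro rfl
    obtain ⟨a, ha⟩ := hR.inter
    have := hξ a ha
    simp at this
  have hc := hl.c0pos
  have hw := hl.wpos
  set a := -ξ w with ha
  have ha0 : 0 < a := lt_of_lt_of_le (by positivity) h2
  have h4 : a ≤ ‖ξ‖ * ‖w‖ := (neg_le_abs _).trans (ξ.le_opNorm w)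
  refine ⟨a⁻¹ • ξ, ?_, ?_, ?_, ?_⟩
  · intro q hq
    simp only [_root_.smul_apply, smul_eq_mul]
    exact mul_nonpos_of_nonneg_of_nonpos (by positivity) (h1 q hq)
  · simp only [_root_.smul_apply, smul_eq_mul]
    have : ξ w = -a := by rw [ha]; ring
    rw [this]; field_simp
  · rw [norm_smul, norm_inv, Real.norm_of_nonneg ha0.le, ← div_eq_inv_mul, div_le_div_iff₀ ha0 hc]
    linarith
  · rw [norm_smul, norm_inv, Real.norm_of_nonneg ha0.le, ← div_eq_inv_mul, div_le_div_iff₀ hw ha0]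
    linarith

lemma badB (hki : k ≠ i) (hR : RegData P f Df M) (hl : LocData k P Df M p0 w r1 c0 sg)
    (L : Pt n ≃L[ℝ] ℝ × (Fin (m+1) → ℝ)) (hL : L w = (1, 0)) (K : ℝ) (hK : 1 ≤ K) :
    ∃ C : ℝ, 0 ≤ C ∧ ∀ (t : Fin N → ℝ) (τ δ η : ℝ), 0 < τ →
      K * τ ≤ δ → 0 < η → η ≤ 1 → TransAt i k P f Df t δ η →
      volume ((fun p => (L p).2) '' {p | p ∈ P ∧ dist p p0 ≤ r1 ∧ p ∉ interior P ∧
        |f k p - t k| ≤ τ ∧ ∀ l, l ≠ i → l ≠ k → f l p ≤ t l + K * τ})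
        ≤ ENNReal.ofReal (C * τ / η^2) := by
  obtain ⟨R, hRp, hPR⟩ := hR.bdd
  have hM := hR.Mone
  have hc := hl.c0pos
  have hw := hl.wpos
  have hsg : |sg| = 1 := by rcases hl.sgn with h | h <;> rw [h] <;> norm_num
  set N1 := ‖(L.symm : (ℝ × (Fin (m+1) → ℝ)) →L[ℝ] Pt n)‖
  have hN1 : 0 ≤ N1 := norm_nonneg _
  set D := (‖w‖ / c0 + 1) * N1
  have hD : 0 ≤ D := by positivity
  set M1 := M * D^2 + M + M * ‖w‖ / c0
  have hM1 : 0 < M1 := by positivity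
  obtain ⟨C, hC, hCp⟩ := projMeas (norm_pos_iff.1 hw) R M1 hRp hM1 L hL
  set e := min 1 (c0 / ‖w‖)
  have he0 : 0 < e := lt_min one_pos (by positivity)
  have he1 : e ≤ 1 := min_le_left _ _
  have he2 : e ≤ c0 / ‖w‖ := min_le_right _ _
  refine ⟨C * 2 / e^2, by positivity, ?_⟩
  intro t τ δ η hτ hKτ hη hη1 hT
  set S := {p | p ∈ P ∧ dist p p0 ≤ r1 ∧ p ∉ interior P ∧
        |f k p - t k| ≤ τ ∧ ∀ l, l ≠ i → l ≠ k → f l p ≤ t l + K * τ}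
  choose! ξ hξ1 hξ2 hξ3 hξ4 using
    (fun (z : Pt n) (hz : z ∈ S) => normalExists hR hl z hz.1 hz.2.1 hz.2.2.1)
  have := hCp S (fun z => sg • (Df k z + (Df k z w) • ξ z)) (e * η) (2 * τ) (by positivity)
        (by nlinarith) (by positivity) ?_ ?_ ?_ ?_ ?_
  · refine this.trans (le_of_eq ?_)
    congr 1; field_simp
  · intro p hp; exact hPR p hp.1
  · intro p hp
    simp [hξ2 p hp]
  · intro p hp
    rw [norm_smul, Real.norm_eq_abs, hsg, one_mul]
    refine (norm_add_le _ _).trans ?_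
    rw [norm_smul, Real.norm_eq_abs]
    have h1 := hR.bddD k p hp.1
    have h2 : |Df k p w| ≤ M * ‖w‖ := ((Df k p).le_opNorm w).trans (by gcongr)
    have h3 : |Df k p w| * ‖ξ p‖ ≤ M * ‖w‖ * (1/c0) := by gcongr; exact hξ3 p hp
    have h4 : M * ‖w‖ * (1/c0) = M * ‖w‖ / c0 := by ring
    have : 0 ≤ M * D^2 := by positivity
    simp only [M1]; linarith
  · intro p hp
    have hp0 := hp
    obtain ⟨hpP, hd, hpi, hfk, hfl⟩ := hp0
    have hb := (hT (fun j => if j = k then f k p else if j = i then t j else max (t j) (f j p)) ?_ p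
      ⟨hpP, ?_⟩ (by simp)).2 (ξ p) (hξ1 p hp) (-(Df k p w)⁻¹)
    · rw [norm_smul, Real.norm_eq_abs, hsg, one_mul]
      have h1 := hl.absw hpP hd
      have h2 : Df k p w ≠ 0 := by intro h; rw [h] at h1; simp at h1; linarith
      have h3 : Df k p + Df k p w • ξ p = Df k p w • (ξ p - (-(Df k p w)⁻¹) • Df k p) := by
        ext x; simp only [_root_.add_apply, _root_.smul_apply, _root_.sub_apply, smul_eq_mul]; field_simp; ring
      rw [h3, norm_smul, Real.norm_eq_abs]
      calc e * η ≤ (c0 / ‖w‖) * η := by gcongr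
        _ = c0 * (η * (1 / ‖w‖)) := by ring
        _ ≤ c0 * (η * ‖ξ p‖) := by gcongr; exact hξ4 p hp
        _ ≤ _ := by gcongr
    · rw [pi_norm_le_iff_of_nonneg (by nlinarith)]
      intro j
      simp only [Pi.sub_apply, Real.norm_eq_abs]
      by_cases hjk : j = k
      · subst hjk; simp; nlinarith
      · by_cases hji : j = i
        · subst hji; simp [hjk]; nlinarith
        · simp only [hjk, hji, if_false]
          have := hfl j hji hjk
          rw [abs_le]
          constructor
          · have := le_max_left (t j) (f j p); nlinarith
          · have : max (t j) (f j p) ≤ t j + K * τ := max_le (by nlinarith) this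
            linarith
    · intro j hji
      by_cases hjk : j = k
      · subst hjk; simp
      · simp [hjk, hji]
  · intro p hp p' hp'
    have g1 := hξ1 p hp p' hp'.1
    have g2 := hξ1 p' hp' p hp.1
    set Δ := p' - p with hΔ
    have hLΔ : (L Δ).2 = (L p').2 - (L p).2 := by simp [hΔ]
    rw [← hLΔ]
    set b := (L Δ).2
    set a := (L Δ).1
    set y := L.symm (0, b)
    have hdec : Δ = a • w + y := decomp L hL Δ
    have hyn : ‖y‖ ≤ N1 * ‖b‖ := by
      have := (L.symm : (ℝ × (Fin (m+1) → ℝ)) →L[ℝ] Pt n).le_opNorm (0, b)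
      simpa [Prod.norm_def] using this
    have g3 : p - p' = -Δ := by rw [hΔ]; abel
    have hξy : ∀ z ∈ S, |ξ z y| ≤ 1/c0 * ‖y‖ := fun z hz =>
      ((ξ z).le_opNorm y).trans (by gcongr; exact hξ3 z hz)
    have ha : |a| ≤ 1/c0 * ‖y‖ := by
      rw [g3, map_neg, hdec, map_add, map_smul, hξ2 p' hp'] at g2
      rw [hdec, map_add, map_smul, hξ2 p hp] at g1
      simp only [smul_eq_mul] at g1 g2
      rw [abs_le]
      have := abs_le.1 (hξy p hp)
      have := abs_le.1 (hξy p' hp')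
      constructor <;> linarith
    have hΔn : ‖Δ‖ ≤ D * ‖b‖ := by
      have : ‖Δ‖ ≤ |a| * ‖w‖ + ‖y‖ := by
        rw [hdec]; exact (norm_add_le _ _).trans (by rw [norm_smul, Real.norm_eq_abs])
      calc ‖Δ‖ ≤ |a| * ‖w‖ + ‖y‖ := this
        _ ≤ 1/c0 * ‖y‖ * ‖w‖ + ‖y‖ := by gcongr
        _ = (‖w‖ / c0 + 1) * ‖y‖ := by ring
        _ ≤ (‖w‖ / c0 + 1) * (N1 * ‖b‖) := by gcongr
        _ = D * ‖b‖ := by simp only [D]; ring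
    have h1 : sg * Df k p Δ ≤ 2 * τ + M * ‖Δ‖^2 := by
      have h := hR.taylor k p hp.1 p' hp'.1
      rw [← hΔ] at h
      have e1 : sg * Df k p Δ ≤ |Df k p Δ| := by
        refine (le_abs_self _).trans ?_
        rw [abs_mul, hsg, one_mul]
      have := abs_le.1 hp.2.2.2.1
      have := abs_le.1 hp'.2.2.2.1
      have := abs_le.1 h
      refine e1.trans (abs_le.2 ⟨?_, ?_⟩) <;> linarith
    have h2 : sg * (Df k p w * ξ p Δ) ≤ 0 := by
      rw [← mul_assoc]
      exact mul_nonpos_of_nonneg_of_nonpos (hc.le.trans (hl.w2 p hp.1 hp.2.1)) g1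
    simp only [_root_.add_apply, _root_.smul_apply, smul_eq_mul]
    have h3 : M * ‖Δ‖^2 ≤ M1 * ‖b‖^2 := by
      calc M * ‖Δ‖^2 ≤ M * (D * ‖b‖)^2 := by gcongr
        _ = M * D^2 * ‖b‖^2 := by ring
        _ ≤ _ := by
          gcongr; simp only [M1]
          have : 0 ≤ M * ‖w‖ / c0 := by positivity
          linarith
    linarith
end Loc2
end

section
section Loc3
variable {n N m : ℕ} {i k : Fin N} {P : Set (Pt n)} {f : Fin N → Pt n → ℝ}
    {Df : Fin N → Pt n → (Pt n →L[ℝ] ℝ)} {M : ℝ} {p0 w : Pt n} {r1 c0 sg : ℝ}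

lemma RegData.cont (hR : RegData P f Df M) (k : Fin N) : ContinuousOn (f k) P :=
  fun p hp => (hR.hasD k p hp).continuousWithinAt

/-- moving along w -/
lemma moveMono (hR : RegData P f Df M) (hl : LocData k P Df M p0 w r1 c0 sg) (p : Pt n)
    (hp : p ∈ P) (hd : dist p p0 ≤ r1) (s : ℝ) (hs : 0 ≤ s) (hs2 : s * ‖w‖ ≤ r1/2)
    (hq : p + s • w ∈ P) : c0 * s / 2 ≤ sg * (f k (p + s • w) - f k p) := by
  have h1 := hR.taylor k p hp _ hq
  have h2 := hl.w2 p hp hd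
  have h3 := hl.small
  have hM := hR.Mone
  have hsg : |sg| = 1 := by rcases hl.sgn with h | h <;> rw [h] <;> norm_num
  have e1 : p + s • w - p = s • w := by abel
  rw [e1, map_smul, norm_smul, Real.norm_of_nonneg hs, smul_eq_mul] at h1
  have h4 : -(M * (s * ‖w‖)^2) ≤ sg * (f k (p + s • w) - f k p - s * Df k p w) := by
    have : |sg * (f k (p + s • w) - f k p - s * Df k p w)| ≤ M * (s * ‖w‖)^2 := by
      rw [abs_mul, hsg, one_mul]; exact h1
    exact (abs_le.1 this).1
  have h5 : M * (s * ‖w‖)^2 ≤ M * (s * ‖w‖) * (r1/2) := by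
    rw [sq, ← mul_assoc]; gcongr
  nlinarith [mul_le_mul_of_nonneg_left h2 hs, mul_le_mul_of_nonneg_left h3 hs, hl.c0pos]

def badSet (i k : Fin N) (P : Set (Pt n)) (f : Fin N → Pt n → ℝ) (p0 : Pt n) (r1 : ℝ)
    (L : Pt n ≃L[ℝ] ℝ × (Fin (m+1) → ℝ)) (t t' : Fin N → ℝ) : Set (Fin (m+1) → ℝ) :=
  {y | ∃ p ∈ othSet i k P f t, dist p p0 ≤ r1/2 ∧ f k p = t k ∧ (L p).2 = y ∧
    ¬ ∃ p' ∈ othSet i k P f t', dist p' p0 ≤ r1 ∧ f k p' = t' k ∧ (L p').2 = y}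

lemma badLem (hki : k ≠ i) (hR : RegData P f Df M) (hl : LocData k P Df M p0 w r1 c0 sg)
    (L : Pt n ≃L[ℝ] ℝ × (Fin (m+1) → ℝ)) (hL : L w = (1, 0)) :
    ∃ K C : ℝ, 1 ≤ K ∧ 0 ≤ C ∧ ∀ (t t' : Fin N → ℝ) (τ δ η : ℝ), 0 < τ → ‖t - t'‖ ≤ τ →
      K * τ ≤ δ → δ ≤ 1 → 0 < η → η ≤ 1 → TransAt i k P f Df t δ η →
      volume (badSet i k P f p0 r1 L t t') ≤ ENNReal.ofReal (C * τ / η^2) := by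
  have hM := hR.Mone
  have hc := hl.c0pos
  have hw := hl.wpos
  have hr := hl.r1pos
  set K := 4 * ‖w‖ / (c0 * r1) + 2 / c0 + 2 * M * ‖w‖ / c0 + 1 with hKdef
  have k1 : 0 ≤ 4 * ‖w‖ / (c0 * r1) := by positivity
  have k2 : 0 ≤ 2 / c0 := by positivity
  have k3 : 0 ≤ 2 * M * ‖w‖ / c0 := by positivity
  have hK : 1 ≤ K := by linarith
  obtain ⟨C1, hC1, hL1⟩ := badL (i := i) hR hl L hL K hK
  obtain ⟨C2, hC2, hB1⟩ := badB hki hR hl L hL K hK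
  refine ⟨K, N * C1 + C2, hK, by positivity, ?_⟩
  intro t t' τ δ η hτ htt hKτ hδ hη hη1 hT
  have hsub : badSet i k P f p0 r1 L t t' ⊆
      (⋃ l : Fin N, if l ≠ i ∧ l ≠ k then (fun p => (L p).2) '' {p | p ∈ othSet i k P f t ∧
        dist p p0 ≤ r1 ∧ f k p = t k ∧ t l - K * τ ≤ f l p} else ∅) ∪
      ((fun p => (L p).2) '' {p | p ∈ P ∧ dist p p0 ≤ r1 ∧ p ∉ interior P ∧
        |f k p - t k| ≤ τ ∧ ∀ l, l ≠ i → l ≠ k → f l p ≤ t l + K * τ}) := by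
    rintro y ⟨p, hp, hpd, hpk, hpy, hno⟩
    have htj : ∀ j, |t j - t' j| ≤ τ := fun j => (norm_le_pi_norm (t - t') j).trans htt
    set u := 2 * τ / c0 with hu
    have hu0 : 0 ≤ u := by positivity
    have huw : u * ‖w‖ ≤ r1/2 := by
      have : 4 * ‖w‖ / (c0 * r1) * τ ≤ 1 := by nlinarith
      rw [hu]
      have e : 2 * τ / c0 * ‖w‖ = (4 * ‖w‖ / (c0 * r1) * τ) * (r1/2) := by field_simp; norm_num
      rw [e]; nlinarith
    have hu1 : u ≤ 1 := by
      have : 2 / c0 * τ ≤ 1 := by nlinarith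
      rw [hu]; linarith [(by ring : 2 * τ / c0 = 2 / c0 * τ)]
    have hcu : c0 * u / 2 = τ := by rw [hu]; field_simp
    have hMu : M * (u * ‖w‖) = 2 * M * ‖w‖ / c0 * τ := by rw [hu]; ring
    have hMK : M * (u * ‖w‖) + τ ≤ K * τ := by rw [hMu, hKdef]; nlinarith
    have hpd1 : dist p p0 ≤ r1 := by linarith
    have hLs : ∀ s : ℝ, (L (p + s • w)).2 = y := by
      intro s; rw [map_add, map_smul, hL]; simp [hpy]
    have hds : ∀ s : ℝ, |s| ≤ u → dist (p + s • w) p0 ≤ r1 := by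
      intro s hs
      have : dist (p + s • w) p ≤ u * ‖w‖ := by
        rw [dist_eq_norm]; simp only [add_sub_cancel_left, norm_smul, Real.norm_eq_abs]; gcongr
      linarith [dist_triangle (p + s • w) p p0]
    have hlipl : ∀ s : ℝ, |s| ≤ u → p + s • w ∈ P → ∀ l, |f l (p + s • w) - f l p| ≤ M * (u * ‖w‖) := by
      intro s hs hP l
      refine (hR.lip l p hp.1 _ hP).trans ?_
      simp only [add_sub_cancel_left, norm_smul, Real.norm_eq_abs]; gcongr
    -- the conclusion if we find a point
    have fin1 : ∀ s : ℝ, |s| ≤ u → p + s • w ∈ P → f k (p + s • w) = t' k →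
        ∃ l, l ≠ i ∧ l ≠ k ∧ t l - K * τ ≤ f l p := by
      intro s hs hP hfk
      have : p + s • w ∉ othSet i k P f t' := fun h => hno ⟨_, h, hds s hs, hfk, hLs s⟩
      have h2 : ∃ l, l ≠ i ∧ l ≠ k ∧ t' l < f l (p + s • w) := by
        by_contra hcon; push Not at hcon; exact this ⟨hP, hcon⟩
      obtain ⟨l, hli, hlk, hl3⟩ := h2
      refine ⟨l, hli, hlk, ?_⟩
      have := abs_le.1 (hlipl s hs hP l)
      have := abs_le.1 (htj l)
      linarith
    have key : (∃ s : ℝ, |s| ≤ u ∧ p + s • w ∈ P ∧ f k (p + s • w) = t' k) ∨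
        (∃ s : ℝ, |s| ≤ u ∧ p + s • w ∈ P ∧ p + s • w ∉ interior P ∧ |f k (p + s • w) - t k| ≤ τ) := by
      have hsg2 : sg * sg = 1 := by rcases hl.sgn with h | h <;> rw [h] <;> norm_num
      have hsg : |sg| = 1 := by rcases hl.sgn with h | h <;> rw [h] <;> norm_num
      have hdabs : |sg * (t' k - t k)| ≤ τ := by
        rw [abs_mul, hsg, one_mul, abs_sub_comm]; exact htj k
      have hcontl : Continuous (fun s : ℝ => p + s • w) := by fun_prop
      by_cases hcase : 0 ≤ sg * (t' k - t k)
      · left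
        have hin : ∀ s ∈ Icc (0:ℝ) u, p + s • w ∈ P := fun s hs =>
          hl.w1 p hp.1 hpd1 s ⟨hs.1, hs.2.trans hu1⟩
        have hcon : ContinuousOn (fun s : ℝ => sg * (f k (p + s • w) - f k p)) (Icc 0 u) :=
          continuousOn_const.mul (((hR.cont k).comp hcontl.continuousOn hin).sub continuousOn_const)
        have := intermediate_value_Icc hu0 hcon
        have hmem : sg * (t' k - t k) ∈ (fun s : ℝ => sg * (f k (p + s • w) - f k p)) '' Icc 0 u := by
          apply this
          constructor
          · simpa using hcase
          · have h1 := moveMono hR hl p hp.1 hpd1 u hu0 huw (hin u ⟨hu0, le_rfl⟩)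
            have := (abs_le.1 hdabs).2
            linarith
        obtain ⟨s, hs, hse⟩ := hmem
        refine ⟨s, by rw [abs_of_nonneg hs.1]; exact hs.2, hin s hs, ?_⟩
        have : sg * (sg * (f k (p + s • w) - f k p)) = sg * (sg * (t' k - t k)) := by
          simp only at hse; rw [hse]
        rw [← mul_assoc, ← mul_assoc, hsg2, hpk] at this; linarith
      · push Not at hcase
        have hZc : IsCompact (Icc (0:ℝ) u ∩ (fun s : ℝ => p + (-s) • w) ⁻¹' P) :=
          isCompact_Icc.inter_right (hR.comp.isClosed.preimage (by fun_prop))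
        obtain ⟨s0, hs0, hmax⟩ := hZc.exists_isMaxOn ⟨0, ⟨le_rfl, hu0⟩, by simpa using hp.1⟩
          (f := fun s => s) continuousOn_id
        have hs0P : p + (-s0) • w ∈ P := hs0.2
        have hs0u : |(-s0)| ≤ u := by rw [abs_neg, abs_of_nonneg hs0.1.1]; exact hs0.1.2
        have hin : ∀ s ∈ Icc (0:ℝ) s0, p + (-s) • w ∈ P := by
          intro s hs
          by_cases h0 : s0 = 0
          · have : s = 0 := le_antisymm (by rw [← h0]; exact hs.2) hs.1
            rw [this]; simpa using hp.1
          have hs0p : 0 < s0 := lt_of_le_of_ne hs0.1.1 (Ne.symm h0)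
          have := hR.conv hp.1 hs0P (a := 1 - s/s0) (b := s/s0)
            (by rw [sub_nonneg, div_le_one hs0p]; exact hs.2) (div_nonneg hs.1 hs0p.le) (by ring)
          convert this using 1
          rw [smul_add, smul_smul, ← add_assoc, ← add_smul]
          congr 1
          · rw [sub_add_cancel, one_smul]
          · congr 1; field_simp
        have hmm : ∀ s ∈ Icc (0:ℝ) s0, c0 * s / 2 ≤ sg * (f k p - f k (p + (-s) • w)) := by
          intro s hs
          have hsu : s ≤ u := hs.2.trans hs0.1.2
          have e : p + (-s) • w + s • w = p := by rw [add_assoc, ← add_smul]; simp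
          have := moveMono hR hl (p + (-s) • w) (hin s hs)
            (hds _ (by rw [abs_neg, abs_of_nonneg hs.1]; exact hsu)) s hs.1
            (le_trans (by gcongr) huw) (by rw [e]; exact hp.1)
          rwa [e] at this
        by_cases hd2 : sg * (t k - t' k) ≤ sg * (f k p - f k (p + (-s0) • w))
        · left
          have hcon : ContinuousOn (fun s : ℝ => sg * (f k p - f k (p + (-s) • w))) (Icc 0 s0) :=
            continuousOn_const.mul (continuousOn_const.sub ((hR.cont k).comp
              (by fun_prop : Continuous (fun s : ℝ => p + (-s) • w)).continuousOn hin))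
          have := intermediate_value_Icc hs0.1.1 hcon
          have hmem : sg * (t k - t' k) ∈ (fun s : ℝ => sg * (f k p - f k (p + (-s) • w))) '' Icc 0 s0 := by
            apply this
            constructor
            · simp; nlinarith
            · exact hd2
          obtain ⟨s, hs, hse⟩ := hmem
          refine ⟨-s, by rw [abs_neg, abs_of_nonneg hs.1]; exact hs.2.trans hs0.1.2, hin s hs, ?_⟩
          have : sg * (sg * (f k p - f k (p + (-s) • w))) = sg * (sg * (t k - t' k)) := by
            simp only at hse; rw [hse]
          rw [← mul_assoc, ← mul_assoc, hsg2, hpk] at this; linarith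
        · right
          push Not at hd2
          have g1 := hmm s0 ⟨hs0.1.1, le_rfl⟩
          have g0 : 0 ≤ c0 * s0 / 2 := by have := hs0.1.1; positivity
          have g2 := abs_le.1 hdabs
          have hlt : sg * (f k p - f k (p + (-s0) • w)) < τ := by nlinarith
          refine ⟨-s0, hs0u, hs0P, ?_, ?_⟩
          · intro hint
            have hs0lt : s0 < u := by
              by_contra hge; push Not at hge
              have : s0 = u := le_antisymm hs0.1.2 hge
              rw [this, hcu] at g1; rw [this] at hlt; linarith
            have hnb : ∀ᶠ s in nhds s0, p + (-s) • w ∈ P := by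
              have hc2 : ContinuousAt (fun s : ℝ => p + (-s) • w) s0 := by fun_prop
              exact hc2.eventually (mem_interior_iff_mem_nhds.1 hint)
            have hnb2 : ∀ᶠ s in nhds s0, s < u := eventually_lt_nhds hs0lt
            obtain ⟨s, ⟨hs1, hs2⟩, hs3⟩ := (((hnb.and hnb2).filter_mono nhdsWithin_le_nhds).and
              (self_mem_nhdsWithin : Ioi s0 ∈ nhdsWithin s0 (Ioi s0))).exists
            have hs3' : s0 < s := hs3
            have : s ≤ s0 := hmax (show s ∈ _ from ⟨⟨hs0.1.1.trans hs3'.le, hs2.le⟩, hs1⟩)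
            linarith
          · have : |sg * (f k p - f k (p + (-s0) • w))| ≤ τ := abs_le.2 ⟨by linarith, hlt.le⟩
            rw [abs_mul, hsg, one_mul, abs_sub_comm] at this
            rw [← hpk]; exact this
    rcases key with ⟨s, hs, hP, hfk⟩ | ⟨s, hs, hP, hnI, hfk⟩
    · left
      obtain ⟨l, hli, hlk, hl3⟩ := fin1 s hs hP hfk
      rw [mem_iUnion]
      refine ⟨l, ?_⟩
      rw [if_pos ⟨hli, hlk⟩]
      exact ⟨p, ⟨hp, hpd1, hpk, hl3⟩, hpy⟩
    · right
      refine ⟨p + s • w, ⟨hP, hds s hs, hnI, hfk, ?_⟩, hLs s⟩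
      intro l hli hlk
      have := abs_le.1 (hlipl s hs hP l)
      have := hp.2 l hli hlk
      linarith
  refine (measure_mono hsub).trans ((measure_union_le _ _).trans ?_)
  have hX : 0 ≤ C1 * τ / η^2 := by positivity
  have hY : 0 ≤ C2 * τ / η^2 := by positivity
  have e : (N * C1 + C2) * τ / η^2 = N * (C1 * τ / η^2) + C2 * τ / η^2 := by ring
  rw [e, ENNReal.ofReal_add (by positivity) hY]
  refine add_le_add ?_ (hB1 t τ δ η hτ hKτ hη hη1 hT)
  refine (measure_iUnion_fintype_le _ _).trans ?_
  calc _ ≤ ∑ l : Fin N, ENNReal.ofReal (C1 * τ / η^2) := by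
        refine Finset.sum_le_sum fun l _ => ?_
        split_ifs with h
        · exact hL1 t τ δ η l h.1 h.2 hτ hKτ hη hη1 hT
        · simp
    _ = _ := by
      rw [Finset.sum_const, Finset.card_univ, Fintype.card_fin, nsmul_eq_mul,
        ENNReal.ofReal_mul (by positivity), ENNReal.ofReal_natCast]
end Loc3
end

section
section Loc4
variable {n N m : ℕ} {i k : Fin N} {P : Set (Pt n)} {f : Fin N → Pt n → ℝ}
    {Df : Fin N → Pt n → (Pt n →L[ℝ] ℝ)} {M : ℝ} {p0 w : Pt n} {r1 c0 sg : ℝ}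

lemma exL (hn : n = m + 2) (w : Pt n) (hw : w ≠ 0) :
    ∃ L : Pt n ≃L[ℝ] ℝ × (Fin (m+1) → ℝ), L w = (1, 0) := by
  have hex : ∃ L0 : Pt n ≃L[ℝ] ℝ × (Fin (m+1) → ℝ), True := by
    have : Module.finrank ℝ (Pt n) = Module.finrank ℝ (ℝ × (Fin (m+1) → ℝ)) := by
      simp [hn]; omega
    exact ⟨ContinuousLinearEquiv.ofFinrankEq this, trivial⟩
  obtain ⟨L0, -⟩ := hex
  have h1 : L0 w ≠ 0 := by simpa using hw
  obtain ⟨A, hA⟩ := SeparatingDual.exists_continuousLinearEquiv_apply_eq (R := ℝ) h1 (show ((1:ℝ), (0 : Fin (m+1) → ℝ)) ≠ 0 by simp)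
  exact ⟨L0.trans A, by simpa using hA⟩

lemma haarProd : (volume : Measure (ℝ × (Fin (m+1) → ℝ))).IsAddHaarMeasure := by
  rw [Measure.volume_eq_prod]; infer_instance

lemma exists_cL (L : Pt n ≃L[ℝ] ℝ × (Fin (m+1) → ℝ)) :
    ∃ cL : ℝ, 0 ≤ cL ∧ ∀ (B : Set (Pt n)) (g : Pt n → ℝ), MeasurableSet B →
      ∫ p in B, g p = cL * ∫ z in L '' B, g (L.symm z) := by
  have := haarProd (m := m)
  have : ((volume : Measure (ℝ × (Fin (m+1) → ℝ))).map L.symm).IsAddHaarMeasure :=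
    L.symm.isAddHaarMeasure_map _
  have h := Measure.isAddLeftInvariant_eq_smul (volume : Measure (Pt n))
    ((volume : Measure (ℝ × (Fin (m+1) → ℝ))).map L.symm)
  set cL := (volume : Measure (Pt n)).addHaarScalarFactor
    ((volume : Measure (ℝ × (Fin (m+1) → ℝ))).map L.symm)
  refine ⟨cL, cL.2, ?_⟩
  intro B g hB
  have hme : MeasurableEmbedding L.symm := L.symm.toHomeomorph.measurableEmbedding
  conv_lhs => rw [h]
  rw [Measure.restrict_smul, integral_smul_nnreal_measure, hme.setIntegral_map,
    ContinuousLinearEquiv.image_eq_preimage_symm]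
  rfl

lemma det_shear (φ : (ℝ × (Fin (m+1) → ℝ)) →L[ℝ] ℝ) :
    (φ.prod (ContinuousLinearMap.snd ℝ ℝ (Fin (m+1) → ℝ))).det = φ (1, 0) := by
  have h : ((φ.prod (ContinuousLinearMap.snd ℝ ℝ (Fin (m+1) → ℝ)) : _ →L[ℝ] _) :
      (ℝ × (Fin (m+1) → ℝ)) →ₗ[ℝ] _) = LinearMap.transvection
      ((φ - ContinuousLinearMap.fst ℝ ℝ (Fin (m+1) → ℝ) : _ →L[ℝ] ℝ) : _ →ₗ[ℝ] ℝ) (1, 0) := by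
    ext x <;> simp [LinearMap.transvection.apply]
  show LinearMap.det _ = _
  rw [h, LinearMap.transvection.det]
  simp

def Th (k : Fin N) (f : Fin N → Pt n → ℝ) (L : Pt n ≃L[ℝ] ℝ × (Fin (m+1) → ℝ)) (p : Pt n) :
    ℝ × (Fin (m+1) → ℝ) := (f k p, (L p).2)

lemma Th_inj (hR : RegData P f Df M) (hl : LocData k P Df M p0 w r1 c0 sg)
    (L : Pt n ≃L[ℝ] ℝ × (Fin (m+1) → ℝ)) (hL : L w = (1, 0)) :
    InjOn (Th k f L) (P ∩ closedBall p0 r1) := by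
  obtain ⟨CL, hCL, h⟩ := locInv hR hl L hL
  intro p hp q hq e
  have h1 := h p hp.1 hp.2 q hq.1 hq.2
  simp only [Th, Prod.mk.injEq] at e
  rw [e.1, e.2] at h1
  simp at h1
  exact (sub_eq_zero.1 h1).symm

lemma Th_cov (hR : RegData P f Df M) (hl : LocData k P Df M p0 w r1 c0 sg)
    (L : Pt n ≃L[ℝ] ℝ × (Fin (m+1) → ℝ)) (hL : L w = (1, 0)) :
    ∃ cL : ℝ, 0 ≤ cL ∧ ∀ (B : Set (Pt n)) (g : (ℝ × (Fin (m+1) → ℝ)) → ℝ), MeasurableSet B →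
      B ⊆ P ∩ closedBall p0 r1 →
      ∫ p in B, |Df k p w| * g (Th k f L p) = cL * ∫ z in Th k f L '' B, g z := by
  obtain ⟨cL, hcL, h⟩ := exists_cL L
  refine ⟨cL, hcL, ?_⟩
  intro B g hB hBA
  rw [h B _ hB]
  congr 1
  have := haarProd (m := m)
  have hLB : MeasurableSet (L '' B) := L.toHomeomorph.measurableEmbedding.measurableSet_image.2 hB
  have himg : Th k f L '' B = (fun z => Th k f L (L.symm z)) '' (L '' B) := by
    rw [image_image]; simp
  rw [himg, integral_image_eq_integral_abs_det_fderiv_smul volume hLB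
    (f' := fun z => ((Df k (L.symm z)).comp (L.symm : (ℝ × (Fin (m+1) → ℝ)) →L[ℝ] Pt n)).prod
      (ContinuousLinearMap.snd ℝ ℝ (Fin (m+1) → ℝ)))]
  · refine setIntegral_congr_fun hLB ?_
    intro z hz
    simp only [det_shear, smul_eq_mul]
    have : L.symm (1, 0) = w := by rw [← hL]; simp
    simp [this]
  · rintro z ⟨p, hp, rfl⟩
    simp only [Th]
    refine HasFDerivWithinAt.prodMk ?_ ?_
    · have h1 := hR.hasD k p (hBA hp).1
      have h2 : HasFDerivWithinAt (f k) (Df k (L.symm (L p))) B (L.symm (L p)) := by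
        rw [L.symm_apply_apply]; exact h1.mono (fun x hx => (hBA hx).1)
      refine HasFDerivWithinAt.comp (t := B) (L p) h2 (L.symm.hasFDerivAt.hasFDerivWithinAt) ?_
      rintro _ ⟨q, hq, rfl⟩; simpa using hq
    · have : (fun z : ℝ × (Fin (m+1) → ℝ) => (L (L.symm z)).2) = fun z => z.2 := by ext; simp
      rw [this]
      exact hasFDerivWithinAt_snd
  · rintro _ ⟨p, hp, rfl⟩ _ ⟨q, hq, rfl⟩ e
    simp only [L.symm_apply_apply] at e
    rw [Th_inj hR hl L hL (hBA hp) (hBA hq) e]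
end Loc4
end

section
section Loc5
variable {n N m : ℕ} {i k : Fin N} {P : Set (Pt n)} {f : Fin N → Pt n → ℝ}
    {Df : Fin N → Pt n → (Pt n →L[ℝ] ℝ)} {M : ℝ} {p0 w : Pt n} {r1 c0 sg : ℝ}

structure FData (i k : Fin N) (P : Set (Pt n)) (f : Fin N → Pt n → ℝ)
    (Df : Fin N → Pt n → (Pt n →L[ℝ] ℝ)) (φ : Pt n → ℝ) (α : ℝ) (F : (Fin N → ℝ) → ℝ)
    (C K : ℝ) : Prop where
  C0 : 0 ≤ C
  K1 : 1 ≤ K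
  bdd : ∀ t, |F t| ≤ C
  ii : ∀ t a b, IntervalIntegrable (fun r => F (Function.update t k r)) volume a b
  ftc : ∀ t a b, a ≤ b → (∫ p in cellSet i P f (Function.update t k b), φ p) -
    (∫ p in cellSet i P f (Function.update t k a), φ p) = ∫ r in a..b, F (Function.update t k r)
  hol : ∀ (t t' : Fin N → ℝ) (τ δ η : ℝ), 0 < τ → ‖t - t'‖ ≤ τ →
      K * τ ≤ δ → δ ≤ 1 → 0 < η → η ≤ 1 → TransAt i k P f Df t δ η → TransAt i k P f Df t' δ η →
      |F t - F t'| ≤ C * τ ^ α / η ^ 2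

lemma closedAux (hR : RegData P f Df M) (S : Set (Fin N)) (t : Fin N → ℝ) :
    IsCompact {p ∈ P | ∀ l ∈ S, f l p ≤ t l} := by
  refine hR.comp.of_isClosed_subset ?_ (fun p hp => hp.1)
  have : {p ∈ P | ∀ l ∈ S, f l p ≤ t l} = P ∩ ⋂ l : Fin N, ⋂ _ : l ∈ S, (P ∩ f l ⁻¹' Iic (t l)) := by
    ext p; simp only [mem_ofPred_eq, mem_inter_iff, mem_iInter, mem_preimage, mem_Iic]
    exact ⟨fun h => ⟨h.1, fun l hl => ⟨h.1, h.2 l hl⟩⟩, fun h => ⟨h.1, fun l hl => (h.2 l hl).2⟩⟩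
  rw [this]
  refine hR.comp.isClosed.inter (isClosed_iInter fun l => isClosed_iInter fun _ => ?_)
  exact (hR.cont l).preimage_isClosed_of_isClosed hR.comp.isClosed isClosed_Iic

lemma othCompact (hR : RegData P f Df M) (t : Fin N → ℝ) : IsCompact (othSet i k P f t) := by
  have := closedAux hR {l | l ≠ i ∧ l ≠ k} t
  convert this using 1
  ext p; simp [othSet]

lemma cellCompact (hR : RegData P f Df M) (t : Fin N → ℝ) : IsCompact (cellSet i P f t) := by
  have := closedAux hR {l | l ≠ i} t
  convert this using 1
  ext p; simp [cellSet]

lemma integrable_of_bdd {E : Type*} [NormedAddCommGroup E] [ProperSpace E] [MeasureSpace E]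
    [BorelSpace E] [IsFiniteMeasureOnCompacts (volume : Measure E)]
    (g : E → ℝ) (hg : Measurable g) (C R : ℝ) (hC : ∀ z, |g z| ≤ C) (hs : ∀ z, g z ≠ 0 → ‖z‖ ≤ R) :
    Integrable g := by
  have h1 : Function.support g ⊆ closedBall 0 R := fun z hz => by
    rw [mem_closedBall_zero_iff]; exact hs z hz
  rw [← integrableOn_iff_integrable_of_support_subset h1]
  exact Measure.integrableOn_of_bounded (isCompact_closedBall 0 R).measure_lt_top.ne
    hg.aestronglyMeasurable (ae_of_all _ hC)

lemma holder_help {x α : ℝ} (hx : 0 < x) (hx1 : x ≤ 1) (hα1 : α ≤ 1) : x ≤ x ^ α := by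
  calc x = x ^ (1:ℝ) := (Real.rpow_one x).symm
    _ ≤ x ^ α := Real.rpow_le_rpow_of_exponent_ge hx hx1 hα1

lemma othUpd (t : Fin N → ℝ) (r : ℝ) :
    othSet i k P f (Function.update t k r) = othSet i k P f t := by
  ext p
  simp only [othSet, mem_ofPred_eq]
  refine and_congr_right fun _ => forall_congr' fun l => forall_congr' fun _ => ?_
  refine forall_congr' fun h => ?_
  rw [Function.update_of_ne h]

set_option maxHeartbeats 1000000 in
lemma localF (hki : k ≠ i) (hR : RegData P f Df M) (hl : LocData k P Df M p0 w r1 c0 sg)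
    (L : Pt n ≃L[ℝ] ℝ × (Fin (m+1) → ℝ)) (hL : L w = (1, 0))
    (φ : Pt n → ℝ) (α Bφ : ℝ) (hα : 0 < α) (hα1 : α ≤ 1) (hB0 : 0 ≤ Bφ)
    (hφc : ContinuousOn φ P) (hφb : ∀ p ∈ P, |φ p| ≤ Bφ)
    (hφh : ∀ p ∈ P, ∀ q ∈ P, |φ p - φ q| ≤ Bφ * ‖p - q‖ ^ α)
    (hφ0 : ∀ p ∈ P, r1 / 2 < dist p p0 → φ p = 0) :
    ∃ F C K, FData i k P f Df φ α F C K := by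
  have hM := hR.Mone
  have hc := hl.c0pos
  have hw := hl.wpos
  have hr := hl.r1pos
  obtain ⟨CL, hCL, hCLi⟩ := locInv hR hl L hL
  obtain ⟨cL, hcL, hcov⟩ := Th_cov hR hl L hL
  obtain ⟨K, Cb, hK, hCb, hbad⟩ := badLem hki hR hl L hL
  set A := P ∩ closedBall p0 r1 with hA
  have hAc : IsCompact A := hR.comp.inter_right isClosed_closedBall
  have hinj := Th_inj hR hl L hL
  set T := Th k f L with hT
  set inv := Function.invFunOn T A with hinvdef
  have hinv : ∀ p ∈ A, inv (T p) = p := fun p hp => hinj.leftInvOn_invFunOn hp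
  have hTc : ContinuousOn T A := by
    refine ContinuousOn.prodMk ((hR.cont k).mono inter_subset_left) ?_
    exact (continuous_snd.comp L.continuous).continuousOn
  have hinvc : ContinuousOn inv (T '' A) := by
    have : LipschitzOnWith CL.toNNReal inv (T '' A) := by
      refine LipschitzOnWith.of_dist_le_mul ?_
      rintro _ ⟨p, hp, rfl⟩ _ ⟨q, hq, rfl⟩
      rw [hinv p hp, hinv q hq, Real.coe_toNNReal _ (by linarith), dist_comm, dist_eq_norm,
        dist_comm (T p), Prod.dist_eq]
      exact hCLi p hp.1 hp.2 q hq.1 hq.2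
    exact this.continuousOn
  have hDc : ContinuousOn (Df k) P := by
    have : LipschitzOnWith M.toNNReal (Df k) P := by
      refine LipschitzOnWith.of_dist_le_mul fun p hp q hq => ?_
      rw [Real.coe_toNNReal _ (by linarith), dist_eq_norm, dist_eq_norm]
      exact hR.lipD k q hq p hp
    exact this.continuousOn
  have hJ0 : ∀ p ∈ A, c0 ≤ |Df k p w| := fun p hp => hl.absw hp.1 hp.2
  set ψ : Pt n → ℝ := fun p => cL * (φ p / |Df k p w|) with hψ
  have hψc : ContinuousOn ψ A := by
    refine continuousOn_const.mul (ContinuousOn.div (hφc.mono inter_subset_left) ?_ ?_)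
    · exact ((hDc.mono inter_subset_left).clm_apply continuousOn_const).abs
    · intro p hp; have := hJ0 p hp; linarith
  set CB := cL * (Bφ / c0) with hCB
  have hCB0 : 0 ≤ CB := by positivity
  have hψb : ∀ p ∈ A, |ψ p| ≤ CB := by
    intro p hp
    simp only [hψ, hCB]
    rw [abs_mul, abs_of_nonneg hcL, abs_div, abs_abs]
    gcongr
    · exact hφb p hp.1
    · exact hJ0 p hp
  set CH := cL * (Bφ * CL / c0 + Bφ * (M * ‖w‖ * CL) / c0^2) with hCH
  have hCH0 : 0 ≤ CH := by positivity
  have hψh : ∀ τ, 0 < τ → τ ≤ 1 → ∀ p ∈ A, ∀ q ∈ A, ‖p - q‖ ≤ CL * τ → |ψ p - ψ q| ≤ CH * τ ^ α := by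
    intro τ hτ hτ1 p hp q hq hpq
    have j1 := hJ0 p hp
    have j2 := hJ0 q hq
    have j3 : abs (|Df k q w| - |Df k p w|) ≤ M * ‖w‖ * CL * τ := by
      refine (abs_abs_sub_abs_le_abs_sub _ _).trans ?_
      have : Df k q w - Df k p w = (Df k q - Df k p) w := by simp
      rw [this]
      refine ((Df k q - Df k p).le_opNorm w).trans ?_
      have := hR.lipD k p hp.1 q hq.1
      rw [norm_sub_rev] at hpq
      calc _ ≤ (M * (CL * τ)) * ‖w‖ := by gcongr; exact this.trans (by gcongr)
        _ = _ := by ring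
    have j4 : |φ p - φ q| ≤ Bφ * CL * τ ^ α := by
      refine (hφh p hp.1 q hq.1).trans ?_
      rw [mul_assoc]; gcongr
      calc ‖p - q‖ ^ α ≤ (CL * τ) ^ α := by gcongr
        _ = CL ^ α * τ ^ α := Real.mul_rpow (by linarith) hτ.le
        _ ≤ CL * τ ^ α := by
          gcongr
          calc CL ^ α ≤ CL ^ (1:ℝ) := Real.rpow_le_rpow_of_exponent_le hCL hα1
            _ = CL := Real.rpow_one _
    have j5 : ψ p - ψ q = cL * ((φ p - φ q) / |Df k p w| +
        φ q * (|Df k q w| - |Df k p w|) / (|Df k p w| * |Df k q w|)) := by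
      have h1 : |Df k p w| ≠ 0 := by linarith
      have h2 : |Df k q w| ≠ 0 := by linarith
      simp only [hψ]; field_simp; ring
    rw [j5, abs_mul, abs_of_nonneg hcL, hCH, mul_assoc]
    gcongr
    refine (abs_add_le _ _).trans ?_
    rw [add_mul]
    gcongr
    · rw [abs_div, abs_abs, div_mul_eq_mul_div]
      gcongr
    · rw [abs_div, abs_mul, abs_mul, abs_abs, abs_abs, div_mul_eq_mul_div, sq, mul_assoc Bφ]
      gcongr
      · exact hφb q hq.1
      · exact j3.trans (by gcongr; exact holder_help hτ hτ1 hα1)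
  -- the function Φ
  set Φ : (Fin N → ℝ) → (ℝ × (Fin (m+1) → ℝ)) → ℝ := fun t =>
    (T '' (A ∩ othSet i k P f t)).indicator (fun z => ψ (inv z)) with hΦ
  have hScomp : ∀ t, IsCompact (T '' (A ∩ othSet i k P f t)) := fun t =>
    (hAc.inter (othCompact hR t)).image_of_continuousOn (hTc.mono inter_subset_left)
  have hΦm : ∀ t, Measurable (Φ t) := by
    intro t
    rw [hΦ]
    simp only [← Set.piecewise_eq_indicator]
    refine ContinuousOn.measurable_piecewise ?_ continuousOn_const (hScomp t).measurableSet
    refine hψc.comp (hinvc.mono (image_mono inter_subset_left)) ?_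
    rintro _ ⟨p, hp, rfl⟩
    rw [hinv p hp.1]; exact hp.1
  have hΦv : ∀ t p, p ∈ A → p ∈ othSet i k P f t → Φ t (T p) = ψ p := by
    intro t p hp hp2
    simp only [hΦ]
    have hm : T p ∈ T '' (A ∩ othSet i k P f t) := ⟨p, ⟨hp, hp2⟩, rfl⟩
    rw [indicator_of_mem hm, hinv p hp]
  have hΦne : ∀ t z, Φ t z ≠ 0 → ∃ p ∈ A, p ∈ othSet i k P f t ∧ T p = z ∧ Φ t z = ψ p := by
    intro t z hz
    obtain ⟨p, hp, rfl⟩ : z ∈ T '' (A ∩ othSet i k P f t) := by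
      by_contra h; exact hz (indicator_of_notMem h _)
    exact ⟨p, hp.1, hp.2, rfl, hΦv t p hp.1 hp.2⟩
  have hΦb : ∀ t z, |Φ t z| ≤ CB := by
    intro t z
    by_cases hz : Φ t z = 0
    · rw [hz]; simpa
    · obtain ⟨p, hp, -, -, e⟩ := hΦne t z hz
      rw [e]; exact hψb p hp
  obtain ⟨R, hR0, hRb⟩ := (hAc.image_of_continuousOn hTc).isBounded.exists_pos_norm_le
  have hΦs : ∀ t z, Φ t z ≠ 0 → ‖z‖ ≤ R := by
    intro t z hz
    obtain ⟨p, hp, -, rfl, -⟩ := hΦne t z hz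
    exact hRb _ ⟨p, hp, rfl⟩
  have := haarProd (m := m)
  have hΦi : ∀ t, Integrable (Φ t) := fun t => integrable_of_bdd _ (hΦm t) CB R (hΦb t) (hΦs t)
  have hsm : ∀ t r, Measurable (fun y => Φ t (r, y)) := fun t r => (hΦm t).comp (by fun_prop)
  have hss : ∀ t r y, Φ t (r, y) ≠ 0 → ‖y‖ ≤ R := fun t r y h =>
    (norm_snd_le (r, y)).trans (hΦs t _ h)
  have hsi : ∀ t r, Integrable (fun y => Φ t (r, y)) := fun t r =>
    integrable_of_bdd _ (hsm t r) CB R (fun y => hΦb t _) (hss t r)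
  set V := volume.real (closedBall (0 : Fin (m+1) → ℝ) R) with hV
  have hV0 : 0 ≤ V := measureReal_nonneg
  have hVfin : volume (closedBall (0 : Fin (m+1) → ℝ) R) < ⊤ := (isCompact_closedBall 0 R).measure_lt_top
  set F : (Fin N → ℝ) → ℝ := fun t => ∫ y, Φ t (t k, y) with hF
  have hFu : ∀ t r, F (Function.update t k r) = ∫ y, Φ t (r, y) := by
    intro t r
    simp only [hF, hΦ, othUpd, Function.update_self]
  have hCfin : 0 ≤ CB * V + (CH * V + 4 * CB * Cb) := by positivity
  refine ⟨F, CB * V + (CH * V + 4 * CB * Cb), K, hCfin, hK, ?_, ?_, ?_, ?_⟩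
  · intro t
    simp only [hF]
    rw [← setIntegral_eq_integral_of_forall_compl_eq_zero (s := closedBall 0 R)
      (fun y hy => by
        by_contra h; exact hy (by rw [mem_closedBall_zero_iff]; exact hss _ _ _ h))]
    have := norm_setIntegral_le_of_norm_le_const (f := fun y => Φ t (t k, y)) (C := CB) hVfin
      (fun y _ => hΦb t _)
    have : 0 ≤ CH * V + 4 * CB * Cb := by positivity
    rw [Real.norm_eq_abs] at *; linarith
  · intro t a b
    simp only [hFu]
    have h1 := (hΦi t)
    rw [Measure.volume_eq_prod] at h1
    exact h1.integral_prod_left.intervalIntegrable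
  · intro t a b hab
    simp only [hFu]
    have hsub : cellSet i P f (Function.update t k a) ⊆ cellSet i P f (Function.update t k b) := by
      rintro p ⟨hp, h⟩
      refine ⟨hp, fun l hli => ?_⟩
      have := h l hli
      by_cases hlk : l = k
      · subst hlk; simp at this ⊢; linarith
      · simpa [hlk] using this
    have hint : ∀ t, IntegrableOn φ (cellSet i P f t) := fun t =>
      (hφc.mono fun p hp => hp.1).integrableOn_compact (cellCompact hR t)
    rw [← integral_diff (cellCompact hR _).measurableSet (hint _) hsub]
    have hD : cellSet i P f (Function.update t k b) \ cellSet i P f (Function.update t k a) =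
        {p ∈ othSet i k P f t | f k p ∈ Ioc a b} := by
      ext p
      constructor
      · rintro ⟨⟨hp, h1⟩, h2⟩
        refine ⟨⟨hp, fun l hli hlk => by simpa [hlk] using h1 l hli⟩, ?_, by simpa using h1 k hki⟩
        by_contra hcon
        push Not at hcon
        refine h2 ⟨hp, fun l hli => ?_⟩
        by_cases hlk : l = k
        · subst hlk; simpa using hcon
        · simpa [hlk] using h1 l hli
      · rintro ⟨⟨hp, h1⟩, h2, h3⟩
        refine ⟨⟨hp, fun l hli => ?_⟩, fun h => ?_⟩
        · by_cases hlk : l = k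
          · subst hlk; simpa using h3
          · simpa [hlk] using h1 l hli hlk
        · have := h.2 k hki
          simp at this; linarith
    have hDm : MeasurableSet {p ∈ othSet i k P f t | f k p ∈ Ioc a b} := by
      rw [← hD]; exact (cellCompact hR _).measurableSet.diff (cellCompact hR _).measurableSet
    rw [hD]
    set D := {p ∈ othSet i k P f t | f k p ∈ Ioc a b} with hDdef
    have e1 : ∫ p in D, φ p = ∫ p in A ∩ D, φ p := by
      refine setIntegral_eq_of_subset_of_forall_diff_eq_zero hDm inter_subset_right ?_
      rintro p ⟨hp, hpA⟩
      refine hφ0 p hp.1.1 ?_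
      by_contra hcon
      push Not at hcon
      exact hpA ⟨⟨hp.1.1, by rw [mem_closedBall]; linarith⟩, hp⟩
    have hADm : MeasurableSet (A ∩ D) := hAc.measurableSet.inter hDm
    have e2 := hcov (A ∩ D) (fun z => φ (inv z) / |Df k (inv z) w|) hADm inter_subset_left
    have e3 : ∫ p in A ∩ D, φ p = ∫ p in A ∩ D, |Df k p w| * (φ (inv (T p)) / |Df k (inv (T p)) w|) := by
      refine setIntegral_congr_fun hADm ?_
      intro p hp
      have := hJ0 p hp.1
      have h1 : |Df k p w| ≠ 0 := by linarith
      simp only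
      rw [hinv p hp.1]; field_simp
    rw [e1, e3, e2, ← integral_const_mul]
    have himg : T '' (A ∩ D) = (Ioc a b ×ˢ univ) ∩ T '' (A ∩ othSet i k P f t) := by
      ext z
      constructor
      · rintro ⟨p, ⟨hp, hp1, hp2⟩, rfl⟩
        exact ⟨⟨hp2, mem_univ _⟩, p, ⟨hp, hp1⟩, rfl⟩
      · rintro ⟨⟨hz, -⟩, p, ⟨hp, hp1⟩, rfl⟩
        exact ⟨p, ⟨hp, hp1, hz⟩, rfl⟩
    rw [himg, ← setIntegral_indicator (hScomp t).measurableSet, intervalIntegral.integral_of_le hab]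
    have e4 := setIntegral_prod (μ := (volume : Measure ℝ))
      (ν := (volume : Measure (Fin (m+1) → ℝ))) (s := Ioc a b) (t := univ) (Φ t) (by
        rw [← Measure.volume_eq_prod]; exact (hΦi t).integrableOn)
    rw [← Measure.volume_eq_prod] at e4
    simp only [Measure.restrict_univ] at e4
    exact e4
  · intro t t' τ δ η hτ htt hKτ hδ hη hη1 hTr hTr'
    have hτ1 : τ ≤ 1 := by nlinarith
    set B1 := badSet i k P f p0 r1 L t t'
    set B2 := badSet i k P f p0 r1 L t' t
    have hB1 := hbad t t' τ δ η hτ htt hKτ hδ hη hη1 hTr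
    have hB2 := hbad t' t τ δ η hτ (by rw [norm_sub_rev]; exact htt) hKτ hδ hη hη1 hTr'
    set W := toMeasurable volume (B1 ∪ B2) with hW
    have hX0 : 0 ≤ Cb * τ / η^2 := by positivity
    have hWv : volume W ≤ ENNReal.ofReal (2 * (Cb * τ / η^2)) := by
      rw [hW, measure_toMeasurable]
      refine (measure_union_le _ _).trans ((add_le_add hB1 hB2).trans ?_)
      rw [← ENNReal.ofReal_add hX0 hX0, two_mul]
    have hWr : volume.real W ≤ 2 * (Cb * τ / η^2) :=
      ENNReal.toReal_le_of_le_ofReal (by positivity) hWv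
    have hWfin : volume W ≠ ⊤ := (hWv.trans_lt ENNReal.ofReal_lt_top).ne
    have htk : |t k - t' k| ≤ τ := (norm_le_pi_norm (t - t') k).trans htt
    have half : ∀ (s s' : Fin N → ℝ), |s k - s' k| ≤ τ → ∀ y, y ∉ badSet i k P f p0 r1 L s s' →
        Φ s (s k, y) ≠ 0 → |Φ s (s k, y) - Φ s' (s' k, y)| ≤ CH * τ ^ α := by
      intro s s' hss y hy hne
      obtain ⟨p, hp, hp2, hp3, hp4⟩ := hΦne _ _ hne
      simp only [hT, Th, Prod.mk.injEq] at hp3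
      have hdp : dist p p0 ≤ r1/2 := by
        by_contra hcon
        push Not at hcon
        have := hφ0 p hp.1 hcon
        rw [hp4] at hne
        apply hne; simp [hψ, this]
      have hex : ∃ p' ∈ othSet i k P f s', dist p' p0 ≤ r1 ∧ f k p' = s' k ∧ (L p').2 = y := by
        by_contra hcon
        exact hy ⟨p, hp2, hdp, hp3.1, hp3.2, hcon⟩
      obtain ⟨p', hp'1, hp'2, hp'3, hp'4⟩ := hex
      have hp'A : p' ∈ A := ⟨hp'1.1, hp'2⟩
      have e : (s' k, y) = T p' := by simp only [hT, Th, hp'3, hp'4]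
      rw [hp4, e, hΦv s' p' hp'A hp'1]
      refine hψh τ hτ hτ1 p hp p' hp'A ?_
      have := hCLi p' hp'A.1 hp'2 p hp.1 hp.2
      refine this.trans ?_
      rw [hp3.1, hp3.2, hp'3, hp'4, sub_self, norm_zero, max_eq_left (abs_nonneg _)]
      gcongr
    have pt : ∀ y, |Φ t (t k, y) - Φ t' (t' k, y)| ≤
        (closedBall (0 : Fin (m+1) → ℝ) R).indicator (fun _ => CH * τ ^ α) y +
        W.indicator (fun _ => 2 * CB) y := by
      intro y
      have n1 : 0 ≤ (closedBall (0 : Fin (m+1) → ℝ) R).indicator (fun _ => CH * τ ^ α) y :=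
        indicator_nonneg (fun _ _ => by positivity) _
      have n2 : 0 ≤ W.indicator (fun _ => 2 * CB) y :=
        indicator_nonneg (fun _ _ => by positivity) _
      by_cases hyW : y ∈ W
      · rw [indicator_of_mem hyW]
        have a1 := hΦb t (t k, y)
        have a2 := hΦb t' (t' k, y)
        have := abs_sub (Φ t (t k, y)) (Φ t' (t' k, y))
        linarith
      have hy12 : y ∉ B1 ∪ B2 := fun h => hyW (subset_toMeasurable _ _ h)
      rw [mem_union, not_or] at hy12
      by_cases z1 : Φ t (t k, y) = 0
      · by_cases z2 : Φ t' (t' k, y) = 0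
        · rw [z1, z2]; simp; linarith
        · have := half t' t (by rw [abs_sub_comm]; exact htk) y hy12.2 z2
          rw [abs_sub_comm] at this
          rw [indicator_of_mem (by rw [mem_closedBall_zero_iff]; exact hss _ _ _ z2)]
          linarith
      · have := half t t' htk y hy12.1 z1
        rw [indicator_of_mem (by rw [mem_closedBall_zero_iff]; exact hss _ _ _ z1)]
        linarith
    simp only [hF]
    rw [← integral_sub (hsi _ _) (hsi _ _)]
    have hWm : MeasurableSet W := measurableSet_toMeasurable _ _
    have i1 : Integrable ((closedBall (0 : Fin (m+1) → ℝ) R).indicator (fun _ => CH * τ ^ α)) :=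
      (integrable_indicator_iff measurableSet_closedBall).2 (integrableOn_const hVfin.ne)
    have i2 : Integrable (W.indicator (fun _ => 2 * CB)) :=
      (integrable_indicator_iff hWm).2 (integrableOn_const hWfin)
    have := norm_integral_le_of_norm_le (f := fun y => Φ t (t k, y) - Φ t' (t' k, y)) (i1.add i2) (ae_of_all _ pt)
    rw [Real.norm_eq_abs] at this
    refine this.trans ?_
    simp only [Pi.add_apply]
    rw [integral_add i1 i2, integral_indicator measurableSet_closedBall, integral_indicator hWm,
      setIntegral_const, setIntegral_const, smul_eq_mul, smul_eq_mul, ← hV]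
    have hτα : τ ≤ τ ^ α := holder_help hτ hτ1 hα1
    have hτα0 : 0 ≤ τ ^ α := hτ.le.trans hτα
    have hη2 : 1 ≤ 1 / η^2 := by
      rw [le_div_iff₀ (by positivity)]; nlinarith
    have g1 : V * (CH * τ ^ α) ≤ (CH * V) * τ ^ α * (1 / η^2) := by
      calc V * (CH * τ ^ α) = (CH * V) * τ ^ α * 1 := by ring
        _ ≤ _ := by gcongr
    have g2 : volume.real W * (2 * CB) ≤ 4 * CB * Cb * τ ^ α * (1 / η^2) := by
      calc volume.real W * (2 * CB) ≤ 2 * (Cb * τ / η^2) * (2 * CB) := by gcongr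
        _ = 4 * CB * Cb * τ * (1 / η^2) := by ring
        _ ≤ _ := by gcongr
    have g3 : 0 ≤ CB * V * τ ^ α * (1 / η^2) := by positivity
    have : (CB * V + (CH * V + 4 * CB * Cb)) * τ ^ α / η^2 = CB * V * τ ^ α * (1 / η^2) +
      (CH * V) * τ ^ α * (1 / η^2) + 4 * CB * Cb * τ ^ α * (1 / η^2) := by ring
    linarith
end Loc5
end

section
section Loc6
variable {n N m : ℕ} {i k : Fin N} {P : Set (Pt n)} {f : Fin N → Pt n → ℝ}
    {Df : Fin N → Pt n → (Pt n →L[ℝ] ℝ)} {M : ℝ}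

lemma exLoc (hR : RegData P f Df M) (m0 : ℝ) (hm0 : 0 < m0) (hm : ∀ p ∈ P, m0 ≤ ‖Df k p‖) :
    ∃ r1 c0 : ℝ, 0 < r1 ∧ ∀ p0 ∈ P, ∃ w sg, LocData k P Df M p0 w r1 c0 sg := by
  obtain ⟨q0, hq0⟩ := hR.inter
  obtain ⟨r0, hr0, hball⟩ := Metric.nhds_basis_closedBall.mem_iff.1 (mem_interior_iff_mem_nhds.1 hq0)
  obtain ⟨R, hRp, hPR⟩ := hR.bdd
  have hM := hR.Mone
  set W := 2 * R + r0 with hW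
  have hW0 : 0 < W := by positivity
  set β := r0 * m0 / 8 with hβ
  have hβ0 : 0 < β := by positivity
  set c0 := min (β/2) (r0/4) with hc0
  have hc0p : 0 < c0 := lt_min (by positivity) (by positivity)
  have hc1 : c0 ≤ β/2 := min_le_left _ _
  have hc2 : c0 ≤ r0/4 := min_le_right _ _
  set r1 := min (r0/4) (c0 / (4 * M * W)) with hr1
  have hr1p : 0 < r1 := lt_min (by positivity) (by positivity)
  have hr2 : r1 ≤ r0/4 := min_le_left _ _
  have hr3 : r1 * (4 * M * W) ≤ c0 := by
    rw [← le_div_iff₀ (by positivity)]; exact min_le_right _ _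
  refine ⟨r1, c0, hr1p, ?_⟩
  intro p0 hp0
  obtain ⟨x, hx1, hx2⟩ := (Df k p0).exists_lt_apply_of_lt_opNorm (r := m0/2)
    (lt_of_lt_of_le (by linarith) (hm p0 hp0))
  rw [Real.norm_eq_abs] at hx2
  have hwex : ∃ w : Pt n, ‖w - (q0 - p0)‖ ≤ r0/2 ∧ β ≤ |Df k p0 w| := by
    by_cases h : β ≤ |Df k p0 (q0 - p0)|
    · exact ⟨q0 - p0, by simp; positivity, h⟩
    · push Not at h
      refine ⟨q0 - p0 + (r0/2) • x, ?_, ?_⟩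
      · rw [add_sub_cancel_left, norm_smul, Real.norm_of_nonneg (by positivity)]
        nlinarith
      · rw [map_add, map_smul, smul_eq_mul]
        have h1 : |(r0/2) * Df k p0 x| = r0/2 * |Df k p0 x| := by
          rw [abs_mul, abs_of_pos (by positivity)]
        have h2 := abs_sub_abs_le_abs_sub ((r0/2) * Df k p0 x) (-(Df k p0 (q0 - p0)))
        rw [abs_neg, sub_neg_eq_add, add_comm] at h2
        have : r0/2 * (m0/2) ≤ r0/2 * |Df k p0 x| := by gcongr
        linarith
  obtain ⟨w, hw1, hw2⟩ := hwex
  have hwW : ‖w‖ ≤ W := by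
    have e : w = (w - (q0 - p0)) + (q0 - p0) := by abel
    rw [e]
    have h1 := hPR p0 hp0
    have h2 := hPR q0 (interior_subset hq0)
    linarith [norm_add_le (w - (q0 - p0)) (q0 - p0), norm_sub_le q0 p0]
  have hin : ∀ p : Pt n, dist p p0 ≤ r1 → ∀ v : Pt n, ‖v‖ ≤ r0/4 → p + w + v ∈ P := by
    intro p hpd v hv
    apply hball
    rw [mem_closedBall, dist_eq_norm]
    have e : p + w + v - q0 = (p - p0) + (w - (q0 - p0)) + v := by abel
    rw [e]
    rw [dist_eq_norm] at hpd
    linarith [norm_add_le (p - p0 + (w - (q0 - p0))) v, norm_add_le (p - p0) (w - (q0 - p0))]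
  have hsgex : ∃ sg : ℝ, (sg = 1 ∨ sg = -1) ∧ β ≤ sg * Df k p0 w := by
    rcases abs_cases (Df k p0 w) with ⟨h, -⟩ | ⟨h, -⟩
    · exact ⟨1, Or.inl rfl, by linarith⟩
    · exact ⟨-1, Or.inr rfl, by linarith⟩
  obtain ⟨sg, hsg, hsgw⟩ := hsgex
  have hsga : |sg| = 1 := by rcases hsg with h | h <;> rw [h] <;> norm_num
  refine ⟨w, sg, hp0, hr1p, hc0p, hsg, ?_, ?_, ?_, ?_⟩
  · intro p hp hpd s hs
    have h1 : p + w ∈ P := by simpa using hin p hpd 0 (by simp; positivity)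
    have := hR.conv hp h1 (a := 1 - s) (b := s) (by linarith [hs.2]) hs.1 (by ring)
    convert this using 1
    rw [smul_add, ← add_assoc, ← add_smul, sub_add_cancel, one_smul]
  · intro p hp hpd
    have h1 := hR.lipD k p0 hp0 p hp
    have h2 : |sg * (Df k p w - Df k p0 w)| ≤ M * r1 * W := by
      rw [abs_mul, hsga, one_mul]
      have : Df k p w - Df k p0 w = (Df k p - Df k p0) w := by simp
      rw [this]
      refine ((Df k p - Df k p0).le_opNorm w).trans ?_
      rw [dist_eq_norm] at hpd
      gcongr
      exact h1.trans (by gcongr)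
    have h3 := (abs_le.1 h2).1
    nlinarith
  · intro p hp hpd ξ hξ
    have hb : ∀ v : Pt n, ‖v‖ ≤ r0/4 → ξ v ≤ -ξ w := by
      intro v hv
      have := hξ _ (hin p hpd v hv)
      have e : p + w + v - p = w + v := by abel
      rw [e, map_add] at this
      linarith
    have hw0 : 0 ≤ -ξ w := by simpa using hb 0 (by simp; positivity)
    have : ‖ξ‖ ≤ (4/r0) * (-ξ w) := by
      refine ContinuousLinearMap.opNorm_le_bound _ (by positivity) ?_
      intro x
      by_cases hx : x = 0
      · simp [hx]
      have hxn : 0 < ‖x‖ := norm_pos_iff.2 hx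
      have a1 := hb ((r0/4/‖x‖) • x) (by
        rw [norm_smul, Real.norm_of_nonneg (by positivity)]; field_simp; rfl)
      have a2 := hb ((r0/4/‖x‖) • (-x)) (by
        rw [norm_smul, Real.norm_of_nonneg (by positivity), norm_neg]; field_simp; rfl)
      rw [map_smul, smul_eq_mul] at a1 a2
      rw [map_neg] at a2
      have e : ∀ y, r0/4/‖x‖ * y ≤ -ξ w → y ≤ (4/r0) * (-ξ w) * ‖x‖ := by
        intro y hy
        calc y = (4/r0) * (r0/4/‖x‖ * y) * ‖x‖ := by field_simp
          _ ≤ _ := by gcongr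
      rw [Real.norm_eq_abs, abs_le]
      constructor
      · linarith [e _ a2]
      · exact e _ a1
    calc c0 * ‖ξ‖ ≤ (r0/4) * ((4/r0) * (-ξ w)) := by gcongr
      _ = _ := by field_simp
  · have : r1 * (4 * M * ‖w‖) ≤ r1 * (4 * M * W) := by gcongr
    linarith

def HB (P : Set (Pt n)) (α : ℝ) (u : Pt n → ℝ) : Prop :=
  ContinuousOn u P ∧ ∃ B : ℝ, 0 ≤ B ∧ (∀ p ∈ P, |u p| ≤ B) ∧
    ∀ p ∈ P, ∀ q ∈ P, |u p - u q| ≤ B * ‖p - q‖ ^ α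

lemma HB.mul {α : ℝ} {u v : Pt n → ℝ} (hu : HB P α u) (hv : HB P α v) :
    HB P α (fun p => u p * v p) := by
  obtain ⟨cu, B, hB, hub, huh⟩ := hu
  obtain ⟨cv, B', hB', hvb, hvh⟩ := hv
  refine ⟨cu.mul cv, 2 * B * B', by positivity, ?_, ?_⟩
  · intro p hp
    rw [abs_mul]
    have : |u p| * |v p| ≤ B * B' := by gcongr; exact hub p hp; exact hvb p hp
    nlinarith
  · intro p hp q hq
    have e : u p * v p - u q * v q = (u p - u q) * v p + u q * (v p - v q) := by ring
    rw [e]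
    refine (abs_add_le _ _).trans ?_
    rw [abs_mul, abs_mul]
    have h1 : |u p - u q| * |v p| ≤ (B * ‖p - q‖ ^ α) * B' := by
      gcongr; exact huh p hp q hq; exact hvb p hp
    have h2 : |u q| * |v p - v q| ≤ B * (B' * ‖p - q‖ ^ α) := by
      gcongr; exact hub q hq; exact hvh p hp q hq
    linarith

lemma HB.ofLip {α : ℝ} (hα : 0 < α) (hα1 : α ≤ 1) (hP : IsCompact P) {u : Pt n → ℝ} (K : ℝ) (hK : 0 ≤ K)
    (h : ∀ p ∈ P, ∀ q ∈ P, |u p - u q| ≤ K * ‖p - q‖) : HB P α u := by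
  have hc : ContinuousOn u P := by
    have : LipschitzOnWith K.toNNReal u P := by
      refine LipschitzOnWith.of_dist_le_mul fun p hp q hq => ?_
      rw [Real.coe_toNNReal _ hK, Real.dist_eq, dist_eq_norm]
      exact h p hp q hq
    exact this.continuousOn
  obtain ⟨B1, hB1⟩ := hP.exists_bound_of_continuousOn hc
  obtain ⟨R, hR1, hR2⟩ := hP.isBounded.exists_pos_norm_le
  refine ⟨hc, |B1| + K * (2 * R + 1), by positivity, ?_, ?_⟩
  · intro p hp
    have := hB1 p hp
    rw [Real.norm_eq_abs] at this
    have : 0 ≤ K * (2 * R + 1) := by positivity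
    linarith [le_abs_self B1]
  · intro p hp q hq
    refine (h p hp q hq).trans ?_
    by_cases h0 : p = q
    · subst h0; simp; positivity
    set x := ‖p - q‖
    have hx : 0 < x := norm_pos_iff.2 (sub_ne_zero.2 h0)
    have hxR : x ≤ 2 * R := by linarith [norm_sub_le p q, hR2 p hp, hR2 q hq]
    have key : x ≤ (2 * R + 1) * x ^ α := by
      by_cases hx1 : x ≤ 1
      · have := holder_help hx hx1 hα1
        nlinarith
      · push Not at hx1
        have : 1 ≤ x ^ α := Real.one_le_rpow hx1.le hα.le
        nlinarith
    have : 0 ≤ |B1| * x ^ α := by positivity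
    calc K * x ≤ K * ((2 * R + 1) * x ^ α) := by gcongr
      _ ≤ _ := by linarith
end Loc6
end

section
section Loc7
variable {n N m : ℕ} {i k : Fin N} {P : Set (Pt n)} {f : Fin N → Pt n → ℝ}
    {Df : Fin N → Pt n → (Pt n →L[ℝ] ℝ)} {M : ℝ}

lemma partUnity (hP : IsCompact P) (r : ℝ) (hr : 0 < r) (α : ℝ) (hα : 0 < α) (hα1 : α ≤ 1) :
    ∃ (S : Finset (Pt n)) (χ : Pt n → Pt n → ℝ), (∀ b ∈ S, b ∈ P) ∧ (∀ b, HB P α (χ b)) ∧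
      (∀ b p, r < dist p b → χ b p = 0) ∧ ∀ p ∈ P, ∑ b ∈ S, χ b p = 1 := by
  obtain ⟨S, hSP, hScov⟩ := hP.elim_nhds_subcover (fun b => ball b r) (fun b _ => ball_mem_nhds b hr)
  set u : Pt n → Pt n → ℝ := fun b p => max 0 (r - dist p b) with hu
  have hu0 : ∀ b p, 0 ≤ u b p := fun b p => le_max_left _ _
  have hul : ∀ b p q, |u b p - u b q| ≤ 1 * ‖p - q‖ := by
    intro b p q
    rw [one_mul, ← dist_eq_norm]
    simp only [hu]
    refine (abs_max_sub_max_le_max _ _ _ _).trans ?_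
    rw [sub_self, abs_zero, max_eq_right (abs_nonneg _)]
    have : r - dist p b - (r - dist q b) = -(dist p b - dist q b) := by ring
    rw [this, abs_neg]
    exact abs_dist_sub_le p q b
  set s : Pt n → ℝ := fun p => ∑ b ∈ S, u b p with hs
  have hsl : ∀ p q, |s p - s q| ≤ S.card * ‖p - q‖ := by
    intro p q
    simp only [hs]
    rw [← Finset.sum_sub_distrib]
    refine (Finset.abs_sum_le_sum_abs _ _).trans ?_
    refine (Finset.sum_le_sum fun b _ => hul b p q).trans ?_
    rw [Finset.sum_const, nsmul_eq_mul, one_mul]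
  have hsc : Continuous s := by
    simp only [hs, hu]; fun_prop
  have hspos : ∀ p ∈ P, 0 < s p := by
    intro p hp
    obtain ⟨b, hb, hpb⟩ := mem_iUnion₂.1 (hScov hp)
    have : 0 < u b p := lt_max_of_lt_right (by rw [mem_ball] at hpb; linarith)
    exact lt_of_lt_of_le this (Finset.single_le_sum (f := fun b => u b p) (fun b _ => hu0 b p) hb)
  have hs0 : ∃ s0 > 0, ∀ p ∈ P, s0 ≤ s p := by
    rcases P.eq_empty_or_nonempty with h | h
    · exact ⟨1, one_pos, by simp [h]⟩
    · obtain ⟨z, hz, hmin⟩ := hP.exists_isMinOn h hsc.continuousOn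
      exact ⟨s z, hspos z hz, fun p hp => hmin hp⟩
  obtain ⟨s0, hs0, hsge⟩ := hs0
  have hinv : HB P α (fun p => (s p)⁻¹) := by
    refine HB.ofLip hα hα1 hP (S.card / s0^2) (by positivity) ?_
    intro p hp q hq
    have h1 := hsge p hp
    have h2 := hsge q hq
    have e : (s p)⁻¹ - (s q)⁻¹ = (s q - s p) / (s p * s q) := by
      have : s p ≠ 0 := by linarith
      have : s q ≠ 0 := by linarith
      field_simp
    rw [e, abs_div, abs_of_pos (by have := hspos p hp; have := hspos q hq; positivity : 0 < s p * s q), div_mul_eq_mul_div, abs_sub_comm, sq]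
    gcongr
    · exact hsl p q
  refine ⟨S, fun b p => u b p * (s p)⁻¹, hSP, ?_, ?_, ?_⟩
  · intro b
    exact (HB.ofLip hα hα1 hP 1 zero_le_one (fun p _ q _ => hul b p q)).mul hinv
  · intro b p hd
    have : u b p = 0 := max_eq_left (by linarith)
    simp [this]
  · intro p hp
    rw [← Finset.sum_mul]
    exact mul_inv_cancel₀ (hspos p hp).ne'

lemma globalF (hn : 2 ≤ n) (hki : k ≠ i) (hR : RegData P f Df M) (m0 : ℝ) (hm0 : 0 < m0)
    (hm : ∀ p ∈ P, m0 ≤ ‖Df k p‖) (α : ℝ) (hα : 0 < α) (hα1 : α ≤ 1) (σ : Pt n → ℝ)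
    (hσ : HB P α σ) : ∃ F C K, FData i k P f Df σ α F C K := by
  obtain ⟨m, rfl⟩ : ∃ m, n = m + 2 := ⟨n - 2, by omega⟩
  obtain ⟨r1, c0, hr1, hloc⟩ := exLoc hR m0 hm0 hm
  obtain ⟨S, χ, hSP, hχ, hχ0, hχ1⟩ := partUnity hR.comp (r1/2) (by positivity) α hα hα1
  have hex : ∀ b ∈ S, ∃ F C K, FData i k P f Df (fun p => σ p * χ b p) α F C K := by
    intro b hb
    obtain ⟨w, sg, hl⟩ := hloc b (hSP b hb)
    obtain ⟨L, hL⟩ := exL (m := m) rfl w (norm_pos_iff.1 hl.wpos)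
    obtain ⟨hc, B, hB, hb1, hb2⟩ := hσ.mul (hχ b)
    exact localF hki hR hl L hL _ α B hα hα1 hB hc hb1 hb2 (fun p hp hd => by
      rw [hχ0 b p hd, mul_zero])
  choose! F C K hF using hex
  refine ⟨fun t => ∑ b ∈ S, F b t, ∑ b ∈ S, C b, 1 + ∑ b ∈ S, K b, ?_, ?_, ?_, ?_, ?_, ?_⟩
  · exact Finset.sum_nonneg fun b hb => (hF b hb).C0
  · have : 0 ≤ ∑ b ∈ S, K b := Finset.sum_nonneg fun b hb => by linarith [(hF b hb).K1]
    linarith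
  · intro t
    exact (Finset.abs_sum_le_sum_abs _ _).trans (Finset.sum_le_sum fun b hb => (hF b hb).bdd t)
  · intro t a b
    have := IntervalIntegrable.sum S (μ := volume) (a := a) (b := b)
      (f := fun b r => F b (Function.update t k r)) (fun c hc => (hF c hc).ii t a b)
    have e : (fun r => ∑ b ∈ S, F b (Function.update t k r))
        = ∑ b ∈ S, fun r => F b (Function.update t k r) := by
      ext r; simp
    rw [e]; exact this
  · intro t a b hab
    have e1 : ∀ t, ∫ p in cellSet i P f t, σ p = ∑ b ∈ S, ∫ p in cellSet i P f t, σ p * χ b p := by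
      intro t
      rw [← integral_finset_sum]
      · refine setIntegral_congr_fun (cellCompact hR t).measurableSet ?_
        intro p hp
        simp only
        rw [← Finset.mul_sum, hχ1 p hp.1, mul_one]
      · intro b hb
        exact ((hσ.mul (hχ b)).1.mono fun p hp => hp.1).integrableOn_compact (cellCompact hR t)
    rw [e1, e1, ← Finset.sum_sub_distrib, intervalIntegral.integral_finset_sum
      (fun c hc => (hF c hc).ii t a b)]
    exact Finset.sum_congr rfl fun c hc => (hF c hc).ftc t a b hab
  · intro t t' τ δ η hτ htt hKτ hδ hη hη1 h1 h2
    rw [← Finset.sum_sub_distrib, Finset.sum_mul, Finset.sum_div]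
    refine (Finset.abs_sum_le_sum_abs _ _).trans (Finset.sum_le_sum fun b hb => ?_)
    refine (hF b hb).hol t t' τ δ η hτ htt (le_trans ?_ hKτ) hδ hη hη1 h1 h2
    have : K b ≤ ∑ b ∈ S, K b := Finset.single_le_sum (f := K) (fun b hb => by linarith [(hF b hb).K1]) hb
    nlinarith
end Loc7
end

section
def ff {n N : ℕ} (c : Pt n → Fin N → ℝ) (e : Fin N → Pt n → Pt n) (i k : Fin N) (p : Pt n) : ℝ :=
  -c (e i p) k + c (e i p) i

structure Charts {n N : ℕ} (X : Set (Pt n)) (c : Pt n → Fin N → ℝ) (μ : Measure (Pt n)) (α : ℝ)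
    (Xi : Fin N → Set (Pt n)) (e j : Fin N → Pt n → Pt n)
    (E J : Fin N → Pt n → (Pt n →L[ℝ] Pt n)) (g : Fin N → Pt n → (Pt n →L[ℝ] ℝ))
    (σ : Fin N → Pt n → ℝ) (B m0 M R : ℝ) : Prop where
  emap : ∀ i, ∀ p ∈ Xi i, e i p ∈ X
  jmap : ∀ i, ∀ x ∈ X, j i x ∈ Xi i
  je : ∀ i, ∀ p ∈ Xi i, j i (e i p) = p
  ej : ∀ i, ∀ x ∈ X, e i (j i x) = x
  hE : ∀ i, ∀ p ∈ Xi i, HasFDerivWithinAt (e i) (E i p) (Xi i) p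
  hJ : ∀ i, ∀ x ∈ X, HasFDerivWithinAt (j i) (J i x) X x
  EJ : ∀ i, ∀ p ∈ Xi i, (E i p).comp (J i (e i p)) = ContinuousLinearMap.id ℝ _
  B1 : 1 ≤ B
  bE : ∀ i, ∀ p ∈ Xi i, ‖E i p‖ ≤ B
  bJ : ∀ i, ∀ x ∈ X, ‖J i x‖ ≤ B
  m0pos : 0 < m0
  tw : ∀ x ∈ X, ∀ i k, i ≠ k → m0 ≤ ‖g i x - g k x‖
  qc : ∀ i k t, Convex ℝ {p ∈ Xi i | ff c e i k p ≤ t}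
  Rpos : 0 < R
  ball : ∀ i, Xi i ⊆ closedBall 0 R
  hb : ∀ i, HB (Xi i) α (σ i)
  bσ : ∀ i, ∀ p ∈ Xi i, |σ i p| ≤ B
  Gint : ∀ ψ i, Gfun X c μ ψ i = ∫ p in cellSet i (Xi i) (ff c e i) (fun k => ψ k - ψ i), σ i p
  reg : ∀ i, RegData (Xi i) (ff c e i) (fun k p => (g i (e i p) - g k (e i p)).comp (E i p)) M

lemma signMax {n : ℕ} {P Q : Set (Pt n)} (hQP : Q ⊆ P) (hQ : Convex ℝ Q) {f : Pt n → ℝ}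
    {D : Pt n →L[ℝ] ℝ} {p : Pt n} (hp : p ∈ Q) (hD : HasFDerivWithinAt f D P p)
    (hmax : ∀ q ∈ Q, f q ≤ f p) : ∀ q ∈ Q, D (q - p) ≤ 0 := by
  intro q hq
  refine IsLocalMaxOn.hasFDerivWithinAt_nonpos (s := Q) (f := f) (a := p) ?_ (hD.mono hQP) ?_
  · exact IsMaxOn.localize (fun q hq => hmax q hq)
  · exact sub_mem_posTangentConeAt_of_segment_subset (hQ.segment_subset hp hq)

lemma thin {n : ℕ} (R : ℝ) (hR : 0 < R) : ∃ C : ℝ, 1 ≤ C ∧ ∀ (S : Set (Pt n)), IsCompact S →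
    S ⊆ closedBall 0 R → ∀ p ∈ S, ∀ a b : Pt n →L[ℝ] ℝ, (∀ q ∈ S, a (q - p) ≤ 0) →
    (∀ q ∈ S, b (q - p) ≤ 0) → ∀ lam : ℝ, 0 ≤ lam →
    volume.real S * ‖b‖ ≤ C * ‖b + lam • a‖ := by
  set V := (volume : Measure (Pt n)).real (closedBall 0 (2 * R)) with hV
  have hV0 : 0 ≤ V := measureReal_nonneg
  refine ⟨4 * V + 1, by linarith, ?_⟩
  intro S hS hSR p hp a b ha hb lam hlam
  set η := ‖b + lam • a‖ with hη
  have hη0 : 0 ≤ η := norm_nonneg _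
  have hslab : ∀ q ∈ S, - (2 * R * η) ≤ b (q - p) := by
    intro q hq
    have h1 := ha q hq
    have h2 : |(b + lam • a) (q - p)| ≤ η * ‖q - p‖ := (b + lam • a).le_opNorm _
    have h3 : ‖q - p‖ ≤ 2 * R := by
      have := hSR hq; have := hSR hp
      simp at *
      linarith [norm_sub_le q p]
    have h4 := abs_le.1 h2
    have h5 : η * ‖q - p‖ ≤ η * (2*R) := mul_le_mul_of_nonneg_left h3 hη0
    simp only [_root_.add_apply, _root_.smul_apply, smul_eq_mul] at h4
    nlinarith [mul_nonneg hlam (neg_nonneg.2 h1)]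
  have hSfin : volume S ≠ ⊤ := hS.measure_ne_top
  set v := volume.real S with hv
  have hvV : v ≤ V := measureReal_mono (hSR.trans (closedBall_subset_closedBall (by linarith)))
    (isCompact_closedBall _ _).measure_ne_top
  by_cases hb0 : b = 0
  · rw [hb0]; simp; positivity
  have hbpos : 0 < ‖b‖ := norm_pos_iff.2 hb0
  have key : ∀ K : ℕ, 1 ≤ K → K * (2 * R * η) < R * ‖b‖ → K * v ≤ V := by
    intro K hK hKs
    have hK0 : (0:ℝ) < K := by exact_mod_cast hK
    set u : Pt n := (InnerProductSpace.toDual ℝ (Pt n)).symm b with hu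
    have hun : ‖u‖ = ‖b‖ := LinearIsometryEquiv.norm_map _ _
    have hbu : b u = ‖b‖^2 := by
      have : b u = inner ℝ u u := by
        rw [hu, InnerProductSpace.toDual_symm_apply]
      rw [this, real_inner_self_eq_norm_sq, hun]
    set w : Pt n := (R / (K * ‖b‖)) • u with hw
    have hwn : ‖w‖ = R / K := by
      rw [hw, norm_smul, hun, Real.norm_of_nonneg (by positivity)]; field_simp
    have hbw : b w = R * ‖b‖ / K := by
      rw [hw, map_smul, hbu, smul_eq_mul]; field_simp
    have hm : ∀ i ∈ Finset.range K, volume.real ((fun q => q + (i:ℝ) • w) '' S) = v := by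
      intro i _
      simp [measureReal_def, hv]
    have hsum : ∑ i ∈ Finset.range K, volume.real ((fun q => q + (i:ℝ) • w) '' S)
        = volume.real (⋃ i ∈ Finset.range K, (fun q => q + (i:ℝ) • w) '' S) := by
      rw [measureReal_biUnion_finset (h := fun i _ => (hS.image (by fun_prop)).measure_ne_top)]
      · intro i _ i' _ hii
        rw [Function.onFun, Set.disjoint_left]
        have main : ∀ i i' : ℕ, i < i' → ∀ x, x ∈ (fun q => q + (i:ℝ) • w) '' S →
            x ∉ (fun q => q + (i':ℝ) • w) '' S := by
          rintro i i' hlt x ⟨q, hq, rfl⟩ ⟨q', hq', he⟩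
          simp only at he
          have h1 : b (q' - p) + i' * b w = b (q - p) + i * b w := by
            have := congrArg b he
            simp only [map_add, map_smul, map_sub, smul_eq_mul] at this ⊢
            linarith
          have h2 : ((i:ℝ) + 1) ≤ i' := by exact_mod_cast hlt
          have h3 := hslab q' hq'
          have h4 := hb q hq
          have h5 : 2 * R * η < b w := by
            rw [hbw, lt_div_iff₀ hK0]; linarith
          have h6 : 0 ≤ b w := by rw [hbw]; positivity
          nlinarith
        intro x hx hx'
        rcases lt_or_gt_of_ne hii with h | h
        · exact main _ _ h x hx hx'
        · exact main _ _ h x hx' hx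
      · intro i _
        exact (hS.image (by fun_prop)).measurableSet
    rw [Finset.sum_congr rfl hm] at hsum
    simp only [Finset.sum_const, Finset.card_range, nsmul_eq_mul] at hsum
    rw [hsum]
    refine measureReal_mono ?_ (isCompact_closedBall _ _).measure_ne_top
    intro x hx
    simp only [mem_iUnion] at hx
    obtain ⟨i, hi, q, hq, rfl⟩ := hx
    rw [Finset.mem_range] at hi
    have := hSR hq
    simp only [mem_closedBall, dist_zero_right] at this ⊢
    have h1 : ‖(i:ℝ) • w‖ ≤ R := by
      rw [norm_smul, hwn, Real.norm_of_nonneg (by positivity)]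
      have : (i:ℝ) ≤ K := by exact_mod_cast hi.le
      rw [mul_div_assoc', div_le_iff₀ hK0]
      nlinarith
    linarith [norm_add_le q ((i:ℝ) • w)]
  have hv0 : 0 ≤ v := measureReal_nonneg
  rcases hv0.eq_or_lt with h0 | h0
  · rw [← h0]; simp; positivity
  by_contra hcon
  push Not at hcon
  have hK := Nat.lt_floor_add_one (V / v)
  have hKle := Nat.floor_le (div_nonneg hV0 hv0)
  set K := ⌊V / v⌋₊ + 1 with hKd
  have h1 : V < K * v := by
    rw [div_lt_iff₀ h0] at hK
    rw [hKd]; push_cast; exact hK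
  refine absurd (key K (by omega) ?_) (not_le.2 h1)
  have h2 : (K:ℝ) * v ≤ 2 * V := by
    rw [le_div_iff₀ h0] at hKle
    rw [hKd]; push_cast; linarith
  have h3 : (K * (2 * R * η)) * v < R * ‖b‖ * v := by
    have : (K * (2 * R * η)) * v = (K * v) * (2 * R * η) := by ring
    rw [this]
    have h4 : (K * v) * (2 * R * η) ≤ 2 * V * (2 * R * η) :=
      mul_le_mul_of_nonneg_right h2 (by positivity)
    nlinarith
  exact lt_of_mul_lt_mul_right h3 hv0
end

section
section Tr
variable {n N : ℕ} {X : Set (Pt n)} {c : Pt n → Fin N → ℝ} {μ : Measure (Pt n)} {α : ℝ}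
    {Xi : Fin N → Set (Pt n)} {e j : Fin N → Pt n → Pt n}
    {E J : Fin N → Pt n → (Pt n →L[ℝ] Pt n)} {g : Fin N → Pt n → (Pt n →L[ℝ] ℝ)}
    {σ : Fin N → Pt n → ℝ} {B m0 M R : ℝ}

lemma memCell (H : Charts X c μ α Xi e j E J g σ B m0 M R) {ψ : Fin N → ℝ} {v : Fin N} {x : Pt n}
    (hx : x ∈ X) (hl : ∀ k, -c x k - ψ k ≤ -c x v - ψ v) :
    j v x ∈ cellSet v (Xi v) (ff c e v) (fun k => ψ k - ψ v) := by
  refine ⟨H.jmap v x hx, fun k _ => ?_⟩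
  have := hl k
  simp only [ff, H.ej v x hx]
  linarith

lemma coneV (H : Charts X c μ α Xi e j E J g σ B m0 M R) : ∃ c1 : ℝ, 0 < c1 ∧ c1 ≤ 1 ∧
    ∀ (ψ : Fin N → ℝ) (ε : ℝ) (v : Fin N), 0 < ε → ε ≤ Gfun X c μ ψ v → ∀ x ∈ X,
    (∀ k, -c x k - ψ k ≤ -c x v - ψ v) → ∀ a b : Pt n →L[ℝ] ℝ,
    (∀ q ∈ cellSet v (Xi v) (ff c e v) (fun k => ψ k - ψ v), a (E v (j v x) (q - j v x)) ≤ 0) →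
    (∀ q ∈ cellSet v (Xi v) (ff c e v) (fun k => ψ k - ψ v), b (E v (j v x) (q - j v x)) ≤ 0) →
    ∀ lam : ℝ, 0 ≤ lam → c1 * ε * ‖b‖ ≤ ‖b + lam • a‖ := by
  obtain ⟨C, hC1, hC⟩ := thin (n := n) R H.Rpos
  have hB := H.B1
  refine ⟨1 / (C * B^3), by positivity, ?_, ?_⟩
  · rw [div_le_one (by positivity)]
    nlinarith [one_le_pow₀ hB (n := 3)]
  intro ψ ε v hε hG x hx hl a b ha hb lam hlam
  have hp := memCell H hx hl
  set S := cellSet v (Xi v) (ff c e v) (fun k => ψ k - ψ v) with hS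
  have hSc : IsCompact S := cellCompact (H.reg v) _
  set p := j v x with hpd
  have hpX := H.jmap v x hx
  have hex := H.ej v x hx
  have h1 := hC S hSc (fun q hq => H.ball v hq.1) p hp (a.comp (E v p)) (b.comp (E v p)) ha hb lam hlam
  have hvol : ε ≤ B * volume.real S := by
    rw [H.Gint ψ v] at hG
    refine hG.trans ((le_abs_self _).trans ?_)
    exact norm_setIntegral_le_of_norm_le_const (f := σ v) hSc.measure_lt_top
      (fun q hq => H.bσ v q hq.1)
  have h2 : ‖b‖ ≤ ‖b.comp (E v p)‖ * B := by
    have : b = (b.comp (E v p)).comp (J v x) := by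
      have h := H.EJ v p hpX
      rw [hex] at h
      rw [ContinuousLinearMap.comp_assoc, h, ContinuousLinearMap.comp_id]
    calc ‖b‖ = ‖(b.comp (E v p)).comp (J v x)‖ := by rw [← this]
      _ ≤ ‖b.comp (E v p)‖ * ‖J v x‖ := ContinuousLinearMap.opNorm_comp_le _ _
      _ ≤ _ := mul_le_mul_of_nonneg_left (H.bJ v x hx) (norm_nonneg _)
  have h3 : ‖b.comp (E v p) + lam • a.comp (E v p)‖ ≤ ‖b + lam • a‖ * B := by
    have : b.comp (E v p) + lam • a.comp (E v p) = (b + lam • a).comp (E v p) := by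
      ext; simp
    rw [this]
    exact (ContinuousLinearMap.opNorm_comp_le _ _).trans
      (mul_le_mul_of_nonneg_left (H.bE v p hpX) (norm_nonneg _))
  have h4 : ε * ‖b‖ ≤ C * B^3 * ‖b + lam • a‖ := by
    calc ε * ‖b‖ ≤ (B * volume.real S) * (‖b.comp (E v p)‖ * B) :=
          mul_le_mul hvol h2 (norm_nonneg _) (by positivity)
      _ = B^2 * (volume.real S * ‖b.comp (E v p)‖) := by ring
      _ ≤ B^2 * (C * (‖b + lam • a‖ * B)) := by
          refine mul_le_mul_of_nonneg_left (h1.trans ?_) (by positivity)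
          exact mul_le_mul_of_nonneg_left h3 (by linarith)
      _ = _ := by ring
  rw [div_mul_eq_mul_div, div_mul_eq_mul_div, div_le_iff₀ (by positivity), one_mul]
  linarith

lemma signG (H : Charts X c μ α Xi e j E J g σ B m0 M R) {ψ : Fin N → ℝ} {v k : Fin N}
    (hkv : k ≠ v) {x : Pt n} (hx : x ∈ X) (hl : ∀ k, -c x k - ψ k ≤ -c x v - ψ v)
    (he : -c x k - ψ k = -c x v - ψ v) :
    ∀ q ∈ cellSet v (Xi v) (ff c e v) (fun k => ψ k - ψ v),
      (g v x - g k x) (E v (j v x) (q - j v x)) ≤ 0 := by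
  have hp := memCell H hx hl
  have hd := (H.reg v).hasD k (j v x) hp.1
  simp only [H.ej v x hx] at hd
  have hval : ff c e v k (j v x) = ψ k - ψ v := by
    simp only [ff, H.ej v x hx]; linarith
  intro q hq
  refine signMax (Q := {p ∈ Xi v | ff c e v k p ≤ ψ k - ψ v}) (fun q hq => hq.1) (H.qc v k _)
    (p := j v x) ⟨hp.1, hval.le⟩ hd (fun q hq => by rw [hval]; exact hq.2) q ⟨hq.1, hq.2 k hkv⟩

lemma transX1 (H : Charts X c μ α Xi e j E J g σ B m0 M R) : ∃ c1 : ℝ, 0 < c1 ∧ c1 ≤ 1 ∧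
    ∀ (ψ : Fin N → ℝ) (ε : ℝ), 0 < ε → (∀ v, ε ≤ Gfun X c μ ψ v) → ∀ x ∈ X, ∀ i k l : Fin N,
    k ≠ i → l ≠ i → l ≠ k → (∀ k, -c x k - ψ k ≤ -c x i - ψ i) →
    -c x k - ψ k = -c x i - ψ i → -c x l - ψ l = -c x i - ψ i → ∀ lam : ℝ,
    c1 * ε ≤ ‖(g i x - g l x) - lam • (g i x - g k x)‖ := by
  obtain ⟨c1, hc1, hc11, hc⟩ := coneV H
  have hm := H.m0pos
  refine ⟨min 1 (c1 * m0 / 2), by positivity, min_le_left _ _, ?_⟩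
  intro ψ ε hε hG x hx i k l hki hli hlk hi hk hl lam
  have hk' : ∀ m, -c x m - ψ m ≤ -c x k - ψ k := fun m => by rw [hk]; exact hi m
  have hl' : ∀ m, -c x m - ψ m ≤ -c x l - ψ l := fun m => by rw [hl]; exact hi m
  have base : min 1 (c1 * m0 / 2) * ε ≤ c1 * m0 / 2 * ε :=
    mul_le_mul_of_nonneg_right (min_le_right _ _) hε.le
  -- general vertex bound
  have vert : ∀ v a b : Fin N, a ≠ v → b ≠ v → (∀ m, -c x m - ψ m ≤ -c x v - ψ v) →
      -c x a - ψ a = -c x v - ψ v → -c x b - ψ b = -c x v - ψ v → ∀ lam : ℝ, 0 ≤ lam →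
      c1 * ε * m0 ≤ ‖(g v x - g b x) + lam • (g v x - g a x)‖ := by
    intro v a b hav hbv hv ha hb lam hlam
    refine le_trans ?_ (hc ψ ε v hε (hG v) x hx hv _ _ (signG H hav hx hv ha)
      (signG H hbv hx hv hb) lam hlam)
    exact mul_le_mul_of_nonneg_left (H.tw x hx v b hbv.symm) (by positivity)
  have hpos : 0 < c1 * ε * m0 := by positivity
  rcases le_or_gt lam 0 with h0 | h0
  · have := vert i k l hki hli hi hk hl (-lam) (by linarith)
    have e1 : (g i x - g l x) + (-lam) • (g i x - g k x)
        = (g i x - g l x) - lam • (g i x - g k x) := by module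
    rw [e1] at this
    nlinarith
  rcases le_or_gt 1 lam with h1 | h1
  · have := vert k i l hki.symm hlk hk' hk.symm (hl.trans hk.symm) (lam - 1) (by linarith)
    have e1 : (g k x - g l x) + (lam - 1) • (g k x - g i x)
        = (g i x - g l x) - lam • (g i x - g k x) := by
      module
    rw [e1] at this
    nlinarith
  · rcases le_or_gt (1/2) lam with h2 | h2
    · have := vert l i k hli.symm hlk.symm hl' hl.symm (hk.trans hl.symm) ((1 - lam)/lam)
        (div_nonneg (by linarith) h0.le)
      have e1 : (g i x - g l x) - lam • (g i x - g k x)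
          = (-lam) • ((g l x - g k x) + ((1 - lam)/lam) • (g l x - g i x)) := by
        rw [smul_add, smul_smul]
        have : -lam * ((1 - lam)/lam) = -(1 - lam) := by field_simp
        rw [this]; module
      rw [e1, norm_smul, norm_neg, Real.norm_of_nonneg h0.le]
      nlinarith
    · have := vert l k i hlk.symm hli.symm hl' (hk.trans hl.symm) hl.symm (lam / (1 - lam))
        (div_nonneg h0.le (by linarith))
      have e1 : (g i x - g l x) - lam • (g i x - g k x)
          = (-(1 - lam)) • ((g l x - g i x) + (lam/(1-lam)) • (g l x - g k x)) := by
        rw [smul_add, smul_smul]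
        have : -(1 - lam) * (lam/(1 - lam)) = -lam := by
          have : 1 - lam ≠ 0 := by linarith
          field_simp
        rw [this]; module
      rw [e1, norm_smul, norm_neg, Real.norm_of_nonneg (by linarith)]
      nlinarith

lemma transPt (H : Charts X c μ α Xi e j E J g σ B m0 M R) : ∃ c1 : ℝ, 0 < c1 ∧ c1 ≤ 1 ∧
    ∀ (ψ : Fin N → ℝ) (ε : ℝ), 0 < ε → (∀ v, ε ≤ Gfun X c μ ψ v) → ∀ i k : Fin N, k ≠ i →
    ∀ p ∈ cellSet i (Xi i) (ff c e i) (fun k => ψ k - ψ i), ff c e i k p = ψ k - ψ i →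
    (∀ l, l ≠ i → l ≠ k → ff c e i l p = ψ l - ψ i → ∀ lam : ℝ,
      c1 * ε ≤ ‖(g i (e i p) - g l (e i p)).comp (E i p)
        - lam • (g i (e i p) - g k (e i p)).comp (E i p)‖) ∧
    (∀ ξ : Pt n →L[ℝ] ℝ, (∀ q ∈ Xi i, ξ (q - p) ≤ 0) → ∀ lam : ℝ,
      c1 * ε * ‖ξ‖ ≤ ‖ξ - lam • (g i (e i p) - g k (e i p)).comp (E i p)‖) := by
  obtain ⟨c1, hc1, hc11, hc⟩ := coneV H
  obtain ⟨c2, hc2, hc21, hcc⟩ := transX1 H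
  have hB := H.B1
  refine ⟨min (c2 / B) (c1 / B^2), by positivity,
    (min_le_left _ _).trans ((div_le_one (by positivity)).2 (by linarith)), ?_⟩
  intro ψ ε hε hG i k hki p hp hk
  set x := e i p with hxd
  have hx : x ∈ X := H.emap i p hp.1
  have hpj : j i x = p := H.je i p hp.1
  have hli : ∀ m, -c x m - ψ m ≤ -c x i - ψ i := by
    intro m
    by_cases hm : m = i
    · rw [hm]
    · have := hp.2 m hm
      simp only [ff] at this
      linarith
  have hke : -c x k - ψ k = -c x i - ψ i := by
    simp only [ff] at hk; linarith
  have hlk : ∀ m, -c x m - ψ m ≤ -c x k - ψ k := fun m => by rw [hke]; exact hli m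
  have hEJ := H.EJ i p hp.1
  have hbJ := H.bJ i x hx
  have hcompB : ∀ A : Pt n →L[ℝ] ℝ, ‖A.comp (J i x)‖ ≤ B * ‖A‖ := by
    intro A
    rw [mul_comm]
    exact (ContinuousLinearMap.opNorm_comp_le _ _).trans
      (mul_le_mul_of_nonneg_left hbJ (norm_nonneg _))
  have hback : ∀ A : Pt n →L[ℝ] ℝ, (A.comp (E i p)).comp (J i x) = A := by
    intro A
    rw [ContinuousLinearMap.comp_assoc, hEJ, ContinuousLinearMap.comp_id]
  constructor
  · intro l hl hlk' hle lam
    have hle' : -c x l - ψ l = -c x i - ψ i := by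
      simp only [ff] at hle; linarith
    have h1 := hcc ψ ε hε hG x hx i k l hki hl hlk' hli hke hle' lam
    have h2 := hcompB ((g i x - g l x).comp (E i p) - lam • (g i x - g k x).comp (E i p))
    have e1 : ((g i x - g l x).comp (E i p) - lam • (g i x - g k x).comp (E i p))
        = ((g i x - g l x) - lam • (g i x - g k x)).comp (E i p) := by
      ext; simp
    rw [e1, hback] at h2
    rw [e1]
    have h3 : min (c2 / B) (c1 / B^2) * ε ≤ c2 / B * ε :=
      mul_le_mul_of_nonneg_right (min_le_left _ _) hε.le
    refine h3.trans ?_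
    rw [div_mul_eq_mul_div, div_le_iff₀ (by positivity)]
    linarith
  · intro ξ hξ lam
    have hJE : (J i x).comp (E i p) = ContinuousLinearMap.id ℝ _ := by
      have : Function.LeftInverse (E i p) (J i x) := fun y => by
        have := congrArg (fun A : Pt n →L[ℝ] Pt n => A y) hEJ
        simpa using this
      have h2 : (E i p : Pt n →ₗ[ℝ] Pt n) * (J i x : Pt n →ₗ[ℝ] Pt n) = 1 := by
        ext1 y; exact this y
      have h3 := mul_eq_one_comm.1 h2
      ext1 y
      have := congrArg (fun A : Pt n →ₗ[ℝ] Pt n => A y) h3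
      simpa using this
    set Ξ := ξ.comp (J i x) with hΞ
    have hΞE : Ξ.comp (E i p) = ξ := by
      rw [hΞ, ContinuousLinearMap.comp_assoc, hJE, ContinuousLinearMap.comp_id]
    have hX : c1 * ε * ‖Ξ‖ ≤ ‖Ξ - lam • (g i x - g k x)‖ := by
      rcases le_or_gt lam 0 with h0 | h0
      · have := hc ψ ε i hε (hG i) x hx hli (g i x - g k x) Ξ (signG H hki hx hli hke) (by
          intro q hq
          rw [hpj]
          have := hξ q hq.1
          rw [← hΞE] at this
          exact this) (-lam) (by linarith)
        have e1 : Ξ + (-lam) • (g i x - g k x) = Ξ - lam • (g i x - g k x) := by module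
        rwa [e1] at this
      · have hd : HasFDerivWithinAt (fun q => ξ (j i (e k q))) (Ξ.comp (E k (j k x))) (Xi k) (j k x) := by
          have hjx := H.jmap k x hx
          have h1 := H.hE k _ hjx
          have h2 := H.hJ i x hx
          rw [← H.ej k x hx] at h2
          have h3 := h2.comp (j k x) h1 (fun q hq => H.emap k q hq)
          have h4 := ξ.hasFDerivAt.comp_hasFDerivWithinAt (j k x) h3
          rw [H.ej k x hx] at h4
          exact h4
        have hs := signMax (Q := Xi k) Subset.rfl (H.reg k).conv (H.jmap k x hx) hd (by
          intro q hq
          have := hξ (j i (e k q)) (H.jmap i _ (H.emap k q hq))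
          rw [map_sub] at this
          simp only [H.ej k x hx, hpj]
          linarith)
        have := hc ψ ε k hε (hG k) x hx hlk (g k x - g i x) Ξ (signG H hki.symm hx hlk hke.symm) (by
          intro q hq
          exact hs q hq.1) lam h0.le
        have e1 : Ξ + lam • (g k x - g i x) = Ξ - lam • (g i x - g k x) := by module
        rwa [e1] at this
    have h1 : ‖ξ‖ ≤ ‖Ξ‖ * B := by
      rw [← hΞE]
      exact (ContinuousLinearMap.opNorm_comp_le _ _).trans
        (mul_le_mul_of_nonneg_left (H.bE i p hp.1) (norm_nonneg _))
    have h2 := hcompB (ξ - lam • (g i x - g k x).comp (E i p))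
    have e2 : (ξ - lam • (g i x - g k x).comp (E i p)).comp (J i x) = Ξ - lam • (g i x - g k x) := by
      rw [ContinuousLinearMap.sub_comp, ContinuousLinearMap.smul_comp, hback]
    rw [e2] at h2
    have h3 : min (c2 / B) (c1 / B^2) * ε * ‖ξ‖ ≤ c1 / B^2 * ε * ‖ξ‖ := by
      gcongr; exact min_le_right _ _
    refine h3.trans ?_
    rw [div_mul_eq_mul_div, div_mul_eq_mul_div, div_le_iff₀ (by positivity)]
    have h4 : c1 * ε * ‖ξ‖ ≤ (c1 * ε * ‖Ξ‖) * B := by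
      have := mul_le_mul_of_nonneg_left h1 (by positivity : 0 ≤ c1 * ε)
      linarith
    have h5 : (c1 * ε * ‖Ξ‖) * B ≤ (B * ‖ξ - lam • (g i x - g k x).comp (E i p)‖) * B :=
      mul_le_mul_of_nonneg_right (hX.trans h2) (by linarith)
    linarith
end Tr
end

section
lemma lipC1 {n : ℕ} {W : Type*} [NormedAddCommGroup W] [NormedSpace ℝ W] {P : Set (Pt n)}
    (hP : IsCompact P) (hc : Convex ℝ P) (hu : UniqueDiffOn ℝ P) {h : Pt n → W}
    (hh : ContDiffOn ℝ 1 h P) : ∃ K : ℝ, 0 ≤ K ∧ ∀ p ∈ P, ∀ q ∈ P, ‖h q - h p‖ ≤ K * ‖q - p‖ := by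
  obtain ⟨K, hK⟩ := hP.exists_bound_of_continuousOn (hh.continuousOn_fderivWithin hu le_rfl)
  refine ⟨max K 0, le_max_right _ _, fun p hp q hq => ?_⟩
  exact hc.norm_image_sub_le_of_norm_hasFDerivWithin_le (𝕜 := ℝ) (f' := fderivWithin ℝ h P)
    (fun x hx => (hh.differentiableOn one_ne_zero x hx).hasFDerivWithinAt)
    (fun x hx => (hK x hx).trans (le_max_left _ _)) hp hq

lemma detC {n : ℕ} : ContDiff ℝ 1 (fun A : Pt n →L[ℝ] Pt n => A.det) := by
  set b := (EuclideanSpace.basisFun (Fin n) ℝ).toBasis with hb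
  have : (fun A : Pt n →L[ℝ] Pt n => A.det) = fun A =>
      ∑ s : Equiv.Perm (Fin n), Equiv.Perm.sign s • ∏ i, (A (b i)) (s i) := by
    ext A
    rw [ContinuousLinearMap.det, ← LinearMap.det_toMatrix b, Matrix.det_apply]
    refine Finset.sum_congr rfl fun s _ => ?_
    congr 1
    refine Finset.prod_congr rfl fun i _ => ?_
    rw [LinearMap.toMatrix_apply]
    simp [hb]
  rw [this]
  refine ContDiff.sum fun s _ => ?_
  have h2 : ContDiff ℝ 1 (fun A : Pt n →L[ℝ] Pt n => ∏ i, (A (b i)) (s i)) := by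
    refine contDiff_prod fun i _ => ?_
    have h3 : ContDiff ℝ 1 (fun A : Pt n →L[ℝ] Pt n => A (b i)) := by fun_prop
    exact (EuclideanSpace.proj (𝕜 := ℝ) (s i)).contDiff.comp h3
  rcases Int.units_eq_one_or (Equiv.Perm.sign s) with h | h <;> rw [h]
  · simpa using h2
  · simpa using h2.neg

lemma regOf {n N : ℕ} {P : Set (Pt n)} (hP : IsCompact P) (hc : Convex ℝ P)
    (hi : (interior P).Nonempty) {f : Fin N → Pt n → ℝ} (hf : ∀ k, ContDiffOn ℝ 2 (f k) P)
    {Df : Fin N → Pt n → (Pt n →L[ℝ] ℝ)}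
    (hD : ∀ k, ∀ p ∈ P, HasFDerivWithinAt (f k) (Df k p) P p) :
    ∃ M, RegData P f Df M := by
  have hu : UniqueDiffOn ℝ P := uniqueDiffOn_convex hc hi
  have hex : ∀ k, ∃ M : ℝ, 0 ≤ M ∧ (∀ p ∈ P, ∀ q ∈ P, ‖Df k q - Df k p‖ ≤ M * ‖q - p‖) ∧
      ∀ p ∈ P, ‖Df k p‖ ≤ M := by
    intro k
    have he : ∀ p ∈ P, fderivWithin ℝ (f k) P p = Df k p := fun p hp =>
      (hD k p hp).fderivWithin (hu p hp)
    have h1 := (hf k).fderivWithin hu (m := 1) (by norm_num)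
    obtain ⟨K, hK, hKl⟩ := lipC1 hP hc hu h1
    obtain ⟨K', hK'⟩ := hP.exists_bound_of_continuousOn h1.continuousOn
    refine ⟨max K K', le_trans hK (le_max_left _ _), ?_, ?_⟩
    · intro p hp q hq
      rw [← he p hp, ← he q hq]
      exact (hKl p hp q hq).trans (mul_le_mul_of_nonneg_right (le_max_left _ _) (norm_nonneg _))
    · intro p hp
      rw [← he p hp]
      exact (hK' p hp).trans (le_max_right _ _)
  choose M hM0 hM1 hM2 using hex
  have hle : ∀ k, M k ≤ 1 + ∑ k, M k := fun k => by
    have := Finset.single_le_sum (f := M) (fun b _ => hM0 b) (Finset.mem_univ k)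
    linarith
  have h1 : (1:ℝ) ≤ 1 + ∑ k, M k := by
    have := Finset.sum_nonneg (s := Finset.univ) (f := M) (fun b _ => hM0 b)
    linarith
  refine ⟨1 + ∑ k, M k, hP, hc, hi, h1, ?_, ?_, ?_, ?_, hD⟩
  · intro k p hp q hq
    have hs : segment ℝ p q ⊆ P := hc.segment_subset hp hq
    have := (convex_segment p q).norm_image_sub_le_of_norm_hasFDerivWithin_le' (𝕜 := ℝ)
      (f := f k) (f' := Df k) (φ := Df k p) (C := M k * ‖q - p‖) (x := p) (y := q)
      (fun x hx => (hD k x (hs hx)).mono hs) (fun x hx => by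
        refine (hM1 k p hp x (hs hx)).trans (mul_le_mul_of_nonneg_left ?_ (hM0 k))
        exact norm_sub_le_of_mem_segment hx) (left_mem_segment _ _ _) (right_mem_segment _ _ _)
    rw [Real.norm_eq_abs] at this
    refine this.trans ?_
    have := hle k
    have h3 := mul_le_mul_of_nonneg_right this (sq_nonneg ‖q - p‖)
    nlinarith
  · intro k p hp q hq
    have := hc.norm_image_sub_le_of_norm_hasFDerivWithin_le (𝕜 := ℝ) (hD k) (hM2 k) hp hq
    rw [Real.norm_eq_abs] at this
    exact this.trans (mul_le_mul_of_nonneg_right (hle k) (norm_nonneg _))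
  · intro k p hp q hq
    exact (hM1 k p hp q hq).trans (mul_le_mul_of_nonneg_right (hle k) (norm_nonneg _))
  · intro k p hp
    exact (hM2 k p hp).trans (hle k)

lemma RegData.mono {n N : ℕ} {P : Set (Pt n)} {f : Fin N → Pt n → ℝ}
    {Df : Fin N → Pt n → (Pt n →L[ℝ] ℝ)} {M M' : ℝ} (h : RegData P f Df M) (hM : M ≤ M') :
    RegData P f Df M' := by
  refine ⟨h.comp, h.conv, h.inter, h.Mone.trans hM, ?_, ?_, ?_, ?_, h.hasD⟩
  · intro k p hp q hq
    exact (h.taylor k p hp q hq).trans (mul_le_mul_of_nonneg_right hM (by positivity))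
  · intro k p hp q hq
    exact (h.lip k p hp q hq).trans (mul_le_mul_of_nonneg_right hM (by positivity))
  · intro k p hp q hq
    exact (h.lipD k p hp q hq).trans (mul_le_mul_of_nonneg_right hM (by positivity))
  · intro k p hp
    exact (h.bddD k p hp).trans hM

lemma finBound {N : ℕ} {Q : Fin N → ℝ → Prop} (mono : ∀ i b b', b ≤ b' → Q i b → Q i b')
    (h : ∀ i, ∃ b, Q i b) : ∃ b, 1 ≤ b ∧ ∀ i, Q i b := by
  choose b hb using h
  have h0 : 0 ≤ ∑ i, |b i| := Finset.sum_nonneg fun i _ => abs_nonneg _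
  refine ⟨1 + ∑ i, |b i|, by linarith, fun i => mono i _ _ ?_ (hb i)⟩
  have := Finset.single_le_sum (f := fun i => |b i|) (fun b _ => abs_nonneg _) (Finset.mem_univ i)
  have := le_abs_self (b i)
  linarith
end

section
lemma lagEq {n N : ℕ} {X : Set (Pt n)} {c : Pt n → Fin N → ℝ} {ψ : Fin N → ℝ} {i : Fin N} {x : Pt n} :
    x ∈ LagCell X c ψ i ↔ x ∈ X ∧ ∀ k, -c x k - ψ k ≤ -c x i - ψ i := by
  have hb : BddAbove (range fun j => -c x j - ψ j) := (finite_range _).bddAbove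
  have : Nonempty (Fin N) := ⟨i⟩
  constructor
  · rintro ⟨hx, h⟩
    exact ⟨hx, fun k => by rw [h]; exact le_ciSup hb k⟩
  · rintro ⟨hx, h⟩
    exact ⟨hx, le_antisymm (le_ciSup hb i) (ciSup_le h)⟩

lemma chartsExist {n N : ℕ} (hN : 1 ≤ N)
    (X : Set (Pt n)) (hX : IsCompact X)
    (c : Pt n → Fin N → ℝ) (hreg : RegCond X c) (htw : TwistCond X c)
    (μ : Measure (Pt n)) (hprob : IsProbabilityMeasure μ)
    (hac : μ ≪ volume) (hsupp : μ Xᶜ = 0)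
    (hqc : LoeperCond X c)
    (α : ℝ) (hα : 0 < α) (hα1 : α ≤ 1)
    (hdens : HolderDensity X μ α) : ∃ Xi e j E J g σ B m0 M R,
      Charts X c μ α Xi e j E J g σ B m0 M R := by
  obtain ⟨Xi, e, j, H⟩ := hqc
  obtain ⟨ρ, hμ, hρc, Cρ, hρ⟩ := hdens
  have hconv := fun i => (H i).1
  have heC := fun i => (H i).2.1
  have hjC := fun i => (H i).2.2.1
  have hbij := fun i => (H i).2.2.2.1
  have hinv := fun i => (H i).2.2.2.2.1
  have hqc := fun i => (H i).2.2.2.2.2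
  have je : ∀ i, ∀ p ∈ Xi i, j i (e i p) = p := fun i p hp => (hinv i).1 hp
  have ej : ∀ i, ∀ x ∈ X, e i (j i x) = x := fun i p hp => (hinv i).2 hp
  have emap : ∀ i, ∀ p ∈ Xi i, e i p ∈ X := fun i p hp => (hbij i).mapsTo hp
  have himg : ∀ i, e i '' Xi i = X := fun i => (hbij i).image_eq
  have jmap : ∀ i, ∀ x ∈ X, j i x ∈ Xi i := by
    intro i x hx
    rw [← himg i] at hx
    obtain ⟨p, hp, rfl⟩ := hx
    rw [je i p hp]; exact hp
  have hjimg : ∀ i, j i '' X = Xi i := by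
    intro i
    apply Subset.antisymm
    · rintro _ ⟨x, hx, rfl⟩; exact jmap i x hx
    · intro p hp; exact ⟨e i p, emap i p hp, je i p hp⟩
  have hcomp : ∀ i, IsCompact (Xi i) := fun i => by
    rw [← hjimg i]; exact hX.image_of_continuousOn (hjC i).continuousOn
  have hμX : μ X ≠ 0 := by
    intro h0
    have : μ univ ≤ μ X + μ Xᶜ := by rw [← union_compl_self X]; exact measure_union_le _ _
    rw [h0, hsupp, measure_univ] at this
    simp at this
  have hint : ∀ i, (interior (Xi i)).Nonempty := by
    intro i
    by_contra hne
    rw [not_nonempty_iff_eq_empty] at hne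
    have h0 : volume (Xi i) = 0 := by
      have := (hconv i).addHaar_frontier (volume : Measure (Pt n))
      rwa [frontier, (hcomp i).isClosed.closure_eq, hne, diff_empty] at this
    have h1 := addHaar_image_eq_zero_of_differentiableOn_of_addHaar_eq_zero volume
      ((heC i).differentiableOn two_ne_zero) h0
    rw [himg i] at h1
    exact hμX (hac h1)
  have hud : ∀ i, UniqueDiffOn ℝ (Xi i) := fun i => uniqueDiffOn_convex (hconv i) (hint i)
  set E := fun i p => fderivWithin ℝ (e i) (Xi i) p with hEdef
  set J := fun i x => fderivWithin ℝ (j i) X x with hJdef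
  set g := fun k x => fderivWithin ℝ (fun y => c y k) X x with hgdef
  have hE : ∀ i, ∀ p ∈ Xi i, HasFDerivWithinAt (e i) (E i p) (Xi i) p := fun i p hp =>
    ((heC i).differentiableOn two_ne_zero p hp).hasFDerivWithinAt
  have hJ : ∀ i, ∀ x ∈ X, HasFDerivWithinAt (j i) (J i x) X x := fun i p hp =>
    ((hjC i).differentiableOn two_ne_zero p hp).hasFDerivWithinAt
  have hg : ∀ k, ∀ x ∈ X, HasFDerivWithinAt (fun y => c y k) (g k x) X x := fun i p hp =>
    ((hreg i).differentiableOn two_ne_zero p hp).hasFDerivWithinAt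
  have JE : ∀ i, ∀ p ∈ Xi i, (J i (e i p)).comp (E i p) = ContinuousLinearMap.id ℝ _ := by
    intro i p hp
    have h1 := (hJ i _ (emap i p hp)).comp p (hE i p hp) (fun q hq => emap i q hq)
    have h2 : HasFDerivWithinAt (j i ∘ e i) (ContinuousLinearMap.id ℝ (Pt n)) (Xi i) p :=
      (hasFDerivWithinAt_id p (Xi i)).congr (fun q hq => je i q hq) (je i p hp)
    exact (hud i p hp).eq h1 h2
  have EJ : ∀ i, ∀ p ∈ Xi i, (E i p).comp (J i (e i p)) = ContinuousLinearMap.id ℝ _ := by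
    intro i p hp
    have h2 : (J i (e i p) : Pt n →ₗ[ℝ] Pt n) * (E i p : Pt n →ₗ[ℝ] Pt n) = 1 := by
      ext1 y
      have := congrArg (fun A : Pt n →L[ℝ] Pt n => A y) (JE i p hp)
      exact this
    have h3 := mul_eq_one_comm.1 h2
    ext1 y
    have := congrArg (fun A : Pt n →ₗ[ℝ] Pt n => A y) h3
    simpa using this
  have hudX : UniqueDiffOn ℝ X := by
    intro x hx
    have i : Fin N := ⟨0, hN⟩
    have hp := jmap i x hx
    have := (hE i _ hp).uniqueDiffWithinAt (hud i _ hp) (by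
      apply Function.Surjective.denseRange
      intro y
      refine ⟨J i (e i (j i x)) y, ?_⟩
      have := congrArg (fun A : Pt n →L[ℝ] Pt n => A y) (EJ i _ hp)
      exact this)
    rwa [himg i, ej i x hx] at this
  have hEC : ∀ i, ContDiffOn ℝ 1 (E i) (Xi i) := fun i =>
    (heC i).fderivWithin (hud i) (by norm_num)
  obtain ⟨B1, hB1, hbE⟩ := finBound (N := N) (Q := fun i b => ∀ p ∈ Xi i, ‖E i p‖ ≤ b)
    (fun i b b' hb h p hp => (h p hp).trans hb)
    (fun i => (hcomp i).exists_bound_of_continuousOn (hEC i).continuousOn)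
  obtain ⟨B2, hB2, hbJ⟩ := finBound (N := N) (Q := fun i b => ∀ x ∈ X, ‖J i x‖ ≤ b)
    (fun i b b' hb h p hp => (h p hp).trans hb)
    (fun i => hX.exists_bound_of_continuousOn ((hjC i).continuousOn_fderivWithin hudX (by norm_num)))
  obtain ⟨R, hR1, hR⟩ := finBound (N := N) (Q := fun i b => ∀ x ∈ Xi i, ‖x‖ ≤ b)
    (fun i b b' hb h p hp => (h p hp).trans hb)
    (fun i => (hcomp i).exists_bound_of_continuousOn continuousOn_id)
  set σ := fun i p => |(E i p).det| * max (ρ (e i p)) 0 with hσdef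
  have hb : ∀ i, HB (Xi i) α (σ i) := by
    intro i
    refine HB.mul ?_ ?_
    · obtain ⟨K, hK, hl⟩ := lipC1 (hcomp i) (hconv i) (hud i) (detC.comp_contDiffOn (hEC i))
      refine HB.ofLip hα hα1 (hcomp i) K hK ?_
      intro p hp q hq
      have := hl q hq p hp
      exact (abs_abs_sub_abs_le_abs_sub _ _).trans this
    · have hcon : ContinuousOn (fun p => max (ρ (e i p)) 0) (Xi i) := by
        have : ContinuousOn (fun p => ρ (e i p)) (Xi i) :=
          hρc.comp (heC i).continuousOn (fun p hp => emap i p hp)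
        exact this.sup continuousOn_const
      obtain ⟨B0, hB0⟩ := (hcomp i).exists_bound_of_continuousOn hcon
      obtain ⟨K, hK, hl⟩ := lipC1 (hcomp i) (hconv i) (hud i) ((heC i).of_le (by norm_num))
      refine ⟨hcon, max |B0| (|Cρ| * K ^ α), le_trans (abs_nonneg _) (le_max_left _ _), ?_, ?_⟩
      · intro p hp
        exact (hB0 p hp).trans ((le_abs_self _).trans (le_max_left _ _))
      · intro p hp q hq
        have h1 : |max (ρ (e i p)) 0 - max (ρ (e i q)) 0| ≤ |ρ (e i p) - ρ (e i q)| :=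
          abs_max_sub_max_le_abs _ _ _
        have h2 := hρ _ (emap i p hp) _ (emap i q hq)
        have h3 : ‖e i p - e i q‖ ^ α ≤ (K * ‖p - q‖) ^ α :=
          Real.rpow_le_rpow (norm_nonneg _) (hl q hq p hp) hα.le
        rw [Real.mul_rpow hK (norm_nonneg _)] at h3
        calc _ ≤ Cρ * ‖e i p - e i q‖ ^ α := h1.trans h2
          _ ≤ |Cρ| * ‖e i p - e i q‖ ^ α := by
            gcongr; exact le_abs_self _
          _ ≤ |Cρ| * (K ^ α * ‖p - q‖ ^ α) := by gcongr
          _ = (|Cρ| * K ^ α) * ‖p - q‖ ^ α := by ring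
          _ ≤ _ := by gcongr; exact le_max_right _ _
  obtain ⟨B3, hB3, hbσ⟩ := finBound (N := N) (Q := fun i b => ∀ p ∈ Xi i, |σ i p| ≤ b)
    (fun i b b' hb h p hp => (h p hp).trans hb)
    (fun i => by obtain ⟨_, B, _, h, _⟩ := hb i; exact ⟨B, h⟩)
  have hffC : ∀ i k, ContDiffOn ℝ 2 (ff c e i k) (Xi i) := by
    intro i k
    exact ((hreg k).comp (heC i) (fun p hp => emap i p hp)).neg.add
      ((hreg i).comp (heC i) (fun p hp => emap i p hp))
  have hffD : ∀ i k, ∀ p ∈ Xi i, HasFDerivWithinAt (ff c e i k)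
      ((g i (e i p) - g k (e i p)).comp (E i p)) (Xi i) p := by
    intro i k p hp
    have h1 := (hg k _ (emap i p hp)).comp p (hE i p hp) (fun q hq => emap i q hq)
    have h2 := (hg i _ (emap i p hp)).comp p (hE i p hp) (fun q hq => emap i q hq)
    have h3 := h1.neg.add h2
    have e1 : (g i (e i p) - g k (e i p)).comp (E i p)
        = -(g k (e i p)).comp (E i p) + (g i (e i p)).comp (E i p) := by
      rw [ContinuousLinearMap.sub_comp]; abel
    rw [e1]
    exact h3
  obtain ⟨M, hM1, hM⟩ := finBound (N := N)
    (Q := fun i b => RegData (Xi i) (ff c e i) (fun k p => (g i (e i p) - g k (e i p)).comp (E i p)) b)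
    (fun i b b' hb h => h.mono hb)
    (fun i => regOf (hcomp i) (hconv i) (hint i) (hffC i) (hffD i))
  have hXne : X.Nonempty := by
    rw [nonempty_iff_ne_empty]; rintro rfl; simp at hμX
  have htw' : ∃ m0 > 0, ∀ x ∈ X, ∀ i k, i ≠ k → m0 ≤ ‖g i x - g k x‖ := by
    have h1 : ∀ z : Fin N × Fin N, ∃ m > 0, ∀ x ∈ X, z.1 ≠ z.2 → m ≤ ‖g z.1 x - g z.2 x‖ := by
      rintro ⟨i, k⟩
      have hcont : ContinuousOn (fun x => ‖g i x - g k x‖) X :=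
        (((hreg i).continuousOn_fderivWithin hudX (by norm_num)).sub
          ((hreg k).continuousOn_fderivWithin hudX (by norm_num))).norm
      obtain ⟨x0, hx0, hmin⟩ := hX.exists_isMinOn hXne hcont
      by_cases hik : i = k
      · exact ⟨1, one_pos, fun x _ h => absurd hik h⟩
      · refine ⟨_, norm_pos_iff.2 (sub_ne_zero.2 (htw x0 hx0 i k hik)), fun x hx _ => hmin hx⟩
    choose m hm hm' using h1
    have : Nonempty (Fin N × Fin N) := ⟨⟨⟨0, hN⟩, ⟨0, hN⟩⟩⟩
    obtain ⟨z0, hz0⟩ := Finite.exists_min m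
    exact ⟨m z0, hm z0, fun x hx i k hik => (hz0 (i, k)).trans (hm' (i, k) x hx hik)⟩
  obtain ⟨m0, hm0, htw2⟩ := htw'
  refine ⟨Xi, e, j, E, J, g, σ, max B1 (max B2 B3), m0, M, R, emap, jmap, je, ej, hE, hJ, EJ, ?_, ?_,
    ?_, hm0, htw2, ?_, ?_, ?_, hb, ?_, ?_, hM⟩
  · exact hB1.trans (le_max_left _ _)
  · intro i p hp; exact (hbE i p hp).trans (le_max_left _ _)
  · intro i p hp; exact (hbJ i p hp).trans ((le_max_left _ _).trans (le_max_right _ _))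
  · intro i k t; exact hqc i t k
  · linarith
  · intro i p hp; simpa using hR i p hp
  · intro i p hp; exact (hbσ i p hp).trans ((le_max_right _ _).trans (le_max_right _ _))
  · intro ψ i
    set S := cellSet i (Xi i) (ff c e i) (fun k => ψ k - ψ i) with hS
    have hSc : IsCompact S := cellCompact (hM i) _
    have hSX : S ⊆ Xi i := fun p hp => hp.1
    have hL : LagCell X c ψ i = e i '' S := by
      ext x
      rw [lagEq]
      constructor
      · rintro ⟨hx, h⟩
        refine ⟨j i x, ⟨jmap i x hx, fun k _ => ?_⟩, ej i x hx⟩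
        have := h k
        simp only [ff, ej i x hx]; linarith
      · rintro ⟨p, hp, rfl⟩
        refine ⟨emap i p hp.1, fun k => ?_⟩
        by_cases hk : k = i
        · rw [hk]
        · have := hp.2 k hk
          simp only [ff] at this; linarith
    have hmeas : MeasurableSet (e i '' S) :=
      (hSc.image_of_continuousOn ((heC i).continuousOn.mono hSX)).measurableSet
    rw [Gfun, hL, hμ, withDensity_apply _ hmeas, lintegral_image_eq_lintegral_abs_det_fderiv_mul volume
      hSc.measurableSet (fun p hp => (hE i p (hSX hp)).mono hSX) ((hbij i).injOn.mono hSX),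
      integral_eq_lintegral_of_nonneg_ae]
    · congr 1
      refine lintegral_congr fun p => ?_
      rw [← ENNReal.ofReal_mul (abs_nonneg _)]
      simp only [hσdef]
      rcases le_total 0 (ρ (e i p)) with h | h
      · rw [max_eq_left h]
      · rw [max_eq_right h, mul_zero, ENNReal.ofReal_zero, ENNReal.ofReal_eq_zero]
        exact mul_nonpos_of_nonneg_of_nonpos (abs_nonneg _) h
    · exact Eventually.of_forall fun p => mul_nonneg (abs_nonneg _) (le_max_right _ _)
    · exact ((hb i).1.mono hSX).aestronglyMeasurable hSc.measurableSet
end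

section
lemma tele {N : ℕ} (H : (Fin N → ℝ) → ℝ) (t t' : Fin N → ℝ) (L : Fin N → ℝ) (ω : ℝ)
    (h : ∀ k (u : Fin N → ℝ), (∀ l, u l ∈ uIcc (t l) (t' l)) →
      |H (Function.update u k (t' k)) - H (Function.update u k (t k)) - L k * (t' k - t k)|
        ≤ ω * ‖t' - t‖) :
    |H t' - H t - ∑ k, L k * (t' k - t k)| ≤ N * ω * ‖t' - t‖ := by
  have main : ∀ s : Finset (Fin N), |H (s.piecewise t' t) - H t - ∑ k ∈ s, L k * (t' k - t k)|
      ≤ s.card * ω * ‖t' - t‖ := by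
    intro s
    induction s using Finset.induction_on with
    | empty => simp
    | insert k s hk ih =>
      have h1 := h k (s.piecewise t' t) (fun l => by
        by_cases hl : l ∈ s
        · rw [Finset.piecewise_eq_of_mem _ _ _ hl]; exact right_mem_uIcc
        · rw [Finset.piecewise_eq_of_notMem _ _ _ hl]; exact left_mem_uIcc)
      rw [← Finset.piecewise_insert] at h1
      have h2 : Function.update (s.piecewise t' t) k (t k) = s.piecewise t' t := by
        rw [Function.update_eq_self_iff, Finset.piecewise_eq_of_notMem _ _ _ hk]
      rw [h2] at h1
      rw [Finset.sum_insert hk, Finset.card_insert_of_notMem hk]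
      push_cast
      have := abs_add_le (H ((insert k s).piecewise t' t) - H (s.piecewise t' t) - L k * (t' k - t k))
        (H (s.piecewise t' t) - H t - ∑ k ∈ s, L k * (t' k - t k))
      have e1 : H ((insert k s).piecewise t' t) - H t - (L k * (t' k - t k) + ∑ k ∈ s, L k * (t' k - t k))
        = (H ((insert k s).piecewise t' t) - H (s.piecewise t' t) - L k * (t' k - t k)) +
        (H (s.piecewise t' t) - H t - ∑ k ∈ s, L k * (t' k - t k)) := by ring
      rw [e1]
      linarith
  have := main Finset.univ
  simpa using this

section Inc
variable {n N : ℕ} {i k : Fin N} {P : Set (Pt n)} {f : Fin N → Pt n → ℝ}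
    {Df : Fin N → Pt n → (Pt n →L[ℝ] ℝ)} {φ : Pt n → ℝ} {α : ℝ} {F : (Fin N → ℝ) → ℝ} {C K : ℝ}

lemma FData.inc (hF : FData i k P f Df φ α F C K) (u : Fin N → ℝ) (a b l ω : ℝ)
    (h : ∀ r ∈ uIcc a b, |F (Function.update u k r) - l| ≤ ω) :
    |(∫ p in cellSet i P f (Function.update u k b), φ p) -
      (∫ p in cellSet i P f (Function.update u k a), φ p) - l * (b - a)| ≤ ω * |b - a| := by
  have hftc : (∫ p in cellSet i P f (Function.update u k b), φ p) -
      (∫ p in cellSet i P f (Function.update u k a), φ p) = ∫ r in a..b, F (Function.update u k r) := by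
    rcases le_total a b with hab | hab
    · exact hF.ftc u a b hab
    · rw [intervalIntegral.integral_symm, ← hF.ftc u b a hab]; ring
  have h2 : |(∫ p in cellSet i P f (Function.update u k b), φ p) -
      (∫ p in cellSet i P f (Function.update u k a), φ p) - l * (b - a)| ≤ ω * |b - a| := by
    have e1 : (∫ r in a..b, F (Function.update u k r)) - l * (b - a)
        = ∫ r in a..b, (F (Function.update u k r) - l) := by
      rw [intervalIntegral.integral_sub (hF.ii u a b) (by simp)]
      simp [mul_comm]
    rw [hftc, e1]
    exact intervalIntegral.norm_integral_le_of_norm_le_const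
      (f := fun r => F (Function.update u k r) - l)
      (fun r hr => h r (uIoc_subset_uIcc hr))
  exact h2

lemma FData.mono (hF : FData i k P f Df φ α F C K) {C' K' : ℝ} (hC : C ≤ C') (hK : K ≤ K') :
    FData i k P f Df φ α F C' K' := by
  refine ⟨hF.C0.trans hC, hF.K1.trans hK, fun t => (hF.bdd t).trans hC, hF.ii, hF.ftc, ?_⟩
  intro t t' τ δ η hτ htt hKτ hδ hη hη1 h1 h2
  refine (hF.hol t t' τ δ η hτ htt (le_trans ?_ hKτ) hδ hη hη1 h1 h2).trans ?_
  · exact mul_le_mul_of_nonneg_right hK hτ.le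
  · gcongr

lemma cellSet_congr {t t' : Fin N → ℝ} (h : ∀ k, k ≠ i → t k = t' k) :
    cellSet i P f t = cellSet i P f t' := by
  ext p
  simp only [cellSet, mem_ofPred_eq]
  refine and_congr Iff.rfl (forall_congr' fun k => forall_congr' fun hk => ?_)
  rw [h k hk]
end Inc

section Asm
variable {n N : ℕ} {X : Set (Pt n)} {c : Pt n → Fin N → ℝ} {μ : Measure (Pt n)} {α : ℝ}
    {Xi : Fin N → Set (Pt n)} {e j : Fin N → Pt n → Pt n}
    {E J : Fin N → Pt n → (Pt n →L[ℝ] Pt n)} {g : Fin N → Pt n → (Pt n →L[ℝ] ℝ)}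
    {σ : Fin N → Pt n → ℝ} {B m0 M R : ℝ}

lemma allF (hn : 2 ≤ n) (hα : 0 < α) (hα1 : α ≤ 1) (H : Charts X c μ α Xi e j E J g σ B m0 M R) :
    ∃ (F : Fin N → Fin N → (Fin N → ℝ) → ℝ) (C K : ℝ), 1 ≤ C ∧ 1 ≤ K ∧ ∀ i k, k ≠ i →
      FData i k (Xi i) (ff c e i) (fun k p => (g i (e i p) - g k (e i p)).comp (E i p)) (σ i) α
        (F i k) C K := by
  have h1 : ∀ i k, ∃ (F : (Fin N → ℝ) → ℝ) (C : ℝ), k ≠ i →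
      FData i k (Xi i) (ff c e i) (fun k p => (g i (e i p) - g k (e i p)).comp (E i p)) (σ i) α
        F C C := by
    intro i k
    by_cases hki : k = i
    · exact ⟨0, 0, fun h => absurd hki h⟩
    have hB := H.B1
    have hm := H.m0pos
    obtain ⟨F, C, K, hF⟩ := globalF hn hki (H.reg i) (m0 / B) (by positivity) (by
      intro p hp
      have hx := H.emap i p hp
      have h1 := H.tw _ hx i k (Ne.symm hki)
      have h2 : g i (e i p) - g k (e i p)
          = ((g i (e i p) - g k (e i p)).comp (E i p)).comp (J i (e i p)) := by
        rw [ContinuousLinearMap.comp_assoc, H.EJ i p hp, ContinuousLinearMap.comp_id]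
      have h3 := ContinuousLinearMap.opNorm_comp_le ((g i (e i p) - g k (e i p)).comp (E i p)) (J i (e i p))
      rw [← h2] at h3
      rw [div_le_iff₀ (by positivity)]
      exact (h1.trans h3).trans (mul_le_mul_of_nonneg_left (H.bJ i _ hx) (norm_nonneg _)))
      α hα hα1 (σ i) (H.hb i)
    exact ⟨F, max C K, fun _ => hF.mono (le_max_left _ _) (le_max_right _ _)⟩
  choose F C hF using h1
  have h0 : 0 ≤ ∑ i, ∑ k, |C i k| :=
    Finset.sum_nonneg fun i _ => Finset.sum_nonneg fun k _ => abs_nonneg _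
  have hle : ∀ i k, C i k ≤ 1 + ∑ i, ∑ k, |C i k| := by
    intro i k
    have h1 := Finset.single_le_sum (f := fun k => |C i k|) (fun b _ => abs_nonneg _) (Finset.mem_univ k)
    have h2 := Finset.single_le_sum (f := fun i => ∑ k, |C i k|)
      (fun b _ => Finset.sum_nonneg fun k _ => abs_nonneg _) (Finset.mem_univ i)
    have h3 := le_abs_self (C i k)
    linarith
  exact ⟨F, _, _, by linarith, by linarith, fun i k hki => (hF i k hki).mono (hle i k) (hle i k)⟩

def shf {N : ℕ} (i : Fin N) (ψ : Fin N → ℝ) : Fin N → ℝ := fun k => ψ k - ψ i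

lemma shf_sub (i : Fin N) (ψ ψ' : Fin N → ℝ) : ‖shf i ψ - shf i ψ'‖ ≤ 2 * ‖ψ - ψ'‖ := by
  rw [pi_norm_le_iff_of_nonneg (by positivity)]
  intro k
  have h1 := norm_le_pi_norm (ψ - ψ') k
  have h2 := norm_le_pi_norm (ψ - ψ') i
  simp only [Pi.sub_apply, shf, Real.norm_eq_abs] at *
  rw [abs_le] at *
  constructor <;> linarith [h1.1, h1.2, h2.1, h2.2]

lemma G_shf (H : Charts X c μ α Xi e j E J g σ B m0 M R) (i v : Fin N) (ψ : Fin N → ℝ) :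
    Gfun X c μ (shf i ψ) v = Gfun X c μ ψ v := by
  rw [H.Gint, H.Gint]
  congr 2
  simp only [shf, sub_sub_sub_cancel_right]

lemma G_lip (H : Charts X c μ α Xi e j E J g σ B m0 M R)
    {F : Fin N → Fin N → (Fin N → ℝ) → ℝ} {C K : ℝ}
    (hF : ∀ i k, k ≠ i →
      FData i k (Xi i) (ff c e i) (fun k p => (g i (e i p) - g k (e i p)).comp (E i p)) (σ i) α
        (F i k) C K) (hC : 1 ≤ C) (i : Fin N) (ψ ψ' : Fin N → ℝ) :
    |Gfun X c μ ψ' i - Gfun X c μ ψ i| ≤ 2 * N * C * ‖ψ' - ψ‖ := by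
  have h1 := tele (fun t => ∫ p in cellSet i (Xi i) (ff c e i) t, σ i p) (shf i ψ) (shf i ψ')
    (fun _ => 0) C (by
      intro k u _
      by_cases hki : k = i
      · rw [cellSet_congr (t := Function.update u k (shf i ψ' k)) (t' := Function.update u k (shf i ψ k))]
        · simp; positivity
        · intro l hl
          rw [Function.update_of_ne (hki ▸ hl), Function.update_of_ne (hki ▸ hl)]
      · have := ((hF i k hki).inc u (shf i ψ k) (shf i ψ' k) 0 C
          (fun r _ => by simpa using (hF i k hki).bdd _))
        refine this.trans (mul_le_mul_of_nonneg_left ?_ (by linarith))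
        exact norm_le_pi_norm (shf i ψ' - shf i ψ) k)
  simp only [zero_mul, Finset.sum_const_zero, sub_zero] at h1
  have e1 : ∀ ψ, Gfun X c μ ψ i = ∫ p in cellSet i (Xi i) (ff c e i) (shf i ψ), σ i p :=
    fun ψ => H.Gint ψ i
  rw [e1, e1]
  refine h1.trans ?_
  have := mul_le_mul_of_nonneg_left (shf_sub i ψ' ψ) (by positivity : 0 ≤ (N:ℝ) * C)
  linarith

lemma transK (H : Charts X c μ α Xi e j E J g σ B m0 M R)
    {F : Fin N → Fin N → (Fin N → ℝ) → ℝ} {C K : ℝ}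
    (hF : ∀ i k, k ≠ i →
      FData i k (Xi i) (ff c e i) (fun k p => (g i (e i p) - g k (e i p)).comp (E i p)) (σ i) α
        (F i k) C K) (hC : 1 ≤ C) : ∃ c1 c2 : ℝ, 0 < c1 ∧ c1 ≤ 1 ∧ 0 < c2 ∧ c2 ≤ 1 ∧
    ∀ ε ψ, 0 < ε → (∀ v, ε ≤ Gfun X c μ ψ v) → ∀ i k, k ≠ i →
    TransAt i k (Xi i) (ff c e i) (fun k p => (g i (e i p) - g k (e i p)).comp (E i p))
      (shf i ψ) (c2 * ε) (c1 * ε) := by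
  obtain ⟨c1, hc1, hc11, hc⟩ := transPt H
  refine ⟨c1 / 2, 1 / (4 * N * C + 1), by positivity, by linarith, by positivity, ?_, ?_⟩
  · rw [div_le_one (by positivity)]
    have : 0 ≤ 4 * N * C := by positivity
    linarith
  intro ε ψ hε hG i k hki t' ht' p hp hk
  set ψ' := Function.update t' i 0 with hψ'
  have hd : ‖ψ' - shf i ψ‖ ≤ 1 / (4 * N * C + 1) * ε := by
    rw [pi_norm_le_iff_of_nonneg (by positivity)]
    intro l
    by_cases hl : l = i
    · subst hl
      simp [hψ', shf]; positivity
    · refine le_trans ?_ ht'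
      have := norm_le_pi_norm (t' - shf i ψ) l
      simpa [hψ', Function.update_of_ne hl] using this
  have hG' : ∀ v, ε / 2 ≤ Gfun X c μ ψ' v := by
    intro v
    have h1 := G_lip H hF hC v (shf i ψ) ψ'
    rw [G_shf H] at h1
    have h2 := (abs_le.1 h1).1
    have h3 := hG v
    have h4 : 2 * N * C * ‖ψ' - shf i ψ‖ ≤ 2 * N * C * (1 / (4 * N * C + 1) * ε) :=
      mul_le_mul_of_nonneg_left hd (by positivity)
    have h5 : 2 * N * C * (1 / (4 * N * C + 1) * ε) ≤ ε / 2 := by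
      have : 0 ≤ (N:ℝ) * C := by positivity
      have e : 2 * N * C * (1 / (4 * N * C + 1) * ε) = (2 * N * C * ε) / (4 * N * C + 1) := by
        field_simp
      rw [e, div_le_iff₀ (by positivity)]
      nlinarith
    linarith
  have hne : ∀ l, l ≠ i → ψ' l - ψ' i = t' l := by
    intro l hl
    simp [hψ', Function.update_of_ne hl]
  have hp' : p ∈ cellSet i (Xi i) (ff c e i) (fun k => ψ' k - ψ' i) := by
    rwa [cellSet_congr (t' := t') (fun l hl => hne l hl)]
  obtain ⟨h1, h2⟩ := hc ψ' (ε/2) (by positivity) hG' i k hki p hp' (by rw [hk, hne k hki])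
  have e1 : c1 / 2 * ε = c1 * (ε / 2) := by ring
  rw [e1]
  exact ⟨fun l hl hlk hle => h1 l hl hlk (by rw [hle, hne l hl]), h2⟩
end Asm
end

section
section Asm2
variable {n N : ℕ} {X : Set (Pt n)} {c : Pt n → Fin N → ℝ} {μ : Measure (Pt n)} {α : ℝ}
    {Xi : Fin N → Set (Pt n)} {e j : Fin N → Pt n → Pt n}
    {E J : Fin N → Pt n → (Pt n →L[ℝ] Pt n)} {g : Fin N → Pt n → (Pt n →L[ℝ] ℝ)}
    {σ : Fin N → Pt n → ℝ} {B m0 M R : ℝ}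

lemma holderK (hα : 0 < α) (hα1 : α ≤ 1) (H : Charts X c μ α Xi e j E J g σ B m0 M R)
    {F : Fin N → Fin N → (Fin N → ℝ) → ℝ} {C K : ℝ}
    (hF : ∀ i k, k ≠ i →
      FData i k (Xi i) (ff c e i) (fun k p => (g i (e i p) - g k (e i p)).comp (E i p)) (σ i) α
        (F i k) C K) (hC : 1 ≤ C) (hK : 1 ≤ K) : ∃ C' : ℝ, 1 ≤ C' ∧ ∀ ε ψ₁ ψ₂, 0 < ε → ε ≤ 1 →
    (∀ v, ε ≤ Gfun X c μ ψ₁ v) → (∀ v, ε ≤ Gfun X c μ ψ₂ v) → ∀ i k, k ≠ i →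
    |F i k (shf i ψ₁) - F i k (shf i ψ₂)| ≤ C' / ε^2 * ‖ψ₁ - ψ₂‖ ^ α := by
  obtain ⟨c1, c2, hc1, hc11, hc2, hc21, hT⟩ := transK H hF hC
  refine ⟨4 * C * K / c2 + 2 * C / c1^2, ?_, ?_⟩
  · have h1 : 0 ≤ 4 * C * K / c2 := by positivity
    have h2 : 1 ≤ 2 * C / c1^2 := by
      rw [le_div_iff₀ (by positivity)]; nlinarith
    linarith
  intro ε ψ₁ ψ₂ hε hε1 h1 h2 i k hki
  by_cases hne : ψ₁ = ψ₂
  · rw [hne]; simp [Real.zero_rpow hα.ne']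
  have hd : 0 < ‖ψ₁ - ψ₂‖ := norm_pos_iff.2 (sub_ne_zero.2 hne)
  set d := ‖ψ₁ - ψ₂‖ with hdd
  have hdα : 0 < d ^ α := Real.rpow_pos_of_pos hd _
  have hτ : (2 * d) ^ α ≤ 2 * d ^ α := by
    rw [Real.mul_rpow (by norm_num) hd.le]
    gcongr
    exact Real.rpow_le_self_of_one_le (by norm_num) hα1
  have hs := shf_sub i ψ₁ ψ₂
  rcases le_or_gt (K * (2 * d)) (c2 * ε) with hle | hgt
  · have := (hF i k hki).hol _ _ (2 * d) (c2 * ε) (c1 * ε) (by positivity) hs hle (by nlinarith)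
      (by positivity) (by nlinarith) (hT ε ψ₁ hε h1 i k hki) (hT ε ψ₂ hε h2 i k hki)
    refine this.trans ?_
    calc C * (2 * d)^α / (c1 * ε)^2 ≤ C * (2 * d^α) / (c1 * ε)^2 := by gcongr
      _ = (2 * C / c1^2) / ε^2 * d^α := by field_simp
      _ ≤ _ := by
        gcongr
        have : 0 ≤ 4 * C * K / c2 := by positivity
        linarith
  · have hb1 := (hF i k hki).bdd (shf i ψ₁)
    have hb2 := (hF i k hki).bdd (shf i ψ₂)
    have h3 : |F i k (shf i ψ₁) - F i k (shf i ψ₂)| ≤ 2 * C := by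
      have := abs_sub (F i k (shf i ψ₁)) (F i k (shf i ψ₂))
      linarith
    have h4 : 1 ≤ K / (c2 * ε) * (2 * d ^ α) := by
      have h5 : 1 ≤ (K / (c2 * ε) * (2 * d)) ^ α := by
        apply Real.one_le_rpow _ hα.le
        rw [div_mul_eq_mul_div, le_div_iff₀ (by positivity)]; linarith
      rw [Real.mul_rpow (by positivity) (by positivity)] at h5
      have h6 : (K / (c2 * ε)) ^ α ≤ K / (c2 * ε) := by
        apply Real.rpow_le_self_of_one_le _ hα1
        rw [le_div_iff₀ (by positivity)]
        nlinarith
      refine h5.trans ?_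
      exact mul_le_mul h6 hτ (by positivity) (by positivity)
    refine h3.trans ?_
    calc 2 * C ≤ 2 * C * (K / (c2 * ε) * (2 * d ^ α)) := le_mul_of_one_le_right (by positivity) h4
      _ = (4 * C * K / c2) / ε * d ^ α := by field_simp; ring
      _ ≤ (4 * C * K / c2) / ε^2 * d ^ α := by
        gcongr ?_ * _
        gcongr
        nlinarith
      _ ≤ _ := by
        gcongr
        have : 0 ≤ 2 * C / c1^2 := by positivity
        linarith

lemma Gmain (hn : 2 ≤ n) (hα : 0 < α) (hα1 : α ≤ 1) (H : Charts X c μ α Xi e j E J g σ B m0 M R) :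
    ∃ (D : Fin N → (Fin N → ℝ) → ((Fin N → ℝ) →L[ℝ] ℝ)) (C : ℝ), 1 ≤ C ∧ ∀ i,
      (∀ ψ, ‖D i ψ‖ ≤ C) ∧ (∀ ψ ψ', |Gfun X c μ ψ' i - Gfun X c μ ψ i| ≤ C * ‖ψ' - ψ‖) ∧
      (∀ ε ψ, 0 < ε → ε ≤ 1 → (∀ v, ε ≤ Gfun X c μ ψ v) →
        HasFDerivAt (fun ψ => Gfun X c μ ψ i) (D i ψ) ψ) ∧
      (∀ ε ψ₁ ψ₂, 0 < ε → ε ≤ 1 → (∀ v, ε ≤ Gfun X c μ ψ₁ v) → (∀ v, ε ≤ Gfun X c μ ψ₂ v) →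
        ‖D i ψ₁ - D i ψ₂‖ ≤ C / ε^2 * ‖ψ₁ - ψ₂‖ ^ α) := by
  obtain ⟨F, C, K, hC, hK, hF⟩ := allF hn hα hα1 H
  obtain ⟨C', hC', hhol⟩ := holderK hα hα1 H hF hC hK
  set Lc : Fin N → (Fin N → ℝ) → Fin N → ℝ := fun i ψ k => if k = i then 0 else F i k (shf i ψ) with hLc
  set pj : Fin N → ((Fin N → ℝ) →L[ℝ] ℝ) := fun k => ContinuousLinearMap.proj k with hpj
  have hpn : ∀ k i, ‖pj k - pj i‖ ≤ 2 := by
    intro k i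
    refine ContinuousLinearMap.opNorm_le_bound _ (by norm_num) fun x => ?_
    have h1 := norm_le_pi_norm x k
    have h2 := norm_le_pi_norm x i
    have h3 : (pj k - pj i) x = x k - x i := rfl
    rw [h3]
    exact (norm_sub_le _ _).trans (by linarith)
  refine ⟨fun i ψ => ∑ k, Lc i ψ k • (pj k - pj i), 1 + 2 * N * C + 2 * N * C', ?_, ?_⟩
  · have : 0 ≤ 2 * N * C + 2 * N * C' := by positivity
    linarith
  intro i
  refine ⟨?_, ?_, ?_, ?_⟩
  · intro ψ
    refine (norm_sum_le _ _).trans ?_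
    have : ∀ k ∈ Finset.univ, ‖Lc i ψ k • (pj k - pj i)‖ ≤ C * 2 := by
      intro k _
      rw [norm_smul]
      refine mul_le_mul ?_ (hpn k i) (norm_nonneg _) (by linarith)
      simp only [hLc]
      split_ifs with h
      · simp; linarith
      · exact (hF i k h).bdd _
    refine (Finset.sum_le_sum this).trans ?_
    simp
    have : 0 ≤ 2 * N * C' := by positivity
    linarith
  · intro ψ ψ'
    refine (G_lip H hF hC i ψ ψ').trans (mul_le_mul_of_nonneg_right ?_ (norm_nonneg _))
    have : 0 ≤ 2 * N * C' := by positivity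
    linarith
  · intro ε ψ hε hε1 hG
    rw [hasFDerivAt_iff_isLittleO, Asymptotics.isLittleO_iff]
    intro η hη
    set ω := η / (2 * N + 1) with hω
    have hω0 : 0 < ω := by positivity
    have ev1 : ∀ᶠ ψ' in nhds ψ, C' / (ε/2)^2 * (2 * ‖ψ' - ψ‖) ^ α < ω := by
      have hcont : Continuous (fun ψ' : Fin N → ℝ => C' / (ε/2)^2 * (2 * ‖ψ' - ψ‖) ^ α) := by
        refine continuous_const.mul (Continuous.rpow_const (by fun_prop) fun _ => Or.inr hα.le)
      refine hcont.continuousAt.eventually_lt continuousAt_const ?_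
      simp [Real.zero_rpow hα.ne', hω0]
    have ev2 : ∀ᶠ ψ' in nhds ψ, 2 * N * C * (2 * ‖ψ' - ψ‖) < ε / 2 := by
      have hcont : Continuous (fun ψ' : Fin N → ℝ => 2 * N * C * (2 * ‖ψ' - ψ‖)) := by fun_prop
      refine hcont.continuousAt.eventually_lt continuousAt_const ?_
      simp [hε]
    filter_upwards [ev1, ev2] with ψ' h1 h2
    have ht := tele (fun t => ∫ p in cellSet i (Xi i) (ff c e i) t, σ i p) (shf i ψ) (shf i ψ')
      (Lc i ψ) ω (by
        intro k u hu
        by_cases hki : k = i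
        · rw [cellSet_congr (t := Function.update u k (shf i ψ' k)) (t' := Function.update u k (shf i ψ k))]
          · simp [hLc, hki]; positivity
          · intro l hl
            rw [Function.update_of_ne (hki ▸ hl), Function.update_of_ne (hki ▸ hl)]
        · have hui : u i = 0 := by
            have := hu i
            simpa [shf] using this
          refine ((hF i k hki).inc u (shf i ψ k) (shf i ψ' k) (Lc i ψ k) ω ?_).trans
            (mul_le_mul_of_nonneg_left (norm_le_pi_norm (shf i ψ' - shf i ψ) k) hω0.le)
          intro r hr
          simp only [hLc, if_neg hki]
          set v := Function.update u k r with hv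
          have hvi : v i = 0 := by rw [hv, Function.update_of_ne (Ne.symm hki)]; exact hui
          have hsv : shf i v = v := by ext l; simp [shf, hvi]
          have hss : shf i (shf i ψ) = shf i ψ := by ext l; simp [shf]
          have hvd : ‖v - shf i ψ‖ ≤ 2 * ‖ψ' - ψ‖ := by
            refine le_trans ?_ (shf_sub i ψ' ψ)
            rw [pi_norm_le_iff_of_nonneg (norm_nonneg _)]
            intro l
            refine le_trans ?_ (norm_le_pi_norm (shf i ψ' - shf i ψ) l)
            have : v l ∈ uIcc (shf i ψ l) (shf i ψ' l) := by
              by_cases hl : l = k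
              · subst hl; simpa [hv] using hr
              · rw [hv, Function.update_of_ne hl]; exact hu l
            exact abs_sub_left_of_mem_uIcc this
          have hGv : ∀ m, ε / 2 ≤ Gfun X c μ v m := by
            intro m
            have h3 := G_lip H hF hC m (shf i ψ) v
            rw [G_shf H] at h3
            have h4 := (abs_le.1 h3).1
            have h5 := hG m
            have h6 : 2 * N * C * ‖v - shf i ψ‖ ≤ 2 * N * C * (2 * ‖ψ' - ψ‖) :=
              mul_le_mul_of_nonneg_left hvd (by positivity)
            linarith
          have hGs : ∀ m, ε / 2 ≤ Gfun X c μ (shf i ψ) m := by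
            intro m; rw [G_shf H]; linarith [hG m]
          have := hhol (ε/2) v (shf i ψ) (by positivity) (by linarith) hGv hGs i k hki
          rw [hsv, hss] at this
          refine this.trans (le_trans ?_ h1.le)
          gcongr)
    have e1 : ∀ ψ, Gfun X c μ ψ i = ∫ p in cellSet i (Xi i) (ff c e i) (shf i ψ), σ i p :=
      fun ψ => H.Gint ψ i
    rw [e1, e1]
    have e2 : (∑ k, Lc i ψ k • (pj k - pj i)) (ψ' - ψ)
        = ∑ k, Lc i ψ k * (shf i ψ' k - shf i ψ k) := by
      rw [ContinuousLinearMap.sum_apply]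
      refine Finset.sum_congr rfl fun k _ => ?_
      have : (Lc i ψ k • (pj k - pj i)) (ψ' - ψ) = Lc i ψ k * ((ψ' k - ψ k) - (ψ' i - ψ i)) := rfl
      rw [this]; simp only [shf]; ring
    rw [e2]
    refine ht.trans ?_
    have h7 := mul_le_mul_of_nonneg_left (shf_sub i ψ' ψ) (by positivity : 0 ≤ N * ω)
    refine h7.trans ?_
    have h8 : N * ω * 2 ≤ η := by
      rw [hω, mul_div_assoc', div_mul_eq_mul_div, div_le_iff₀ (by positivity)]
      nlinarith
    have := mul_le_mul_of_nonneg_right h8 (norm_nonneg (ψ' - ψ))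
    linarith
  · intro ε ψ₁ ψ₂ hε hε1 h1 h2
    rw [← Finset.sum_sub_distrib]
    refine (norm_sum_le _ _).trans ?_
    have : ∀ k ∈ Finset.univ, ‖Lc i ψ₁ k • (pj k - pj i) - Lc i ψ₂ k • (pj k - pj i)‖
        ≤ (C' / ε^2 * ‖ψ₁ - ψ₂‖^α) * 2 := by
      intro k _
      have e0 : Lc i ψ₁ k • (pj k - pj i) - Lc i ψ₂ k • (pj k - pj i)
          = (Lc i ψ₁ k - Lc i ψ₂ k) • (pj k - pj i) := by module
      rw [e0, norm_smul]
      refine mul_le_mul ?_ (hpn k i) (norm_nonneg _) (by positivity)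
      simp only [hLc]
      split_ifs with h
      · simp; positivity
      · exact hhol ε ψ₁ ψ₂ hε hε1 h1 h2 i k h
    refine (Finset.sum_le_sum this).trans ?_
    simp only [Finset.sum_const, Finset.card_univ, Fintype.card_fin, nsmul_eq_mul]
    have e1 : N * (C' / ε^2 * ‖ψ₁ - ψ₂‖^α * 2) = (2 * N * C') / ε^2 * ‖ψ₁ - ψ₂‖^α := by ring
    rw [e1]
    gcongr
    have : 0 ≤ 2 * N * C := by positivity
    linarith
end Asm2
end

section
def rr (t : ℝ) : ℝ := Real.sqrt (1 + t^2) - t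
def gp (t : ℝ) : ℝ := -2 * rr t ^ 2 / Real.sqrt (1 + t^2)

lemma sq1 (t : ℝ) : Real.sqrt (1 + t^2) ^ 2 = 1 + t^2 := Real.sq_sqrt (by positivity)
lemma sq1pos (t : ℝ) : 1 ≤ Real.sqrt (1 + t^2) := by
  rw [Real.one_le_sqrt]; nlinarith [sq_nonneg t]
lemma sq1abs (t : ℝ) : |t| ≤ Real.sqrt (1 + t^2) := by
  apply Real.abs_le_sqrt; linarith
lemma gfun_eq (t : ℝ) : gfun t = 1 + rr t ^ 2 := by
  have := sq1 t
  simp only [gfun, rr]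
  nlinarith
lemma rr_nonneg (t : ℝ) : 0 ≤ rr t := by
  have := (le_abs_self t).trans (sq1abs t); simp only [rr]; linarith
lemma rr_le (t : ℝ) : rr t ≤ 2 * Real.sqrt (1 + t^2) := by
  have := (neg_le_abs t).trans (sq1abs t); simp only [rr]; linarith
lemma rr_bd {A t : ℝ} (hA : 0 ≤ A) (h : -A ≤ t) : rr t ≤ 1 + 2 * A := by
  have h1 : Real.sqrt (1 + t^2) ≤ 1 + |t| := by
    rw [Real.sqrt_le_left (by positivity)]
    nlinarith [sq_abs t, abs_nonneg t]
  simp only [rr]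
  rcases abs_cases t with ⟨h2, _⟩ | ⟨h2, _⟩ <;> rw [h2] at h1 <;> linarith
lemma hasD_sqrt (t : ℝ) : HasDerivAt (fun t : ℝ => Real.sqrt (1 + t^2)) (t / Real.sqrt (1 + t^2)) t := by
  have h1 : HasDerivAt (fun t : ℝ => 1 + t^2) (2 * t) t := by
    have := (hasDerivAt_pow 2 t).const_add 1
    simpa using this
  have h2 := h1.sqrt (by positivity)
  convert h2 using 1
  have := sq1pos t
  field_simp
lemma hasD_rr (t : ℝ) : HasDerivAt rr (- rr t / Real.sqrt (1 + t^2)) t := by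
  have h := (hasD_sqrt t).sub (hasDerivAt_id t)
  have e : t / Real.sqrt (1 + t^2) - 1 = - rr t / Real.sqrt (1 + t^2) := by
    have := sq1pos t
    simp only [rr]; field_simp; ring
  rw [e] at h
  exact h
lemma hasD_g (t : ℝ) : HasDerivAt gfun (gp t) t := by
  have h := ((hasD_rr t).pow 2).const_add 1
  have e1 : gfun = fun t => 1 + rr t ^ 2 := by ext t; exact gfun_eq t
  rw [e1]
  have e2 : gp t = (2:ℕ) * rr t ^ (2 - 1) * (- rr t / Real.sqrt (1 + t^2)) := by
    simp only [gp]; push_cast; ring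
  rw [e2]
  exact h
lemma hasD_gp (t : ℝ) : HasDerivAt gp (2 * rr t ^ 2 * (2 + t / Real.sqrt (1 + t^2)) / Real.sqrt (1 + t^2)^2) t := by
  have h := (((hasD_rr t).pow 2).const_mul (-2)).div (hasD_sqrt t) (by have := sq1pos t; linarith)
  have e1 : 2 * rr t ^ 2 * (2 + t / Real.sqrt (1 + t^2)) / Real.sqrt (1 + t^2)^2
     = ((-2) * ((2:ℕ) * rr t ^ (2 - 1) * (- rr t / Real.sqrt (1 + t^2))) * Real.sqrt (1 + t^2) -
      (-2) * rr t ^ 2 * (t / Real.sqrt (1 + t^2))) / Real.sqrt (1 + t^2)^2 := by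
    have := sq1pos t
    push_cast
    field_simp
    ring
  rw [e1]
  exact h
lemma gp_bd {A t : ℝ} (hA : 0 ≤ A) (h : -A ≤ t) : |gp t| ≤ 4 * (1 + 2 * A) := by
  have h1 := rr_bd hA h
  have h2 := rr_le t
  have h3 := rr_nonneg t
  have h4 := sq1pos t
  simp only [gp]
  rw [abs_div, abs_of_nonneg (by linarith : 0 ≤ Real.sqrt (1 + t^2)), div_le_iff₀ (by linarith), abs_mul,
    abs_of_nonneg (sq_nonneg (rr t))]
  norm_num
  have h5 : rr t ^ 2 ≤ (1 + 2 * A) * (2 * Real.sqrt (1 + t^2)) := by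
    rw [sq]; exact mul_le_mul h1 h2 h3 (by positivity)
  linarith
lemma gpp_bd (t : ℝ) : |2 * rr t ^ 2 * (2 + t / Real.sqrt (1 + t^2)) / Real.sqrt (1 + t^2)^2| ≤ 24 := by
  have h2 := rr_le t
  have h3 := rr_nonneg t
  have h4 := sq1pos t
  have h5 := sq1abs t
  have h6 : |t / Real.sqrt (1 + t^2)| ≤ 1 := by
    rw [abs_div, abs_of_nonneg (by linarith : 0 ≤ Real.sqrt (1 + t^2)), div_le_one (by linarith)]
    exact h5
  rw [abs_div, abs_of_nonneg (by positivity : 0 ≤ Real.sqrt (1 + t^2)^2), div_le_iff₀ (by positivity), abs_mul,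
    abs_of_nonneg (by positivity : 0 ≤ 2 * rr t ^ 2)]
  have h7 : |2 + t / Real.sqrt (1 + t^2)| ≤ 3 := by
    rw [abs_le] at *
    constructor <;> linarith [h6.1, h6.2]
  have h8 : rr t ^ 2 ≤ (2 * Real.sqrt (1 + t^2))^2 := by gcongr
  calc 2 * rr t ^ 2 * |2 + t / Real.sqrt (1 + t^2)| ≤ 2 * (2 * Real.sqrt (1 + t^2))^2 * 3 := by gcongr
    _ = _ := by ring
lemma gp_lip (a b : ℝ) : |gp a - gp b| ≤ 24 * |a - b| :=
  convex_univ.norm_image_sub_le_of_norm_hasDerivWithin_le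
    (fun t _ => (hasD_gp t).hasDerivWithinAt) (fun t _ => gpp_bd t) (mem_univ b) (mem_univ a)
lemma g_lip {A a b : ℝ} (hA : 0 ≤ A) (ha : -A ≤ a) (hb : -A ≤ b) :
    |gfun a - gfun b| ≤ 4 * (1 + 2 * A) * |a - b| :=
  (convex_Ici (-A)).norm_image_sub_le_of_norm_hasDerivWithin_le
    (fun t _ => (hasD_g t).hasDerivWithinAt) (fun t ht => gp_bd hA ht) hb ha
lemma g_bd {A t : ℝ} (hA : 0 ≤ A) (h : -A ≤ t) : |gfun t| ≤ 1 + (1 + 2 * A)^2 := by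
  have h1 := rr_bd hA h
  have h3 := rr_nonneg t
  rw [gfun_eq, abs_of_nonneg (by positivity)]
  gcongr
lemma g_low (t : ℝ) : 0 ≤ gfun t := by rw [gfun_eq]; positivity
lemma g_low2 {t K : ℝ} (hK : 0 ≤ K) (h : gfun t ≤ 2 * K^2) : -K ≤ t := by
  by_contra hc
  push Not at hc
  have h1 : -2 * t ≤ rr t := by
    have := (neg_le_abs t).trans (sq1abs t); simp only [rr]; linarith
  rw [gfun_eq] at h
  nlinarith

lemma powCombine {x L d α : ℝ} (hd : 0 ≤ d) (hα : 0 < α) (hα1 : α ≤ 1) (hL : 0 ≤ L)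
    (h1 : x ≤ L * d) (h2 : x ≤ L) : x ≤ L * d ^ α := by
  rcases hd.eq_or_lt with h0 | h0
  · rw [← h0, Real.zero_rpow hα.ne']; rw [← h0] at h1; exact h1
  rcases le_or_gt d 1 with h | h
  · exact h1.trans (mul_le_mul_of_nonneg_left (holder_help h0 h hα1) hL)
  · refine h2.trans (le_mul_of_one_le_right hL (Real.one_le_rpow h.le hα.le))

lemma eNorm2_ge {N : ℕ} (v : Fin N → ℝ) : ‖v‖ ≤ eNorm2 v := by
  rw [pi_norm_le_iff_of_nonneg (show 0 ≤ eNorm2 v from Real.sqrt_nonneg _)]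
  intro i
  apply Real.abs_le_sqrt
  exact Finset.single_le_sum (f := fun i => v i ^ 2) (fun b _ => sq_nonneg _) (Finset.mem_univ i)

lemma eNorm2_le {N : ℕ} (v : Fin N → ℝ) (b : ℝ) (hb : 0 ≤ b) (h : ∀ i, |v i| ≤ b) : eNorm2 v ≤ N * b := by
  rw [eNorm2, Real.sqrt_le_left (by positivity)]
  have h1 : ∑ i, v i ^ 2 ≤ ∑ _i : Fin N, b^2 := Finset.sum_le_sum fun i _ => by
    rw [← sq_abs]; gcongr; exact h i
  refine h1.trans ?_
  simp
  rcases Nat.eq_zero_or_pos N with h0 | h0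
  · simp [h0]
  · have : (1:ℝ) ≤ N := by exact_mod_cast h0
    nlinarith [sq_nonneg b, mul_nonneg (by linarith : (0:ℝ) ≤ N) (sq_nonneg b)]
end

section

lemma sumG_ge {n N : ℕ} (hN : 1 ≤ N) (X : Set (Pt n)) (c : Pt n → Fin N → ℝ)
    (μ : Measure (Pt n)) [IsProbabilityMeasure μ] (hsupp : μ Xᶜ = 0) (ψ : Fin N → ℝ) :
    1 ≤ ∑ i, Gfun X c μ ψ i := by
  have hne : Nonempty (Fin N) := ⟨⟨0, hN⟩⟩
  have hsub : X ⊆ ⋃ i, LagCell X c ψ i := by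
    intro x hx
    obtain ⟨i, hi⟩ := Finite.exists_max (fun j => -c x j - ψ j)
    exact mem_iUnion.2 ⟨i, lagEq.2 ⟨hx, hi⟩⟩
  have h1 : (1 : ENNReal) ≤ ∑ i, μ (LagCell X c ψ i) := by
    calc (1 : ENNReal) = μ univ := measure_univ.symm
      _ ≤ μ (X ∪ Xᶜ) := by rw [union_compl_self]
      _ ≤ μ X + μ Xᶜ := measure_union_le _ _
      _ = μ X := by rw [hsupp, add_zero]
      _ ≤ μ (⋃ i, LagCell X c ψ i) := measure_mono hsub
      _ ≤ ∑ i, μ (LagCell X c ψ i) := measure_iUnion_fintype_le _ _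
  have h2 : ∑ i, Gfun X c μ ψ i = (∑ i, μ (LagCell X c ψ i)).toReal := by
    rw [ENNReal.toReal_sum (fun i _ => measure_ne_top _ _)]; rfl
  rw [h2, ← ENNReal.toReal_one]
  exact ENNReal.toReal_mono (ENNReal.sum_ne_top.2 fun i _ => measure_ne_top _ _) h1

lemma psiLow {n N : ℕ} (hN : 1 ≤ N) (X : Set (Pt n)) (hX : IsCompact X)
    (c : Pt n → Fin N → ℝ) (hreg : RegCond X c)
    (μ : Measure (Pt n)) (hprob : IsProbabilityMeasure μ) (hsupp : μ Xᶜ = 0) :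
    ∃ B, 1 ≤ B ∧ ∀ (h ε : ℝ) (w : Fin N → ℝ),
      0 < h → h ≤ 1 → 0 < ε → ε < 1 / (2 * N) →
      (∀ i, w i ∈ Icc (0:ℝ) 1) → ∀ ψ ∈ Nset X c μ h ε w, ∀ j, -B ≤ ψ j := by
  obtain ⟨K, hK1, hK⟩ := finBound (N := N) (Q := fun i b => ∀ x ∈ X, ‖c x i‖ ≤ b)
    (fun i b b' hb h p hp => (h p hp).trans hb)
    (fun i => hX.exists_bound_of_continuousOn (hreg i).continuousOn)
  have hN' : (1:ℝ) ≤ N := by exact_mod_cast hN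
  refine ⟨N + 2 * K, by linarith, ?_⟩
  intro h ε w hh hh1 hε hε1 hw ψ hψ j
  obtain ⟨hk, hs⟩ := hψ
  have hne : Nonempty (Fin N) := ⟨⟨0, hN⟩⟩
  have hsum := sumG_ge hN X c μ hsupp ψ
  obtain ⟨i0, hi0⟩ : ∃ i0, (1:ℝ) / N ≤ Gfun X c μ ψ i0 := by
    by_contra hc
    push Not at hc
    have : ∑ i, Gfun X c μ ψ i < ∑ _i : Fin N, (1:ℝ) / N :=
      Finset.sum_lt_sum_of_nonempty Finset.univ_nonempty fun i _ => hc i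
    simp at this
    rw [mul_inv_cancel₀ (by linarith)] at this
    linarith
  have hterm : ∀ i, 0 ≤ wmap X c μ h ε ψ i := fun i =>
    mul_nonneg (sub_nonneg.2 (hk i).le) (g_low _)
  have hle : wmap X c μ h ε ψ i0 ≤ N := by
    have h1 := Finset.single_le_sum (f := fun i => wmap X c μ h ε ψ i) (fun b _ => hterm b) (Finset.mem_univ i0)
    have h2 : ∑ i, w i ≤ ∑ _i : Fin N, (1:ℝ) := Finset.sum_le_sum fun i _ => (hw i).2
    simp at h2 h1
    linarith
  have h3 : 1 / (2 * (N:ℝ)) ≤ Gfun X c μ ψ i0 - ε := by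
    have : (1:ℝ) / N = 1 / (2 * N) + 1 / (2 * N) := by field_simp; norm_num
    linarith
  have h4 : 1 / (2 * (N:ℝ)) * gfun (ψ i0 / h) ≤ N :=
    (mul_le_mul_of_nonneg_right h3 (g_low _)).trans hle
  have h5 : gfun (ψ i0 / h) ≤ 2 * (N:ℝ)^2 := by
    have : gfun (ψ i0 / h) = 2 * N * (1 / (2 * (N:ℝ)) * gfun (ψ i0 / h)) := by field_simp
    rw [this]
    nlinarith
  have h6 := g_low2 (by linarith) h5
  rw [le_div_iff₀ hh] at h6
  have h7 : -(N:ℝ) ≤ ψ i0 := by nlinarith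
  have hne2 : (LagCell X c ψ i0).Nonempty := by
    by_contra hc
    rw [not_nonempty_iff_eq_empty] at hc
    have := hk i0
    simp [Gfun, hc] at this
    linarith
  obtain ⟨x, hx⟩ := hne2
  obtain ⟨hxX, hx⟩ := lagEq.1 hx
  have a1 := abs_le.1 (hK i0 x hxX)
  have a2 := abs_le.1 (hK j x hxX)
  have := hx j
  linarith [a1.1, a1.2, a2.1, a2.2]

section
variable {n N : ℕ} {X : Set (Pt n)} {c : Pt n → Fin N → ℝ} {μ : Measure (Pt n)}

/-- derivative of the i-th component of w -/
def DW (X : Set (Pt n)) (c : Pt n → Fin N → ℝ) (μ : Measure (Pt n)) (D : Fin N → (Fin N → ℝ) → ((Fin N → ℝ) →L[ℝ] ℝ))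
    (h ε : ℝ) (ψ : Fin N → ℝ) (i : Fin N) : (Fin N → ℝ) →L[ℝ] ℝ :=
  gfun (ψ i / h) • D i ψ + ((Gfun X c μ ψ i - ε) * (gp (ψ i / h) / h)) • ContinuousLinearMap.proj i

lemma proj_norm (i : Fin N) : ‖(ContinuousLinearMap.proj i : (Fin N → ℝ) →L[ℝ] ℝ)‖ ≤ 1 :=
  ContinuousLinearMap.opNorm_le_bound _ (by norm_num) fun x => by
    rw [one_mul]; exact norm_le_pi_norm x i

lemma hasD_w {D : Fin N → (Fin N → ℝ) → ((Fin N → ℝ) →L[ℝ] ℝ)} {h ε : ℝ} {ψ : Fin N → ℝ}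
    (hD : ∀ i, HasFDerivAt (fun ψ => Gfun X c μ ψ i) (D i ψ) ψ) :
    HasFDerivAt (wmap X c μ h ε) (ContinuousLinearMap.pi (DW X c μ D h ε ψ)) ψ := by
  rw [hasFDerivAt_pi]
  intro i
  have h1 : HasFDerivAt (fun ψ => Gfun X c μ ψ i - ε) (D i ψ) ψ := (hD i).sub_const ε
  have h0 : HasFDerivAt (fun ψ : Fin N → ℝ => ψ i) (ContinuousLinearMap.proj i : (Fin N → ℝ) →L[ℝ] ℝ) ψ :=
    (ContinuousLinearMap.proj (R := ℝ) (φ := fun _ : Fin N => ℝ) i).hasFDerivAt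
  have h2 : HasDerivAt (fun t => gfun (t / h)) (gp (ψ i / h) * (1 / h)) (ψ i) :=
    HasDerivAt.comp (h₂ := gfun) (h := fun t => t / h) (ψ i) (hasD_g (ψ i / h)) ((hasDerivAt_id (ψ i)).div_const h)
  have h3 : HasFDerivAt (fun ψ : Fin N → ℝ => gfun (ψ i / h))
      ((gp (ψ i / h) * (1 / h)) • (ContinuousLinearMap.proj i : (Fin N → ℝ) →L[ℝ] ℝ)) ψ :=
    HasDerivAt.comp_hasFDerivAt (h₂ := fun t => gfun (t / h)) (f := fun ψ : Fin N → ℝ => ψ i) ψ h2 h0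
  have h4 := h1.mul h3
  refine h4.congr_fderiv ?_
  rw [DW, smul_smul, add_comm]
  congr 2
  ring

lemma piNorm {L : Fin N → ((Fin N → ℝ) →L[ℝ] ℝ)} {b : ℝ} (hb : 0 ≤ b) (h : ∀ i, ‖L i‖ ≤ b) :
    ‖(ContinuousLinearMap.pi L : (Fin N → ℝ) →L[ℝ] (Fin N → ℝ))‖ ≤ b := by
  refine ContinuousLinearMap.opNorm_le_bound _ hb fun x => ?_
  rw [pi_norm_le_iff_of_nonneg (by positivity)]
  intro i
  exact ((L i).le_opNorm x).trans (mul_le_mul_of_nonneg_right (h i) (norm_nonneg _))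

lemma gbds {B h t : ℝ} (hB : 1 ≤ B) (hh : 0 < h) (hh1 : h ≤ 1) (ht : -B ≤ t) :
    |gfun (t / h)| ≤ 10 * B^2 / h^2 ∧ |gp (t/h)| ≤ 12 * B / h := by
  have hA : 0 ≤ B / h := by positivity
  have h1 : -(B/h) ≤ t / h := by rw [← neg_div]; gcongr
  have h2 : 1 ≤ B / h := by rw [le_div_iff₀ hh]; linarith
  have h3 := g_bd hA h1
  have h4 := gp_bd hA h1
  constructor
  · have e : 10 * B^2 / h^2 = 10 * (B/h)^2 := by rw [div_pow]; ring
    rw [e]; nlinarith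
  · have e : 12 * B / h = 12 * (B/h) := by ring
    rw [e]; linarith

lemma glips {B h t s : ℝ} (hB : 1 ≤ B) (hh : 0 < h) (hh1 : h ≤ 1) (ht : -B ≤ t) (hs : -B ≤ s) :
    |gfun (t / h) - gfun (s/h)| ≤ 12 * B / h^2 * |t - s| ∧ |gp (t/h) - gp (s/h)| ≤ 24 / h * |t - s| := by
  have hA : 0 ≤ B / h := by positivity
  have h1 : -(B/h) ≤ t / h := by rw [← neg_div]; gcongr
  have h1' : -(B/h) ≤ s / h := by rw [← neg_div]; gcongr
  have h2 : 1 ≤ B / h := by rw [le_div_iff₀ hh]; linarith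
  have h3 := g_lip hA h1 h1'
  have h4 := gp_lip (t/h) (s/h)
  have e : |t/h - s/h| = |t - s| / h := by rw [← sub_div, abs_div, abs_of_pos hh]
  rw [e] at h3 h4
  constructor
  · refine h3.trans ?_
    have : 4 * (1 + 2 * (B/h)) * (|t-s|/h) ≤ 12 * (B/h) * (|t-s|/h) :=
      mul_le_mul_of_nonneg_right (by linarith) (by positivity)
    refine this.trans (le_of_eq ?_)
    field_simp
  · refine h4.trans (le_of_eq ?_); ring

lemma G_range [IsProbabilityMeasure μ] (ψ : Fin N → ℝ) (i : Fin N) :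
    0 ≤ Gfun X c μ ψ i ∧ Gfun X c μ ψ i ≤ 1 := by
  refine ⟨ENNReal.toReal_nonneg, ?_⟩
  rw [Gfun, ← ENNReal.toReal_one]
  exact ENNReal.toReal_mono (by simp) prob_le_one

lemma DW_bd [IsProbabilityMeasure μ] {D : Fin N → (Fin N → ℝ) → ((Fin N → ℝ) →L[ℝ] ℝ)} {h ε B C : ℝ} {ψ : Fin N → ℝ} {i : Fin N}
    (hB : 1 ≤ B) (hC : 1 ≤ C) (hh : 0 < h) (hh1 : h ≤ 1) (hε : 0 < ε) (hε1 : ε ≤ 1)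
    (ht : -B ≤ ψ i) (hG : ε ≤ Gfun X c μ ψ i) (hD : ‖D i ψ‖ ≤ C) :
    ‖DW X c μ D h ε ψ i‖ ≤ 22 * B^2 * C / h^2 := by
  obtain ⟨g1, g2⟩ := gbds hB hh hh1 ht
  have hG1 := (G_range (X := X) (c := c) (μ := μ) ψ i).2
  have a1 : |Gfun X c μ ψ i - ε| ≤ 1 := by rw [abs_le]; constructor <;> linarith
  rw [DW]
  refine (norm_add_le _ _).trans ?_
  rw [norm_smul, norm_smul, Real.norm_eq_abs, Real.norm_eq_abs, abs_mul, abs_div, abs_of_pos hh]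
  have b1 : |gfun (ψ i / h)| * ‖D i ψ‖ ≤ 10 * B^2 / h^2 * C := by gcongr
  have b2 : |Gfun X c μ ψ i - ε| * (|gp (ψ i / h)| / h) * ‖(ContinuousLinearMap.proj i : (Fin N → ℝ) →L[ℝ] ℝ)‖
      ≤ 1 * ((12 * B / h) / h) * 1 := by gcongr; exact proj_norm i
  refine (add_le_add b1 b2).trans ?_
  have e : 10 * B^2 / h^2 * C + 1 * ((12 * B / h) / h) * 1 = (10 * B^2 * C + 12 * B) / h^2 := by
    field_simp
  rw [e]
  gcongr
  nlinarith [mul_nonneg (sub_nonneg.2 hB) (sub_nonneg.2 hC), sq_nonneg (B-1)]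

lemma DW_hol [IsProbabilityMeasure μ] {D : Fin N → (Fin N → ℝ) → ((Fin N → ℝ) →L[ℝ] ℝ)} {h ε B C α : ℝ} {ψ φ : Fin N → ℝ} {i : Fin N}
    (hα : 0 < α) (hα1 : α ≤ 1)
    (hB : 1 ≤ B) (hC : 1 ≤ C) (hh : 0 < h) (hh1 : h ≤ 1) (hε : 0 < ε) (hε1 : ε ≤ 1)
    (ht : -B ≤ ψ i) (hs : -B ≤ φ i) (hG : ε ≤ Gfun X c μ ψ i) (hG' : ε ≤ Gfun X c μ φ i)
    (hD' : ‖D i φ‖ ≤ C)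
    (hL : |Gfun X c μ ψ i - Gfun X c μ φ i| ≤ C * ‖ψ - φ‖)
    (hH : ‖D i ψ - D i φ‖ ≤ C / ε^2 * ‖ψ - φ‖ ^ α) :
    ‖DW X c μ D h ε ψ i - DW X c μ D h ε φ i‖ ≤ 66 * B^2 * C / (h^2 * ε^2) * ‖ψ - φ‖ ^ α := by
  obtain ⟨g1, g2⟩ := gbds hB hh hh1 ht
  obtain ⟨g1', g2'⟩ := gbds hB hh hh1 hs
  obtain ⟨l1, l2⟩ := glips hB hh hh1 ht hs
  have r1 := G_range (X := X) (c := c) (μ := μ) ψ i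
  have r2 := G_range (X := X) (c := c) (μ := μ) φ i
  have hd : |ψ i - φ i| ≤ ‖ψ - φ‖ := norm_le_pi_norm (ψ - φ) i
  set d := ‖ψ - φ‖ with hdd
  have hd0 : 0 ≤ d := norm_nonneg _
  set G1 := Gfun X c μ ψ i
  set G2 := Gfun X c μ φ i
  have hda : 0 ≤ d ^ α := Real.rpow_nonneg hd0 α
  have hpr := proj_norm (N := N) i
  set p : (Fin N → ℝ) →L[ℝ] ℝ := ContinuousLinearMap.proj i with hp
  have e : DW X c μ D h ε ψ i - DW X c μ D h ε φ i =
      gfun (ψ i / h) • (D i ψ - D i φ) + (gfun (ψ i / h) - gfun (φ i / h)) • D i φ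
      + ((G1 - G2) * (gp (ψ i / h) / h)) • p + ((G2 - ε) * ((gp (ψ i / h) - gp (φ i / h)) / h)) • p := by
    simp only [DW, ← hp]
    change gfun (ψ i / h) • D i ψ + ((G1 - ε) * (gp (ψ i / h) / h)) • p - (gfun (φ i / h) • D i φ + ((G2 - ε) * (gp (φ i / h) / h)) • p) = _
    module
  have hq : 1 ≤ 1 / ε^2 := by
    rw [le_div_iff₀ (by positivity)]; nlinarith
  have t1 : ‖gfun (ψ i / h) • (D i ψ - D i φ)‖ ≤ 10 * B^2 / h^2 * (C / ε^2 * d^α) := by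
    rw [norm_smul, Real.norm_eq_abs]; gcongr
  have s2 : |gfun (ψ i / h) - gfun (φ i / h)| ≤ 20 * B^2 / h^2 * d ^ α := by
    refine powCombine hd0 hα hα1 (by positivity) ?_ ?_
    · refine l1.trans ?_
      gcongr
      · norm_num
      · nlinarith
    · refine (abs_sub _ _).trans ?_
      refine (add_le_add g1 g1').trans (le_of_eq ?_); ring
  have t2 : ‖(gfun (ψ i / h) - gfun (φ i / h)) • D i φ‖ ≤ 20 * B^2 / h^2 * d ^ α * C := by
    rw [norm_smul, Real.norm_eq_abs]; gcongr
  have s3 : |G1 - G2| ≤ C * d^α := by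
    refine powCombine hd0 hα hα1 (by positivity) hL ?_
    rw [abs_le]; constructor <;> linarith [r1.1, r1.2, r2.1, r2.2]
  have t3 : ‖((G1 - G2) * (gp (ψ i / h) / h)) • p‖ ≤ (C * d^α) * (12 * B / h / h) * 1 := by
    rw [norm_smul, Real.norm_eq_abs, abs_mul, abs_div, abs_of_pos hh]; gcongr
  have s4 : |gp (ψ i / h) - gp (φ i / h)| ≤ 24 * B / h * d ^ α := by
    refine powCombine hd0 hα hα1 (by positivity) ?_ ?_
    · refine l2.trans ?_
      gcongr
      nlinarith
    · refine (abs_sub _ _).trans ?_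
      refine (add_le_add g2 g2').trans (le_of_eq ?_); ring
  have a1 : |G2 - ε| ≤ 1 := by rw [abs_le]; constructor <;> linarith [r2.2]
  have t4 : ‖((G2 - ε) * ((gp (ψ i / h) - gp (φ i / h)) / h)) • p‖ ≤ 1 * (24 * B / h * d ^ α / h) * 1 := by
    rw [norm_smul, Real.norm_eq_abs, abs_mul, abs_div, abs_of_pos hh]; gcongr
  rw [e]
  refine (norm_add_le _ _).trans ((add_le_add_left (norm_add₃_le) _).trans ?_)
  refine (add_le_add (add_le_add (add_le_add t1 t2) t3) t4).trans ?_
  have f1 : 10 * B^2 / h^2 * (C / ε^2 * d^α) + 20 * B^2 / h^2 * d ^ α * C + (C * d^α) * (12 * B / h / h) * 1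
      + 1 * (24 * B / h * d ^ α / h) * 1 =
      (10 * B^2 * C * (1/ε^2) + (20 * B^2 * C + 12 * B * C + 24 * B)) * (d^α / h^2) := by
    field_simp; ring
  have f2 : 66 * B^2 * C / (h^2 * ε^2) * d^α = (66 * B^2 * C * (1/ε^2)) * (d^α / h^2) := by
    field_simp
  rw [f1, f2]
  refine mul_le_mul_of_nonneg_right ?_ (by positivity)
  have k0 : B ≤ B^2 := le_self_pow₀ hB (by norm_num)
  have k1 : B * C ≤ B^2 * C := mul_le_mul_of_nonneg_right k0 (by linarith)
  have k2 : B ≤ B^2 * C := k0.trans (le_mul_of_one_le_right (by positivity) hC)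
  have k3 : B^2 * C ≤ B^2 * C * (1/ε^2) := le_mul_of_one_le_right (by positivity) hq
  linarith
end
end

theorem stmt12
    (n N : ℕ) (hn : 2 ≤ n) (hN : 1 ≤ N)
    (X : Set (Pt n)) (hX : IsCompact X)
    (Y : Fin N → Pt n) (hY : Function.Injective Y)
    (c : Pt n → Fin N → ℝ) (hreg : RegCond X c) (htw : TwistCond X c)
    (μ : Measure (Pt n)) (hprob : IsProbabilityMeasure μ)
    (hac : μ ≪ volume) (hsupp : μ Xᶜ = 0)
    (hqc : LoeperCond X c)
    (α : ℝ) (hα : 0 < α) (hα1 : α ≤ 1)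
    (hdens : HolderDensity X μ α) :
    ∃ C > (0:ℝ), ∀ (h ε : ℝ) (w : Fin N → ℝ),
      0 < h → h ≤ 1 → 0 < ε → ε < 1 / (2 * N) →
      (∀ i, w i ∈ Icc (0:ℝ) 1) → 1 ≤ ∑ i, w i →
      (∀ ψ ∈ Nset X c μ h ε w,
        DifferentiableAt ℝ (wmap X c μ h ε) ψ ∧
        eNorm2 (wmap X c μ h ε ψ) + ‖fderiv ℝ (wmap X c μ h ε) ψ‖ ≤
          C * max (h ^ (-2:ℝ) * ε ^ (-2:ℝ)) (h ^ (-3:ℝ) * ε ^ (-(1:ℝ) / 2))) ∧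
      ∀ ψ₁ ∈ Nset X c μ h ε w, ∀ ψ₂ ∈ Nset X c μ h ε w,
        ‖fderiv ℝ (wmap X c μ h ε) ψ₁ - fderiv ℝ (wmap X c μ h ε) ψ₂‖ ≤
          C * max (h ^ (-2:ℝ) * ε ^ (-2:ℝ)) (h ^ (-3:ℝ) * ε ^ (-(1:ℝ) / 2)) *
            eNorm2 (ψ₁ - ψ₂) ^ α := by
  obtain ⟨Xi, e, j, E, J, g, σ, B0, m0, M, R, H⟩ :=
    chartsExist hN X hX c hreg htw μ hprob hac hsupp hqc α hα hα1 hdens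
  obtain ⟨D, C, hC, hG⟩ := Gmain hn hα hα1 H
  obtain ⟨B, hB, hlow⟩ := psiLow hN X hX c hreg μ hprob hsupp
  have hN' : (1:ℝ) ≤ N := by exact_mod_cast hN
  have hB2 : 1 ≤ B^2 := one_le_pow₀ hB
  refine ⟨(10 * N + 66) * B^2 * C, by positivity, ?_⟩
  intro h ε w hh hh1 hε hε1 hw _
  have hε1' : ε ≤ 1 := by
    refine hε1.le.trans ?_
    rw [div_le_one (by positivity)]; linarith
  set Q := max (h ^ (-2:ℝ) * ε ^ (-2:ℝ)) (h ^ (-3:ℝ) * ε ^ (-(1:ℝ) / 2)) with hQ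
  have hQ1 : 1 / (h^2 * ε^2) ≤ Q := by
    refine le_trans (le_of_eq ?_) (le_max_left _ _)
    rw [Real.rpow_neg hh.le, Real.rpow_neg hε.le, Real.rpow_two, Real.rpow_two, one_div, mul_inv]
  have hQ2 : 1 / h^2 ≤ Q := by
    refine le_trans ?_ hQ1
    apply one_div_le_one_div_of_le (by positivity)
    have : ε^2 ≤ 1 := pow_le_one₀ hε.le hε1'
    nlinarith [sq_nonneg h]
  have hder : ∀ ψ ∈ Nset X c μ h ε w,
      HasFDerivAt (wmap X c μ h ε) (ContinuousLinearMap.pi (DW X c μ D h ε ψ)) ψ := fun ψ hψ =>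
    hasD_w fun i => (hG i).2.2.1 ε ψ hε hε1' fun v => (hψ.1 v).le
  have hBC : 0 ≤ B^2 * C := by positivity
  have hQ0 : 0 ≤ Q := le_trans (by positivity) hQ2
  constructor
  · intro ψ hψ
    have hl := hlow h ε w hh hh1 hε hε1 hw ψ hψ
    refine ⟨(hder ψ hψ).differentiableAt, ?_⟩
    rw [(hder ψ hψ).fderiv]
    have b1 : eNorm2 (wmap X c μ h ε ψ) ≤ N * (10 * B^2 / h^2) := by
      refine eNorm2_le _ _ (by positivity) fun i => ?_
      have r := G_range (X := X) (c := c) (μ := μ) ψ i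
      have hk := hψ.1 i
      have a1 : |Gfun X c μ ψ i - ε| ≤ 1 := by rw [abs_le]; constructor <;> linarith [r.2]
      have g1 := (gbds hB hh hh1 (hl i)).1
      rw [wmap, abs_mul]
      calc _ ≤ 1 * (10 * B^2 / h^2) := mul_le_mul a1 g1 (abs_nonneg _) (by norm_num)
        _ = _ := one_mul _
    have b2 := piNorm (L := DW X c μ D h ε ψ) (b := 22 * B^2 * C / h^2) (by positivity)
      (fun i => DW_bd hB hC hh hh1 hε hε1' (hl i) (hψ.1 i).le ((hG i).1 ψ))
    have e1 : N * (10 * B^2 / h^2) = (10 * N * B^2) * (1 / h^2) := by ring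
    have e2 : 22 * B^2 * C / h^2 = (22 * (B^2 * C)) * (1 / h^2) := by ring
    have c1 : (10 * N * B^2) * (1 / h^2) ≤ (10 * N * (B^2 * C)) * Q := by
      refine mul_le_mul ?_ hQ2 (by positivity) (by positivity)
      exact mul_le_mul_of_nonneg_left (le_mul_of_one_le_right (by positivity) hC) (by positivity)
    have c2 : (22 * (B^2 * C)) * (1 / h^2) ≤ (66 * (B^2 * C)) * Q :=
      mul_le_mul (by linarith) hQ2 (by positivity) (by positivity)
    rw [e1] at b1
    rw [e2] at b2
    calc _ ≤ (10 * N * (B^2 * C)) * Q + (66 * (B^2 * C)) * Q :=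
          add_le_add (b1.trans c1) (b2.trans c2)
      _ = _ := by ring
  · intro ψ hψ φ hφ
    have hl := hlow h ε w hh hh1 hε hε1 hw ψ hψ
    have hl' := hlow h ε w hh hh1 hε hε1 hw φ hφ
    rw [(hder ψ hψ).fderiv, (hder φ hφ).fderiv]
    have e0 : (ContinuousLinearMap.pi (DW X c μ D h ε ψ) : (Fin N → ℝ) →L[ℝ] (Fin N → ℝ))
        - ContinuousLinearMap.pi (DW X c μ D h ε φ)
        = ContinuousLinearMap.pi fun i => DW X c μ D h ε ψ i - DW X c μ D h ε φ i := by
      ext v i; rfl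
    have hda : 0 ≤ ‖ψ - φ‖ ^ α := Real.rpow_nonneg (norm_nonneg _) α
    have b2 := piNorm (L := fun i => DW X c μ D h ε ψ i - DW X c μ D h ε φ i)
      (b := 66 * B^2 * C / (h^2 * ε^2) * ‖ψ - φ‖ ^ α) (by positivity)
      (fun i => DW_hol hα hα1 hB hC hh hh1 hε hε1' (hl i) (hl' i) (hψ.1 i).le (hφ.1 i).le
        ((hG i).1 φ) ((hG i).2.1 φ ψ)
        ((hG i).2.2.2 ε ψ φ hε hε1' (fun v => (hψ.1 v).le) (fun v => (hφ.1 v).le)))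
    rw [e0]
    refine b2.trans ?_
    refine mul_le_mul ?_ (Real.rpow_le_rpow (norm_nonneg _) (eNorm2_ge _) hα.le) hda (by positivity)
    have e2 : 66 * B^2 * C / (h^2 * ε^2) = (66 * B^2 * C) * (1 / (h^2 * ε^2)) := by ring
    rw [e2]
    refine mul_le_mul ?_ hQ1 (by positivity) (by positivity)
    have : 0 ≤ N * (B^2 * C) := by positivity
    linarith
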